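/- Suppose that the following holds: whenever a = a(n) is an integer-valued function with μ_a(n) = Θ(n/log² n), then whp χ_{a−1}(G_{n,1/2}) = k_{a−1}(n) + O(n^{0.99}). Then there is a constant c > 0 such that for any sequence of intervals [s_n, t_n] with P(χ(G_{n,1/2}) ∈ [s_n, t_n]) ≥ 0.9 for all n, there exist infinitely many integers n* with t_{n*} − s_{n*} ≥ c · √(n*) · log log n* / (log n*)³. -/

import Mathlib

open Filter Real

/-- Number of edges of a graph on `Fin n`. -/
noncomputable def edgeCount {n : ℕ} (G : SimpleGraph (Fin n)) : ℕ := G.edgeSet.ncard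

/-- The probability that the binomial random graph `G_{n,p}` equals `G`. -/
noncomputable def gnpWeight (n : ℕ) (p : ℝ) (G : SimpleGraph (Fin n)) : ℝ :=
  p ^ edgeCount G * (1 - p) ^ (n.choose 2 - edgeCount G)

open scoped Classical in
/-- The probability that `G_{n,p}` lies in the set `A` of graphs. -/
noncomputable def gnpProb (n : ℕ) (p : ℝ) (A : Set (SimpleGraph (Fin n))) : ℝ :=
  ∑ G : SimpleGraph (Fin n), if G ∈ A then gnpWeight n p G else 0

/-- The chromatic number, as a natural number. -/
noncomputable def chrom {n : ℕ} (G : SimpleGraph (Fin n)) : ℕ := G.chromaticNumber.toNat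

/-- `μ_t(n) = C(n,t) q^C(t,2)`; for `G_{n,1/2}` take `q = 1/2`. -/
noncomputable def muNat (n t : ℕ) (q : ℝ) : ℝ := (n.choose t : ℝ) * q ^ t.choose 2

/-- `P` is a partition of the vertex set of `G` into independent sets, each of size at most
`t`. -/
def IsIndepPartition {n : ℕ} (G : SimpleGraph (Fin n)) (t : ℕ)
    (P : Finset (Finset (Fin n))) : Prop :=
  (∀ S ∈ P, S.Nonempty ∧ S.card ≤ t ∧ ∀ u ∈ S, ∀ v ∈ S, ¬ G.Adj u v) ∧
  (∀ v : Fin n, ∃! S, S ∈ P ∧ v ∈ S)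

/-- The number of unordered `t`-bounded `k`-colourings of `G` (partitions of the vertex set
into `k` independent sets of size at most `t`). -/
noncomputable def numPartitions {n : ℕ} (k t : ℕ) (G : SimpleGraph (Fin n)) : ℕ :=
  Set.ncard {P : Finset (Finset (Fin n)) | P.card = k ∧ IsIndepPartition G t P}

/-- `E_{n,k,t}`: expected number of unordered `t`-bounded `k`-colourings of `G_{n,1/2}`. -/
noncomputable def EE (n k t : ℕ) : ℝ :=
  ∑ G : SimpleGraph (Fin n), gnpWeight n (1 / 2) G * numPartitions k t G

/-- `k_t(n) = min {k : E_{n,k,t} ≥ 1}`, the `t`-bounded first moment threshold. -/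
noncomputable def kThresh (n t : ℕ) : ℕ := sInf {k : ℕ | 1 ≤ EE n k t}

/-- The `t`-bounded chromatic number `χ_t(G)`. -/
noncomputable def boundedChrom {n : ℕ} (t : ℕ) (G : SimpleGraph (Fin n)) : ℕ :=
  sInf {k : ℕ | ∃ P : Finset (Finset (Fin n)), P.card = k ∧ IsIndepPartition G t P}

namespace ChromNC

/-- The proportion of graphs on `V` with property `P`. -/
noncomputable def frac {V : Type*} (P : SimpleGraph V → Prop) : ℝ :=
  Set.ncard {G | P G} / (Nat.card (SimpleGraph V) : ℝ)

theorem frac_eq {V : Type*} [Fintype (SimpleGraph V)] (P : SimpleGraph V → Prop)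
    [DecidablePred P] :
    frac P = (Finset.univ.filter P).card / (Fintype.card (SimpleGraph V) : ℝ) := by
  unfold frac
  rw [Nat.card_eq_fintype_card, Set.ncard_eq_toFinset_card', Set.toFinset_ofPred]

section Frac

variable {V : Type*} [Fintype V]

theorem frac_mono {P Q : SimpleGraph V → Prop} (h : ∀ G, P G → Q G) : frac P ≤ frac Q := by
  classical
  rw [frac_eq, frac_eq]
  gcongr
  exact h _

omit [Fintype V] in
theorem frac_nonneg (P : SimpleGraph V → Prop) : 0 ≤ frac P := by
  unfold frac; positivity

theorem frac_or_le (P Q : SimpleGraph V → Prop) :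
    frac (fun G => P G ∨ Q G) ≤ frac P + frac Q := by
  classical
  rw [frac_eq, frac_eq, frac_eq, ← add_div]
  gcongr
  have := Finset.card_union_le (Finset.univ.filter P) (Finset.univ.filter Q)
  rw [← Finset.filter_or] at this
  exact_mod_cast this

theorem frac_add_not (P : SimpleGraph V → Prop) : frac P + frac (fun G => ¬ P G) = 1 := by
  classical
  rw [frac_eq, frac_eq, ← add_div, div_eq_one_iff_eq (by positivity)]
  exact_mod_cast Finset.card_filter_add_card_filter_not (s := Finset.univ) P

theorem exists_of_one_lt_frac_add {P Q : SimpleGraph V → Prop} (h : 1 < frac P + frac Q) :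
    ∃ G, P G ∧ Q G := by
  by_contra! hn
  have h1 : frac Q ≤ frac (fun G => ¬ P G) := frac_mono fun G hQ hP => hn G hP hQ
  have := frac_add_not P
  linarith

omit [Fintype V] in
/-- Markov's inequality for the uniform random graph. -/
theorem frac_markov [Fintype (SimpleGraph V)] (X : SimpleGraph V → ℝ) (hX : ∀ G, 0 ≤ X G)
    {t : ℝ} (ht : 0 < t) :
    frac (fun G => t ≤ X G) ≤ (∑ G, X G) / Fintype.card (SimpleGraph V) / t := by
  classical
  rw [frac_eq, div_div, mul_comm, ← div_div]
  gcongr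
  rw [le_div_iff₀ ht]
  calc _ = ∑ G ∈ Finset.univ.filter (fun G => t ≤ X G), t := by simp
    _ ≤ ∑ G ∈ Finset.univ.filter (fun G => t ≤ X G), X G :=
      Finset.sum_le_sum fun G hG => (Finset.mem_filter.1 hG).2
    _ ≤ _ := Finset.sum_le_sum_of_subset_of_nonneg (Finset.filter_subset _ _) fun G _ _ => hX G

end Frac

section Count

variable {V : Type*} [Fintype V] [DecidableEq V]

open scoped Classical in
/-- The graphs avoiding a set `F` of potential edges have proportion `2 ^ (-|F|)`. -/
theorem card_avoid_mul (F : Finset (Sym2 V)) (hF : ∀ e ∈ F, ¬ e.IsDiag) :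
    (Finset.univ.filter fun G : SimpleGraph V => ∀ e ∈ F, e ∉ G.edgeSet).card * 2 ^ F.card =
      Fintype.card (SimpleGraph V) := by
  have key : ∀ F : Finset (Sym2 V), (∀ e ∈ F, ¬ e.IsDiag) →
      (Finset.univ.filter fun G : SimpleGraph V => ∀ e ∈ F, e ∉ G.edgeSet).card =
        2 ^ ((⊤ : SimpleGraph V).edgeFinset.card - F.card) := by
    intro F hF
    have hsub : F ⊆ (⊤ : SimpleGraph V).edgeFinset := by
      intro e he
      simpa using hF e he
    rw [← Finset.card_sdiff_of_subset hsub, ← Finset.card_powerset]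
    refine Finset.card_bij' (fun G _ => G.edgeFinset)
      (fun s _ => SimpleGraph.fromEdgeSet (s : Set (Sym2 V))) ?_ ?_ ?_ ?_
    · intro G hG
      simp only [Finset.mem_filter, Finset.mem_univ, true_and] at hG
      simp only [Finset.mem_powerset]
      intro e he
      simp only [SimpleGraph.mem_edgeFinset] at he
      simp only [Finset.mem_sdiff, SimpleGraph.mem_edgeFinset]
      exact ⟨SimpleGraph.edgeSet_mono le_top he, fun h => hG e h he⟩
    · intro s hs
      simp only [Finset.mem_powerset] at hs
      simp only [Finset.mem_filter, Finset.mem_univ, true_and, SimpleGraph.edgeSet_fromEdgeSet]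
      intro e he h
      exact (Finset.mem_sdiff.1 (hs h.1)).2 he
    · intro G _
      simp
    · intro s hs
      simp only [Finset.mem_powerset] at hs
      ext e
      simp only [SimpleGraph.mem_edgeFinset, SimpleGraph.edgeSet_fromEdgeSet, Set.mem_sdiff,
        Finset.mem_coe, and_iff_left_iff_imp]
      intro he
      have := (Finset.mem_sdiff.1 (hs he)).1
      simpa using this
  have h0 := key ∅ (by simp)
  simp only [Finset.notMem_empty, false_implies, implies_true, Finset.filter_true,
    Finset.card_univ, Finset.card_empty, Nat.sub_zero] at h0
  rw [key F hF, h0, ← pow_add, Nat.sub_add_cancel]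
  refine Finset.card_le_card fun e he => ?_
  simpa using hF e he

theorem frac_avoid (F : Finset (Sym2 V)) (hF : ∀ e ∈ F, ¬ e.IsDiag) :
    frac (fun G : SimpleGraph V => ∀ e ∈ F, e ∉ G.edgeSet) = (1 / 2) ^ F.card := by
  classical
  rw [frac_eq, ← card_avoid_mul F hF]
  push_cast
  rw [one_div, inv_pow, div_mul_eq_div_div, div_self, one_div]
  have := card_avoid_mul F hF
  intro h0
  rw [Nat.cast_eq_zero] at h0
  rw [h0, zero_mul] at this
  exact Fintype.card_ne_zero this.symm

theorem card_simpleGraph_eq : Nat.card (SimpleGraph V) = 2 ^ (Fintype.card V).choose 2 := by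
  classical
  have h := card_avoid_mul (V := V) (⊤ : SimpleGraph V).edgeFinset (by simp)
  rw [SimpleGraph.card_edgeFinset_top_eq_card_choose_two] at h
  rw [Nat.card_eq_fintype_card, ← h, Nat.mul_eq_right (by positivity), Finset.card_eq_one]
  refine ⟨⊥, ?_⟩
  ext G
  simp only [SimpleGraph.mem_edgeFinset, Finset.mem_filter, Finset.mem_univ, true_and,
    Finset.mem_singleton]
  constructor
  · intro hG
    rw [← SimpleGraph.edgeSet_eq_empty, Set.eq_empty_iff_forall_notMem]
    exact fun e he => hG e (SimpleGraph.edgeSet_mono le_top he) he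
  · rintro rfl
    simp

end Count

theorem gnpProb_half (n : ℕ) (A : Set (SimpleGraph (Fin n))) :
    gnpProb n (1 / 2) A = frac (fun G => G ∈ A) := by
  classical
  have hw : ∀ G : SimpleGraph (Fin n), gnpWeight n (1 / 2) G = (1 / 2) ^ n.choose 2 := by
    intro G
    have hle : edgeCount G ≤ n.choose 2 := by
      unfold edgeCount
      have := G.card_edgeFinset_le_card_choose_two
      rw [Fintype.card_fin] at this
      rwa [Set.ncard_eq_toFinset_card']
    unfold gnpWeight
    rw [show (1 : ℝ) - 1 / 2 = 1 / 2 by norm_num, ← pow_add, Nat.add_sub_cancel' hle]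
  unfold gnpProb frac
  rw [← Finset.sum_filter]
  simp only [hw, Finset.sum_const, nsmul_eq_mul]
  rw [Set.ncard_eq_toFinset_card', card_simpleGraph_eq, Fintype.card_fin]
  push_cast
  rw [one_div, inv_pow, ← div_eq_mul_inv]
  congr 3
  ext G
  simp

section McDiarmid

open scoped BigOperators

theorem expect_pi_succ {n : ℕ} (Ω : Fin (n + 1) → Type) [∀ i, Fintype (Ω i)]
    (f : (∀ i, Ω i) → ℝ) :
    𝔼 ω, f ω = 𝔼 x : Ω 0, 𝔼 ω : (∀ i : Fin n, Ω i.succ), f (Fin.cons x ω) := by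
  rw [← Finset.expect_product' (s := Finset.univ) (t := Finset.univ)
    (f := fun x ω => f (Fin.cons x ω)), Finset.univ_product_univ]
  exact (Fintype.expect_equiv (Fin.consEquiv Ω) _ _ fun x => rfl).symm

theorem exp_mul_le_cosh_add {z l : ℝ} (hz : |z| ≤ 1) :
    Real.exp (l * z) ≤ Real.cosh l + z * Real.sinh l := by
  obtain ⟨h1, h2⟩ := abs_le.1 hz
  have := convexOn_exp.2 (Set.mem_univ l) (Set.mem_univ (-l))
    (show 0 ≤ (1 + z) / 2 by linarith) (show 0 ≤ (1 - z) / 2 by linarith) (by ring)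
  simp only [smul_eq_mul] at this
  rw [show (1 + z) / 2 * l + (1 - z) / 2 * -l = l * z by ring] at this
  rw [Real.cosh_eq, Real.sinh_eq]
  linarith

theorem expect_exp_le {n : ℕ} (Ω : Fin n → Type) [∀ i, Fintype (Ω i)] [∀ i, Nonempty (Ω i)]
    (f : (∀ i, Ω i) → ℝ)
    (hf : ∀ (i : Fin n) (ω ω' : ∀ i, Ω i), (∀ j, j ≠ i → ω j = ω' j) → f ω - f ω' ≤ 1)
    (l : ℝ) : 𝔼 ω, Real.exp (l * (f ω - 𝔼 ω', f ω')) ≤ Real.exp (n * (l ^ 2 / 2)) := by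
  induction n with
  | zero =>
    have : Unique (∀ i, Ω i) := Pi.uniqueOfIsEmpty _
    simp
  | succ n ih =>
    set g : Ω 0 → ℝ := fun x => 𝔼 ω : (∀ i : Fin n, Ω i.succ), f (Fin.cons x ω) with hg
    have hE : 𝔼 ω', f ω' = 𝔼 x, g x := expect_pi_succ Ω f
    have hgd : ∀ x y, g x - g y ≤ 1 := by
      intro x y
      rw [hg]
      simp only
      rw [← Finset.expect_sub_distrib]
      refine (Finset.expect_le_expect (g := fun _ => (1 : ℝ)) fun ω _ => ?_).trans ?_
      · apply hf 0
        intro j hj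
        obtain ⟨k, rfl⟩ := Fin.exists_succ_eq.2 hj
        simp
      · simp
    have hz : ∀ x, |g x - 𝔼 x, g x| ≤ 1 := by
      intro x
      rw [abs_le]
      constructor
      · have : 𝔼 y, (g y - g x) ≤ 𝔼 y : Ω 0, (1 : ℝ) :=
          Finset.expect_le_expect fun y _ => hgd y x
        rw [Finset.expect_sub_distrib] at this
        simp at this
        linarith
      · have : 𝔼 y, (g x - g y) ≤ 𝔼 y : Ω 0, (1 : ℝ) :=
          Finset.expect_le_expect fun y _ => hgd x y
        rw [Finset.expect_sub_distrib] at this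
        simp at this
        linarith
    rw [hE, expect_pi_succ]
    calc _ = 𝔼 x : Ω 0, Real.exp (l * (g x - 𝔼 x, g x)) *
          𝔼 ω : (∀ i : Fin n, Ω i.succ), Real.exp (l * (f (Fin.cons x ω) - g x)) := by
          refine Finset.expect_congr rfl fun x _ => ?_
          rw [Finset.mul_expect]
          refine Finset.expect_congr rfl fun ω _ => ?_
          rw [← Real.exp_add]
          congr 1
          ring
      _ ≤ 𝔼 x : Ω 0, (Real.cosh l + (g x - 𝔼 x, g x) * Real.sinh l) *
            Real.exp (n * (l ^ 2 / 2)) := by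
          refine Finset.expect_le_expect fun x _ => ?_
          have h1 := exp_mul_le_cosh_add (l := l) (hz x)
          have h2 := ih (fun i => Ω i.succ) (fun ω => f (Fin.cons x ω)) (by
            intro i ω ω' h
            apply hf i.succ
            intro j
            refine Fin.cases ?_ (fun k => ?_) j
            · intro _; simp
            · intro hk
              simpa using h k fun h' => hk (by rw [h']))
          exact mul_le_mul h1 h2 (Finset.expect_nonneg fun _ _ => (Real.exp_pos _).le)
            ((Real.exp_pos _).le.trans h1)
      _ = Real.cosh l * Real.exp (n * (l ^ 2 / 2)) := by
          rw [← Finset.expect_mul, Finset.expect_add_distrib, ← Finset.expect_mul,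
            Finset.expect_sub_distrib]
          simp
      _ ≤ Real.exp (l ^ 2 / 2) * Real.exp (n * (l ^ 2 / 2)) := by
          gcongr
          exact Real.cosh_le_exp_half_sq l
      _ = _ := by
          rw [← Real.exp_add]
          congr 1
          push_cast
          ring

theorem card_le_of_bounded_diff {n : ℕ} (hn : 0 < n) (Ω : Fin n → Type) [∀ i, Fintype (Ω i)]
    [∀ i, Nonempty (Ω i)] (f : (∀ i, Ω i) → ℝ)
    (hf : ∀ (i : Fin n) (ω ω' : ∀ i, Ω i), (∀ j, j ≠ i → ω j = ω' j) → f ω - f ω' ≤ 1)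
    {t : ℝ} (ht : 0 ≤ t) :
    ((Finset.univ.filter fun ω => 𝔼 ω', f ω' + t ≤ f ω).card : ℝ) ≤
      Fintype.card (∀ i, Ω i) * Real.exp (-(t ^ 2 / (2 * n))) := by
  have hn' : (0 : ℝ) < n := by exact_mod_cast hn
  have h := expect_exp_le Ω f hf (t / n)
  rw [Fintype.expect_eq_sum_div_card, div_le_iff₀ (by positivity)] at h
  have h2 : ((Finset.univ.filter fun ω => 𝔼 ω', f ω' + t ≤ f ω).card : ℝ) *
      Real.exp (t / n * t) ≤ ∑ ω, Real.exp (t / n * (f ω - 𝔼 ω', f ω')) := by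
    rw [← nsmul_eq_mul, ← Finset.sum_const]
    refine (Finset.sum_le_sum fun ω hω => ?_).trans
      (Finset.sum_le_sum_of_subset_of_nonneg (Finset.filter_subset _ _) fun _ _ _ => by positivity)
    have := (Finset.mem_filter.1 hω).2
    gcongr
    linarith
  have h3 := h2.trans h
  rw [← le_div_iff₀ (by positivity)] at h3
  refine h3.trans (le_of_eq ?_)
  rw [mul_comm, mul_div_assoc, ← Real.exp_sub]
  congr 2
  field_simp
  ring

/-- Two-sided concentration in the following form: a function with bounded differences which is at
most `m` with non-negligible probability is at most `m + 2 t` with high probability. -/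
theorem card_lt_of_bounded_diff {n : ℕ} (hn : 0 < n) (Ω : Fin n → Type) [∀ i, Fintype (Ω i)]
    [∀ i, Nonempty (Ω i)] (f : (∀ i, Ω i) → ℝ)
    (hf : ∀ (i : Fin n) (ω ω' : ∀ i, Ω i), (∀ j, j ≠ i → ω j = ω' j) → f ω - f ω' ≤ 1)
    {t m : ℝ} (ht : 0 ≤ t)
    (hm : Fintype.card (∀ i, Ω i) * Real.exp (-(t ^ 2 / (2 * n))) <
      (Finset.univ.filter fun ω => f ω ≤ m).card) :
    ((Finset.univ.filter fun ω => m + 2 * t < f ω).card : ℝ) ≤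
      Fintype.card (∀ i, Ω i) * Real.exp (-(t ^ 2 / (2 * n))) := by
  have h1 := card_le_of_bounded_diff hn Ω (fun ω => - f ω) (fun i ω ω' h => by
    have := hf i ω' ω fun j hj => (h j hj).symm
    linarith) ht
  have h2 := card_le_of_bounded_diff hn Ω f hf ht
  have hlt : 𝔼 ω, f ω < m + t := by
    by_contra! hc
    refine absurd (hm.trans_le ?_) (lt_irrefl _)
    refine le_trans ?_ h1
    refine Nat.cast_le.2 (Finset.card_le_card (Finset.monotone_filter_right _ fun ω _ h => ?_))
    rw [Finset.expect_neg_distrib]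
    linarith
  refine le_trans (Nat.cast_le.2 ?_) h2
  refine Finset.card_le_card (Finset.monotone_filter_right _ fun ω _ h => ?_)
  linarith

end McDiarmid

section Chromatic

/-- A graph on `Fin n` is determined by the adjacency of each vertex to the previous ones. -/
def backEquiv (n : ℕ) : (∀ j : Fin n, Set (Fin j)) ≃ SimpleGraph (Fin n) where
  toFun ω :=
    { Adj := fun x y => (∃ h : x < y, (⟨x, h⟩ : Fin y) ∈ ω y) ∨ ∃ h : y < x, (⟨y, h⟩ : Fin x) ∈ ω x
      symm := ⟨fun _ _ h => h.symm⟩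
      loopless := ⟨fun x h => by simp at h⟩ }
  invFun G := fun j => {i | G.Adj (Fin.castLE j.2.le i) j}
  left_inv ω := by
    funext j
    ext i
    have h1 : Fin.castLE j.2.le i < j := i.2
    simp only [Set.mem_ofPred_eq, h1, exists_true_left, h1.not_gt]
    simp
  right_inv G := by
    ext x y
    simp only [Set.mem_ofPred_eq]
    rcases lt_trichotomy x y with h | h | h
    · simp only [h, h.not_gt, exists_true_left]
      simp
    · subst h; simp
    · simp only [h, h.not_gt, exists_true_left]
      simp [G.adj_comm]

theorem colorable_succ_of_differ {V : Type*} [DecidableEq V] {G G' : SimpleGraph V} (v : V)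
    (h : ∀ x y, x ≠ v → y ≠ v → G'.Adj x y → G.Adj x y) {k : ℕ} (hG : G.Colorable k) :
    G'.Colorable (k + 1) := by
  obtain ⟨c⟩ := hG
  have c' : G'.Coloring (Option (Fin k)) := SimpleGraph.Coloring.mk
    (fun x => if x = v then none else some (c x)) (by
      intro x y hxy
      by_cases hx : x = v <;> by_cases hy : y = v
      · subst hx hy; simp at hxy
      · simp [hx, hy]
      · simp [hx, hy]
      · simpa [hx, hy] using c.valid (h x y hx hy hxy))
  simpa using c'.colorable

theorem chrom_le_iff {n k : ℕ} (G : SimpleGraph (Fin n)) : chrom G ≤ k ↔ G.Colorable k := by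
  have hfin : G.chromaticNumber ≠ ⊤ :=
    SimpleGraph.chromaticNumber_ne_top_iff_exists.2 ⟨_, G.colorable_of_fintype⟩
  rw [← SimpleGraph.chromaticNumber_le_iff_colorable, chrom]
  constructor
  · intro h
    rw [← ENat.natCast_toNat hfin]
    exact_mod_cast h
  · intro h
    exact ENat.toNat_le_of_le_natCast h

theorem chrom_colorable {n : ℕ} (G : SimpleGraph (Fin n)) : G.Colorable (chrom G) :=
  (chrom_le_iff G).1 le_rfl

/-- The chromatic number is concentrated in a window of width `O(√n)`. -/
theorem frac_chrom_le {n : ℕ} (hn : 0 < n) {t m : ℝ} (ht : 0 ≤ t)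
    (hm : Real.exp (-(t ^ 2 / (2 * n))) < frac (fun G : SimpleGraph (Fin n) => chrom G ≤ m)) :
    1 - Real.exp (-(t ^ 2 / (2 * n))) ≤
      frac (fun G : SimpleGraph (Fin n) => chrom G ≤ m + 2 * t) := by
  classical
  have hcard : Fintype.card (∀ j : Fin n, Set (Fin j)) = Fintype.card (SimpleGraph (Fin n)) :=
    Fintype.card_congr (backEquiv n)
  have hpos : (0 : ℝ) < Fintype.card (SimpleGraph (Fin n)) := by exact_mod_cast Fintype.card_pos
  have tr : ∀ P : SimpleGraph (Fin n) → Prop,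
      ((Finset.univ.filter fun ω => P (backEquiv n ω)).card : ℝ) = (Finset.univ.filter P).card := by
    intro P
    norm_cast
    exact Finset.card_equiv (backEquiv n) (by simp)
  have key := card_lt_of_bounded_diff hn (fun j : Fin n => Set (Fin j))
    (fun ω => (chrom (backEquiv n ω) : ℝ)) (by
      intro i ω ω' h
      rw [sub_le_iff_le_add']
      norm_cast
      rw [add_comm, chrom_le_iff, add_comm]
      refine colorable_succ_of_differ i ?_ (chrom_colorable _)
      intro x y hx hy
      simp only [backEquiv, Equiv.coe_fn_mk]
      rw [h x hx, h y hy]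
      exact id) (t := t) (m := m) ht (by
      rw [tr fun G => (chrom G : ℝ) ≤ m, hcard, mul_comm, ← lt_div_iff₀ hpos]
      rwa [frac_eq] at hm)
  rw [tr fun G => m + 2 * t < (chrom G : ℝ), hcard, ← div_le_iff₀' hpos, ← frac_eq] at key
  have := frac_add_not (fun G : SimpleGraph (Fin n) => (chrom G : ℝ) ≤ m + 2 * t)
  simp only [not_le] at this
  linarith

end Chromatic

section SecondMoment

variable {V ι : Type*} [Fintype V] [DecidableEq V] [DecidableEq ι]

open scoped Classical in
/-- The potential edges inside the classes of a partial colouring. -/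
noncomputable def mono (c : V → Option ι) : Finset (Sym2 V) :=
  Finset.univ.filter fun e => ¬ e.IsDiag ∧ ∃ i, ∀ x ∈ e, c x = some i

omit [DecidableEq ι] in
theorem mem_mono {c : V → Option ι} {e : Sym2 V} :
    e ∈ mono c ↔ ¬ e.IsDiag ∧ ∃ i, ∀ x ∈ e, c x = some i := by
  simp [mono]

/-- `c` is a proper partial colouring of `G`. -/
def Avoids (G : SimpleGraph V) (c : V → Option ι) : Prop := ∀ e ∈ mono c, e ∉ G.edgeSet

omit [DecidableEq ι] in
theorem mem_mono_comp (c : V → Option ι) (τ : Equiv.Perm V) (e : Sym2 V) :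
    e ∈ mono (c ∘ τ) ↔ e.map τ ∈ mono c := by
  rw [mem_mono, mem_mono]
  refine and_congr ?_ ?_
  · induction e with | _ x y => simp
  · simp [Sym2.mem_map]

omit [DecidableEq ι] in
theorem avoids_comap (c : V → Option ι) (τ : Equiv.Perm V) (G : SimpleGraph V) :
    Avoids (G.comap τ) (c ∘ τ) ↔ Avoids G c := by
  have he : ∀ e : Sym2 V, e ∈ (G.comap τ).edgeSet ↔ e.map τ ∈ G.edgeSet := by
    intro e
    induction e with | _ x y => simp
  constructor
  · intro h e hem hG
    obtain ⟨e', rfl⟩ : ∃ e', Sym2.map τ e' = e := ⟨e.map τ.symm, by simp [Sym2.map_map]⟩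
    exact h e' ((mem_mono_comp c τ e').2 hem) ((he e').2 hG)
  · intro h e hem hG
    exact h _ ((mem_mono_comp c τ e).1 hem) ((he e).1 hG)

/-- Relabelling the vertices of a graph. -/
def comapEquiv (τ : Equiv.Perm V) : SimpleGraph V ≃ SimpleGraph V where
  toFun G := G.comap τ
  invFun G := G.comap τ.symm
  left_inv G := by ext; simp
  right_inv G := by ext; simp

omit [DecidableEq ι] in
theorem card_inter_mono (c : V → Option ι) (τ ρ : Equiv.Perm V) :
    (mono (c ∘ τ) ∩ mono (c ∘ ρ)).card = (mono c ∩ mono (c ∘ (ρ * τ⁻¹))).card := by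
  refine Finset.card_bij (fun e _ => e.map τ) ?_ ?_ ?_
  · intro e he
    simp only [Finset.mem_inter, mem_mono_comp] at he ⊢
    refine ⟨he.1, ?_⟩
    rw [Sym2.map_map]
    convert he.2 using 2
    simp
  · intro e _ e' _ h
    exact Sym2.map.injective τ.injective h
  · intro e he
    obtain ⟨e', rfl⟩ : ∃ e', Sym2.map τ e' = e := ⟨e.map τ.symm, by simp [Sym2.map_map]⟩
    refine ⟨e', ?_, rfl⟩
    simp only [Finset.mem_inter, mem_mono_comp] at he ⊢
    refine ⟨he.1, ?_⟩
    have := he.2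
    rw [Sym2.map_map] at this
    convert this using 2
    simp

omit [DecidableEq ι] in
theorem card_mono_comp (c : V → Option ι) (τ : Equiv.Perm V) :
    (mono (c ∘ τ)).card = (mono c).card := by
  have h := card_inter_mono c τ τ
  simpa [mul_inv_cancel] using h

/-- The vertices of the class `i` which `ρ` moves to the class `j`. -/
def overlap (c : V → Option ι) (ρ : Equiv.Perm V) (i j : ι) : Finset V :=
  Finset.univ.filter fun x => c x = some i ∧ c (ρ x) = some j

theorem card_inter_mono_le [Fintype ι] (c : V → Option ι) (ρ : Equiv.Perm V) :
    (mono c ∩ mono (c ∘ ρ)).card ≤ ∑ i, ∑ j, (overlap c ρ i j).card.choose 2 := by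
  have hsub : mono c ∩ mono (c ∘ ρ) ⊆ Finset.univ.biUnion fun p : ι × ι =>
      (overlap c ρ p.1 p.2).offDiag.image Sym2.mk.uncurry := by
    intro e he
    simp only [Finset.mem_inter, mem_mono] at he
    obtain ⟨⟨hd, i, hi⟩, -, j, hj⟩ := he
    induction e with | _ x y =>
    simp only [Finset.mem_biUnion, Finset.mem_univ, true_and, Finset.mem_image]
    refine ⟨(i, j), (x, y), ?_, rfl⟩
    simp only [Finset.mem_offDiag, overlap, Finset.mem_filter, Finset.mem_univ, true_and]
    simp at hi hj hd
    tauto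
  refine (Finset.card_le_card hsub).trans (Finset.card_biUnion_le.trans ?_)
  rw [Fintype.sum_prod_type]
  simp [Sym2.card_image_offDiag]

omit [DecidableEq ι] in
theorem frac_avoids (c : V → Option ι) :
    frac (fun G : SimpleGraph V => Avoids G c) = (1 / 2) ^ (mono c).card :=
  frac_avoid _ fun _ he => (mem_mono.1 he).1

omit [DecidableEq ι] in
open scoped Classical in
theorem sum_sq_avoids (c : V → Option ι) :
    ∑ G : SimpleGraph V, ((Finset.univ.filter fun τ : Equiv.Perm V => Avoids G (c ∘ τ)).card : ℝ) ^ 2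
      = Fintype.card (SimpleGraph V) * (1 / 4) ^ (mono c).card * (Fintype.card V).factorial *
        ∑ ρ : Equiv.Perm V, 2 ^ (mono c ∩ mono (c ∘ ρ)).card := by
  have h1 : ∀ G : SimpleGraph V,
      ((Finset.univ.filter fun τ : Equiv.Perm V => Avoids G (c ∘ τ)).card : ℝ) ^ 2 =
      ∑ τ : Equiv.Perm V, ∑ ρ : Equiv.Perm V,
        if (∀ e ∈ mono (c ∘ τ) ∪ mono (c ∘ ρ), e ∉ G.edgeSet) then (1 : ℝ) else 0 := by
    intro G
    rw [Finset.card_filter, Nat.cast_sum, sq, Finset.sum_mul_sum]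
    refine Finset.sum_congr rfl fun τ _ => Finset.sum_congr rfl fun ρ _ => ?_
    have : (∀ e ∈ mono (c ∘ τ) ∪ mono (c ∘ ρ), e ∉ G.edgeSet) ↔
        Avoids G (c ∘ τ) ∧ Avoids G (c ∘ ρ) := by
      simp only [Finset.mem_union, Avoids]
      exact ⟨fun h => ⟨fun e he => h e (Or.inl he), fun e he => h e (Or.inr he)⟩,
        fun h e he => he.elim (h.1 e) (h.2 e)⟩
    rw [if_congr this rfl rfl]
    by_cases hp : Avoids G (c ∘ τ) <;> by_cases hr : Avoids G (c ∘ ρ) <;> simp [hp, hr]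
  simp_rw [h1]
  rw [Finset.sum_comm]
  have h2 : ∀ τ : Equiv.Perm V, (∑ G : SimpleGraph V, ∑ ρ : Equiv.Perm V,
      if (∀ e ∈ mono (c ∘ τ) ∪ mono (c ∘ ρ), e ∉ G.edgeSet) then (1 : ℝ) else 0) =
      Fintype.card (SimpleGraph V) * (1 / 4) ^ (mono c).card *
        ∑ ρ : Equiv.Perm V, 2 ^ (mono c ∩ mono (c ∘ ρ)).card := by
    intro τ
    rw [Finset.sum_comm, ← Equiv.sum_comp (Equiv.mulRight τ⁻¹) (fun ρ : Equiv.Perm V =>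
      (2 : ℝ) ^ (mono c ∩ mono (c ∘ ρ)).card), Finset.mul_sum]
    refine Finset.sum_congr rfl fun ρ _ => ?_
    have h3 := frac_avoid (mono (c ∘ τ) ∪ mono (c ∘ ρ)) (by
      intro e he
      rcases Finset.mem_union.1 he with he | he <;> exact (mem_mono.1 he).1)
    rw [frac_eq, div_eq_iff (by positivity)] at h3
    rw [Finset.sum_boole, h3]
    have h4 := Finset.card_union_add_card_inter (mono (c ∘ τ)) (mono (c ∘ ρ))
    rw [card_inter_mono, card_mono_comp, card_mono_comp, ← two_mul] at h4
    simp only [Equiv.coe_mulRight]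
    rw [mul_comm, mul_assoc]
    congr 1
    rw [show (1 / 4 : ℝ) = (1 / 2) ^ 2 by norm_num, ← pow_mul, ← h4, pow_add, mul_assoc, ← mul_pow]
    norm_num
  simp_rw [h2]
  rw [Finset.sum_const, Finset.card_univ, Fintype.card_perm, nsmul_eq_mul]
  ring

/-- The second moment method for the number of embeddings of a partial colouring. -/
theorem second_moment [Fintype ι] (c : V → Option ι) (A : SimpleGraph V → Prop)
    (hA : ∀ (τ : Equiv.Perm V) (G : SimpleGraph V), A (G.comap τ) ↔ A G) {q : ℝ} (hq : 0 ≤ q)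
    (h : q * frac (fun G => Avoids G c) ≤ frac (fun G => A G ∧ Avoids G c)) :
    q ^ 2 * (Fintype.card V).factorial ≤ frac A *
      ∑ ρ : Equiv.Perm V, ∏ i, ∏ j, (2 : ℝ) ^ (overlap c ρ i j).card.choose 2 := by
  classical
  set S : ℝ := ∑ ρ : Equiv.Perm V, ∏ i, ∏ j, (2 : ℝ) ^ (overlap c ρ i j).card.choose 2 with hS
  set Y : SimpleGraph V → ℝ := fun G =>
    ((Finset.univ.filter fun τ : Equiv.Perm V => Avoids G (c ∘ τ)).card : ℝ) with hY
  have hpos : (0 : ℝ) < Fintype.card (SimpleGraph V) := by exact_mod_cast Fintype.card_pos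
  have hfac : (0 : ℝ) < (Fintype.card V).factorial := by exact_mod_cast Nat.factorial_pos _
  have hsq : ∑ G, Y G ^ 2 ≤ Fintype.card (SimpleGraph V) * (1 / 4) ^ (mono c).card *
      (Fintype.card V).factorial * S := by
    rw [hY, sum_sq_avoids]
    gcongr
    rw [hS]
    refine Finset.sum_le_sum fun ρ _ => ?_
    simp_rw [Finset.prod_pow_eq_pow_sum]
    exact pow_le_pow_right₀ (by norm_num) (card_inter_mono_le c ρ)
  have hfirst : ∑ G ∈ Finset.univ.filter A, Y G = (Fintype.card V).factorial *
      (Fintype.card (SimpleGraph V) * frac (fun G => A G ∧ Avoids G c)) := by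
    rw [frac_eq, mul_div_cancel₀ _ hpos.ne', hY]
    simp_rw [← Finset.sum_boole]
    rw [Finset.sum_comm, ← Fintype.card_perm, ← Finset.card_univ, ← nsmul_eq_mul]
    refine Finset.sum_eq_card_nsmul fun τ _ => ?_
    rw [Finset.sum_filter, ← (comapEquiv τ).sum_comp]
    refine Finset.sum_congr rfl fun G _ => ?_
    have h1 : A (comapEquiv τ G) ↔ A G := hA τ G
    have h2 : Avoids (comapEquiv τ G) (c ∘ τ) ↔ Avoids G c := avoids_comap c τ G
    rw [if_congr h1 rfl rfl, if_congr h2 rfl rfl, ← ite_and]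
  have hcs : (∑ G ∈ Finset.univ.filter A, Y G) ^ 2 ≤
      (Fintype.card (SimpleGraph V) * frac A) * ∑ G, Y G ^ 2 := by
    refine (sq_sum_le_card_mul_sum_sq).trans ?_
    rw [frac_eq, mul_div_cancel₀ _ hpos.ne']
    gcongr
    exact Finset.filter_subset _ _
  rw [hfirst] at hcs
  rw [frac_avoids] at h
  have hfA : 0 ≤ frac A := frac_nonneg A
  have h3 := hcs.trans (mul_le_mul_of_nonneg_left hsq (by positivity))
  have h4 : ((Fintype.card V).factorial * (Fintype.card (SimpleGraph V) *
      (q * (1 / 2) ^ (mono c).card)) : ℝ) ^ 2 ≤ ((Fintype.card V).factorial *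
      (Fintype.card (SimpleGraph V) * frac (fun G => A G ∧ Avoids G c))) ^ 2 := by
    gcongr
  have h5 := h4.trans h3
  set e := (mono c).card
  set N : ℝ := (Fintype.card (SimpleGraph V) : ℝ)
  set f : ℝ := ((Fintype.card V).factorial : ℝ)
  have h6 : (1 / 4 : ℝ) ^ e = ((1 / 2) ^ e) ^ 2 := by
    rw [← pow_mul, mul_comm, pow_mul]; norm_num
  rw [h6] at h5
  have hu : (0 : ℝ) < (1 / 2) ^ e := by positivity
  set u : ℝ := (1 / 2) ^ e
  have h7 : (f * (N * u) ^ 2) * (q ^ 2 * f) ≤ (f * (N * u) ^ 2) * (frac A * S) := by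
    calc _ = (f * (N * (q * u))) ^ 2 := by ring
      _ ≤ _ := h5
      _ = _ := by ring
  exact le_of_mul_le_mul_left h7 (by positivity)

end SecondMoment

section PermCount

variable {V ι : Type*} [Fintype V] [DecidableEq V] [Fintype ι] [DecidableEq ι]

/-- The size of a class of a partial colouring. -/
def csize (c : V → Option ι) (i : ι) : ℕ := (Finset.univ.filter fun x => c x = some i).card

theorem card_perm_agree (T : Finset V) (ρ₀ : Equiv.Perm V) :
    (Finset.univ.filter fun ρ : Equiv.Perm V => ∀ x ∈ T, ρ x = ρ₀ x).card =
      (Fintype.card V - T.card).factorial := by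
  classical
  have h1 : Fintype.card {x // x ∉ T} = Fintype.card V - T.card := by
    rw [Fintype.card_subtype_compl, Fintype.card_coe]
  rw [← h1, ← Fintype.card_perm,
    Fintype.card_congr (Equiv.Perm.subtypeEquivSubtypePerm fun x => x ∉ T), Fintype.card_subtype]
  refine Finset.card_equiv (Equiv.mulLeft ρ₀⁻¹) ?_
  intro ρ
  simp only [Finset.mem_filter, Finset.mem_univ, true_and, not_not, Equiv.coe_mulLeft,
    Equiv.Perm.mul_apply, Equiv.Perm.inv_eq_iff_eq]

theorem card_perm_maps_le (c g : V → Option ι) :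
    (Finset.univ.filter fun ρ : Equiv.Perm V => ∀ x j, g x = some j → c (ρ x) = some j).card ≤
      (Fintype.card V - (Finset.univ.filter fun x => g x ≠ none).card).factorial *
        ∏ j, (csize c j).descFactorial (csize g j) := by
  classical
  set P : Equiv.Perm V → Prop := fun ρ => ∀ x j, g x = some j → c (ρ x) = some j with hP
  let Φ : {ρ // P ρ} → ∀ j : ι, ({x // g x = some j} ↪ {x // c x = some j}) := fun ρ j =>
    ⟨fun x => ⟨ρ.1 x.1, ρ.2 x.1 j x.2⟩, fun x y h => by
      simpa [Subtype.ext_iff] using h⟩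
  have hT : Fintype.card (∀ j : ι, ({x // g x = some j} ↪ {x // c x = some j})) =
      ∏ j, (csize c j).descFactorial (csize g j) := by
    rw [Fintype.card_pi]
    refine Finset.prod_congr rfl fun j _ => ?_
    rw [Fintype.card_embedding_eq, Fintype.card_subtype, Fintype.card_subtype]
    rfl
  rw [← Fintype.card_subtype, ← hT, ← Finset.card_univ (α := {ρ // P ρ}),
    ← Finset.card_univ (α := ∀ j : ι, ({x // g x = some j} ↪ {x // c x = some j}))]
  refine Finset.card_le_mul_card_image_of_maps_to (f := Φ) (fun _ _ => Finset.mem_univ _) _ ?_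
  intro b _
  rcases Finset.eq_empty_or_nonempty (Finset.univ.filter fun ρ => Φ ρ = b) with h | ⟨ρ₀, h₀⟩
  · rw [h]; simp
  · rw [← card_perm_agree _ ρ₀.1]
    refine Finset.card_le_card_of_injOn Subtype.val ?_ Subtype.val_injective.injOn
    intro ρ hρ
    simp only [Finset.coe_filter, Finset.mem_univ, true_and, Set.mem_ofPred_eq] at hρ h₀ ⊢
    rw [Finset.mem_filter] at h₀
    intro x hx
    rw [Finset.mem_filter] at hx
    obtain ⟨j, hj⟩ := Option.ne_none_iff_exists'.1 hx.2
    have h1 : Φ ρ j ⟨x, hj⟩ = Φ ρ₀ j ⟨x, hj⟩ := by rw [hρ, h₀.2]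
    exact congrArg Subtype.val h1

end PermCount

section Numeric

theorem descFactorial_add (n s t : ℕ) :
    n.descFactorial (s + t) = n.descFactorial s * (n - s).descFactorial t := by
  induction t with
  | zero => simp
  | succ t ih =>
    rw [← add_assoc, Nat.descFactorial_succ, ih, Nat.descFactorial_succ, Nat.sub_sub]
    ring

theorem pow_le_descFactorial {n N t : ℕ} (h : N + t ≤ n) : N ^ t ≤ n.descFactorial t := by
  refine le_trans ?_ (Nat.pow_sub_le_descFactorial n t)
  exact Nat.pow_le_pow_left (by omega) _

theorem descFactorial_sum_le {ι : Type*} [Fintype ι] [DecidableEq ι] (s : ι → ℕ) {v a : ℕ}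
    (hv : v ≤ a) (B : Finset ι) (hB : B.card ≤ 1) :
    v.descFactorial (∑ i, s i) ≤ ∏ i, if i ∈ B then v.descFactorial (s i) else a ^ s i := by
  obtain rfl | ⟨b, rfl⟩ : B = ∅ ∨ ∃ b, B = {b} := by
    rcases Nat.le_one_iff_eq_zero_or_eq_one.1 hB with h | h
    · exact Or.inl (Finset.card_eq_zero.1 h)
    · exact Or.inr (Finset.card_eq_one.1 h)
  · simp only [Finset.notMem_empty, if_false, Finset.prod_pow_eq_pow_sum]
    exact (Nat.descFactorial_le_pow _ _).trans (Nat.pow_le_pow_left hv _)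
  · rw [← Finset.add_sum_erase _ _ (Finset.mem_univ b), descFactorial_add,
      ← Finset.mul_prod_erase _ _ (Finset.mem_univ b), if_pos (Finset.mem_singleton_self b)]
    refine Nat.mul_le_mul le_rfl ?_
    rw [Finset.prod_congr rfl fun i hi => if_neg (by
      simpa using (Finset.mem_erase.1 hi).1), Finset.prod_pow_eq_pow_sum]
    exact (Nat.descFactorial_le_pow _ _).trans (Nat.pow_le_pow_left ((Nat.sub_le _ _).trans hv) _)

/-- `M` is a matching between rows and columns. -/
def IsMat {ι : Type*} (M : Finset (ι × ι)) : Prop :=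
  Set.InjOn Prod.fst (M : Set (ι × ι)) ∧ Set.InjOn Prod.snd (M : Set (ι × ι))

theorem IsMat.card_col_le {ι : Type*} [Fintype ι] [DecidableEq ι] {M : Finset (ι × ι)}
    (hM : IsMat M) (j : ι) : (Finset.univ.filter fun i => (i, j) ∈ M).card ≤ 1 := by
  rw [Finset.card_le_one]
  intro i hi i' hi'
  simp only [Finset.mem_filter, Finset.mem_univ, true_and] at hi hi'
  exact congrArg Prod.fst (hM.2 hi hi' rfl)

theorem factorial_mul_prod_le {ι : Type*} [Fintype ι] [DecidableEq ι] {M : Finset (ι × ι)}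
    (hM : IsMat M) (s : ι × ι → ℕ) (v : ι → ℕ) {n N a : ℕ} (hv : ∀ i, v i ≤ a) (hN : 0 < N)
    (hs : N + ∑ p, s p ≤ n) :
    ((n - ∑ p, s p).factorial : ℝ) * ∏ j, ((v j).descFactorial (∑ i, s (i, j)) : ℝ) ≤
      n.factorial * (1 / (n.descFactorial (∑ p ∈ M, s p) : ℝ)) *
        ∏ p, if p ∈ M then ((v p.2).descFactorial (s p) : ℝ) else ((a : ℝ) / N) ^ s p := by
  have h1 : (∏ j, (v j).descFactorial (∑ i, s (i, j))) ≤
      ∏ p : ι × ι, if p ∈ M then (v p.2).descFactorial (s p) else a ^ s p := by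
    rw [Fintype.prod_prod_type_right]
    refine Finset.prod_le_prod' fun j _ => ?_
    have := descFactorial_sum_le (fun i => s (i, j)) (hv j)
      (Finset.univ.filter fun i => (i, j) ∈ M) (hM.card_col_le j)
    simpa using this
  have h2 : (n - ∑ p, s p).factorial * (n.descFactorial (∑ p ∈ M, s p) * N ^ ∑ p ∈ Mᶜ, s p) ≤
      n.factorial := by
    rw [← Nat.factorial_mul_descFactorial (show ∑ p, s p ≤ n by omega)]
    refine Nat.mul_le_mul le_rfl ?_
    have h3 := Finset.sum_add_sum_compl M s
    rw [← h3, descFactorial_add]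
    exact Nat.mul_le_mul le_rfl (pow_le_descFactorial (by omega))
  have h4 : (0 : ℝ) < n.descFactorial (∑ p ∈ M, s p) := by
    have h3 := Finset.sum_add_sum_compl M s
    have : n.descFactorial (∑ p ∈ M, s p) ≠ 0 := by
      rw [Ne, Nat.descFactorial_eq_zero_iff_lt]; omega
    exact_mod_cast Nat.pos_of_ne_zero this
  have hN' : (0 : ℝ) < N := by exact_mod_cast hN
  have h5 : (∏ p : ι × ι, if p ∈ M then ((v p.2).descFactorial (s p) : ℝ) else ((a : ℝ) / N) ^ s p)
      * (N : ℝ) ^ ∑ p ∈ Mᶜ, s p =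
      ∏ p : ι × ι, if p ∈ M then ((v p.2).descFactorial (s p) : ℝ) else (a : ℝ) ^ s p := by
    rw [Finset.prod_ite, Finset.prod_ite, ← Finset.prod_pow_eq_pow_sum, mul_assoc]
    congr 1
    have : (Finset.univ.filter fun p => p ∉ M) = Mᶜ := by ext; simp
    rw [this, ← Finset.prod_mul_distrib]
    refine Finset.prod_congr rfl fun p _ => ?_
    rw [← mul_pow, div_mul_cancel₀ _ hN'.ne']
  have h6 : (0 : ℝ) < (N : ℝ) ^ ∑ p ∈ Mᶜ, s p := by positivity
  rw [← mul_le_mul_iff_left₀ h6, mul_assoc (_ * _) _ ((N : ℝ) ^ _), h5, mul_one_div, div_mul_eq_mul_div,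
    le_div_iff₀ h4]
  calc _ = ((n - ∑ p, s p).factorial * (n.descFactorial (∑ p ∈ M, s p) * N ^ ∑ p ∈ Mᶜ, s p) : ℝ) *
        ∏ j, ((v j).descFactorial (∑ i, s (i, j)) : ℝ) := by ring
    _ ≤ _ := by
      gcongr
      · exact_mod_cast h2
      · exact_mod_cast h1

/-- `v! * 2 ^ C(v, 2)`. -/
noncomputable def gw (v : ℕ) : ℝ := v.factorial * 2 ^ v.choose 2

theorem gw_pos (v : ℕ) : 0 < gw v := by unfold gw; positivity

/-- The weight of the rows used by a matching. -/
noncomputable def rowW {ι : Type*} (n : ℕ) (v : ι → ℕ) (M : Finset (ι × ι)) : ℝ :=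
  (∏ p ∈ M, gw (v p.1)) / n.descFactorial (∑ p ∈ M, v p.1)

/-- The weight of the columns used by a matching. -/
noncomputable def colW {ι : Type*} (n : ℕ) (v : ι → ℕ) (M : Finset (ι × ι)) : ℝ :=
  (∏ p ∈ M, gw (v p.2)) / n.descFactorial (∑ p ∈ M, v p.2)

theorem one_div_descFactorial_le {n s m : ℕ} (hs : s ≤ m) (hm : m ≤ n) :
    1 / (n.descFactorial s : ℝ) ≤ (n : ℝ) ^ (m - s) / n.descFactorial m := by
  have h1 : (0 : ℝ) < n.descFactorial s := by
    exact_mod_cast Nat.pos_of_ne_zero (by rw [Ne, Nat.descFactorial_eq_zero_iff_lt]; omega)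
  have h2 : (0 : ℝ) < n.descFactorial m := by
    exact_mod_cast Nat.pos_of_ne_zero (by rw [Ne, Nat.descFactorial_eq_zero_iff_lt]; omega)
  rw [div_le_div_iff₀ h1 h2, one_mul, mul_comm]
  norm_cast
  conv_lhs => rw [← Nat.add_sub_cancel' hs, descFactorial_add]
  exact Nat.mul_le_mul le_rfl
    ((Nat.descFactorial_le_pow _ _).trans (Nat.pow_le_pow_left (Nat.sub_le _ _) _))

/-- The weight of completing an overlap of size `s` between classes of sizes `x` and `y`. -/
noncomputable def fillW (n x y s : ℕ) : ℝ :=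
  √((n : ℝ) ^ (x - s) / gw x * ((n : ℝ) ^ (y - s) / gw y))

theorem one_div_descFactorial_sum_le {ι : Type*} {M : Finset (ι × ι)} (s : ι × ι → ℕ) (v : ι → ℕ)
    {n : ℕ} (h1 : ∀ p ∈ M, s p ≤ v p.1) (h2 : ∀ p ∈ M, s p ≤ v p.2)
    (hr : ∑ p ∈ M, v p.1 ≤ n) (hc : ∑ p ∈ M, v p.2 ≤ n) :
    1 / (n.descFactorial (∑ p ∈ M, s p) : ℝ) ≤
      (rowW n v M + colW n v M) / 2 * ∏ p ∈ M, fillW n (v p.1) (v p.2) (s p) := by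
  have key : ∀ w : ι × ι → ℕ, (∀ p ∈ M, s p ≤ w p) → ∑ p ∈ M, w p ≤ n →
      1 / (n.descFactorial (∑ p ∈ M, s p) : ℝ) ≤
      ((∏ p ∈ M, gw (w p)) / n.descFactorial (∑ p ∈ M, w p)) *
        ∏ p ∈ M, ((n : ℝ) ^ (w p - s p) / gw (w p)) := by
    intro w hw hn
    refine (one_div_descFactorial_le (Finset.sum_le_sum hw) hn).trans (le_of_eq ?_)
    rw [Finset.prod_div_distrib, Finset.prod_pow_eq_pow_sum, Finset.sum_tsub_distrib _ hw]
    have : ∏ p ∈ M, gw (w p) ≠ 0 := (Finset.prod_pos fun p _ => gw_pos _).ne'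
    field_simp
  have hrow := key (fun p => v p.1) h1 hr
  have hcol := key (fun p => v p.2) h2 hc
  change _ ≤ rowW n v M * _ at hrow
  change _ ≤ colW n v M * _ at hcol
  set X := rowW n v M
  set Y := colW n v M
  set t := 1 / (n.descFactorial (∑ p ∈ M, s p) : ℝ)
  set P := ∏ p ∈ M, ((n : ℝ) ^ (v p.1 - s p) / gw (v p.1)) with hP
  set Q := ∏ p ∈ M, ((n : ℝ) ^ (v p.2 - s p) / gw (v p.2)) with hQ
  have ht : 0 ≤ t := by positivity
  have hX : 0 ≤ X := div_nonneg (Finset.prod_nonneg fun _ _ => (gw_pos _).le) (by positivity)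
  have hY : 0 ≤ Y := div_nonneg (Finset.prod_nonneg fun _ _ => (gw_pos _).le) (by positivity)
  have hP0 : 0 ≤ P := Finset.prod_nonneg fun _ _ => div_nonneg (by positivity) (gw_pos _).le
  have hQ0 : 0 ≤ Q := Finset.prod_nonneg fun _ _ => div_nonneg (by positivity) (gw_pos _).le
  have hf : ∏ p ∈ M, fillW n (v p.1) (v p.2) (s p) = √(P * Q) := by
    rw [hP, hQ, ← Finset.prod_mul_distrib, Real.sqrt_prod]
    · rfl
    · intro p _
      exact mul_nonneg (div_nonneg (by positivity) (gw_pos _).le)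
        (div_nonneg (by positivity) (gw_pos _).le)
  rw [hf]
  have h3 : t ≤ √((X * Y) * (P * Q)) := by
    apply Real.le_sqrt_of_sq_le
    calc t ^ 2 = t * t := sq t
      _ ≤ (X * P) * (Y * Q) := mul_le_mul hrow hcol ht (by positivity)
      _ = _ := by ring
  refine h3.trans ?_
  rw [Real.sqrt_mul (by positivity)]
  refine mul_le_mul_of_nonneg_right ?_ (Real.sqrt_nonneg _)
  rw [Real.sqrt_le_left (by positivity)]
  nlinarith [sq_nonneg (X - Y)]

end Numeric

section Expansion

variable {V ι : Type*} [Fintype V] [DecidableEq V] [Fintype ι] [DecidableEq ι]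

/-- The vertices of class `p.1` sent to class `p.2` by the partial map `g`. -/
def cell (c g : V → Option ι) (p : ι × ι) : Finset V :=
  Finset.univ.filter fun x => c x = some p.1 ∧ g x = some p.2

/-- The target class of each vertex lying in an overlap of size at least two. -/
def target (c : V → Option ι) (ρ : Equiv.Perm V) (x : V) : Option ι :=
  match c x, c (ρ x) with
  | some i, some j => if 2 ≤ (overlap c ρ i j).card then some j else none
  | _, _ => none

/-- The partial maps arising as targets. -/
def IsTarget (c g : V → Option ι) : Prop :=
  (∀ x, c x = none → g x = none) ∧ ∀ p, (cell c g p).card ≠ 1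

omit [Fintype ι] [DecidableEq V] in
theorem target_eq_some {c : V → Option ι} {ρ : Equiv.Perm V} {x : V} {j : ι} :
    target c ρ x = some j ↔
      c (ρ x) = some j ∧ ∃ i, c x = some i ∧ 2 ≤ (overlap c ρ i j).card := by
  unfold target
  rcases h1 : c x with _ | i <;> rcases h2 : c (ρ x) with _ | j'
  · simp
  · simp
  · simp
  · simp only [Option.some.injEq]
    split_ifs with h
    · simp only [Option.some.injEq]
      constructor
      · rintro rfl; exact ⟨rfl, i, rfl, h⟩
      · rintro ⟨rfl, -⟩; rfl
    · simp only [false_iff, not_and, not_exists]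
      rintro rfl i' rfl
      exact h

omit [Fintype ι] [DecidableEq V] in
theorem cell_target (c : V → Option ι) (ρ : Equiv.Perm V) (p : ι × ι) :
    cell c (target c ρ) p =
      if 2 ≤ (overlap c ρ p.1 p.2).card then overlap c ρ p.1 p.2 else ∅ := by
  ext x
  split_ifs with h
  · simp only [cell, overlap, Finset.mem_filter, Finset.mem_univ, true_and, target_eq_some]
    constructor
    · rintro ⟨h1, h2, -⟩; exact ⟨h1, h2⟩
    · rintro ⟨h1, h2⟩; exact ⟨h1, h2, p.1, h1, h⟩
  · simp only [cell, Finset.mem_filter, Finset.mem_univ, true_and, target_eq_some,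
      Finset.notMem_empty, iff_false, not_and, not_exists]
    rintro h1 - i h2
    rw [h1, Option.some.injEq] at h2
    rwa [← h2]

omit [Fintype ι] [DecidableEq V] in
theorem isTarget_target (c : V → Option ι) (ρ : Equiv.Perm V) : IsTarget c (target c ρ) := by
  constructor
  · intro x hx
    unfold target
    rw [hx]
  · intro p
    rw [cell_target]
    split_ifs with h
    · omega
    · simp

omit [DecidableEq V] in
theorem prod_overlap_eq (c : V → Option ι) (ρ : Equiv.Perm V) :
    ∏ i, ∏ j, (2 : ℝ) ^ (overlap c ρ i j).card.choose 2 =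
      ∏ p, (2 : ℝ) ^ (cell c (target c ρ) p).card.choose 2 := by
  rw [Fintype.prod_prod_type]
  refine Finset.prod_congr rfl fun i _ => Finset.prod_congr rfl fun j _ => ?_
  rw [cell_target]
  split_ifs with h
  · rfl
  · congr 1
    rw [Finset.card_empty, Nat.choose_eq_zero_of_lt (by simpa using h : (overlap c ρ i j).card < 2)]
    rfl

theorem IsTarget.csize_eq {c g : V → Option ι} (h : IsTarget c g) (j : ι) :
    csize g j = ∑ i, (cell c g (i, j)).card := by
  unfold csize
  rw [← Finset.card_biUnion]
  · congr 1
    ext x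
    simp only [cell, Finset.mem_filter, Finset.mem_univ, true_and, Finset.mem_biUnion,
      exists_and_right]
    constructor
    · intro hx
      refine ⟨Option.ne_none_iff_exists'.1 fun hc => ?_, hx⟩
      rw [h.1 x hc] at hx
      cases hx
    · exact fun hx => hx.2
  · intro i _ i' _ hne
    rw [Function.onFun, Finset.disjoint_left]
    intro x hx hx'
    simp only [cell, Finset.mem_filter, Finset.mem_univ, true_and] at hx hx'
    rw [hx.1, Option.some.injEq] at hx'
    exact hne hx'.1

theorem card_ne_none_eq (g : V → Option ι) :
    (Finset.univ.filter fun x => g x ≠ none).card = ∑ j, csize g j := by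
  unfold csize
  rw [← Finset.card_biUnion]
  · congr 1
    ext x
    simp [Option.ne_none_iff_exists']
  · intro i _ i' _ hne
    rw [Function.onFun, Finset.disjoint_left]
    intro x hx hx'
    simp only [Finset.mem_filter, Finset.mem_univ, true_and] at hx hx'
    rw [hx, Option.some.injEq] at hx'
    exact hne hx'

theorem IsTarget.sum_card_eq {c g : V → Option ι} (h : IsTarget c g) :
    (Finset.univ.filter fun x => g x ≠ none).card = ∑ p, (cell c g p).card := by
  rw [card_ne_none_eq, Fintype.sum_prod_type_right]
  exact Finset.sum_congr rfl fun j _ => h.csize_eq j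

omit [Fintype ι] [DecidableEq V] in
theorem cell_subset (c g : V → Option ι) (p : ι × ι) :
    cell c g p ⊆ Finset.univ.filter fun x => c x = some p.1 := by
  intro x hx
  simp only [cell, Finset.mem_filter, Finset.mem_univ, true_and] at hx ⊢
  exact hx.1

theorem sum_cell_row_le (c g : V → Option ι) (i : ι) :
    ∑ j, (cell c g (i, j)).card ≤ csize c i := by
  rw [← Finset.card_biUnion]
  · exact Finset.card_le_card (Finset.biUnion_subset.2 fun j _ => cell_subset c g (i, j))
  · intro i _ i' _ hne
    rw [Function.onFun, Finset.disjoint_left]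
    intro x hx hx'
    simp only [cell, Finset.mem_filter, Finset.mem_univ, true_and] at hx hx'
    rw [hx.2, Option.some.injEq] at hx'
    exact hne hx'.2

open scoped Classical in
theorem sum_overlap_le_sum_target (c : V → Option ι) :
    ∑ ρ : Equiv.Perm V, ∏ i, ∏ j, (2 : ℝ) ^ (overlap c ρ i j).card.choose 2 ≤
      ∑ g ∈ Finset.univ.filter (IsTarget c),
        ((Fintype.card V - ∑ p, (cell c g p).card).factorial : ℝ) *
          (∏ j, ((csize c j).descFactorial (∑ i, (cell c g (i, j)).card) : ℝ)) *
          ∏ p, (2 : ℝ) ^ (cell c g p).card.choose 2 := by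
  rw [← Finset.sum_fiberwise_of_maps_to (s := Finset.univ) (t := Finset.univ.filter (IsTarget c))
    (g := target c) (fun ρ _ => by simpa using isTarget_target c ρ)]
  refine Finset.sum_le_sum fun g hg => ?_
  have hg' : IsTarget c g := by simpa using hg
  rw [Finset.sum_congr rfl (g := fun _ => ∏ p, (2 : ℝ) ^ (cell c g p).card.choose 2) (by
    intro ρ hρ
    rw [prod_overlap_eq, (Finset.mem_filter.1 hρ).2]), Finset.sum_const, nsmul_eq_mul]
  gcongr
  have h1 := card_perm_maps_le c g
  rw [hg'.sum_card_eq] at h1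
  simp_rw [hg'.csize_eq] at h1
  have h2 : (Finset.univ.filter fun ρ : Equiv.Perm V => target c ρ = g).card ≤
      (Finset.univ.filter fun ρ : Equiv.Perm V => ∀ x j, g x = some j → c (ρ x) = some j).card := by
    refine Finset.card_le_card (Finset.monotone_filter_right _ fun ρ _ h x j hx => ?_)
    rw [← h] at hx
    exact (target_eq_some.1 hx).1
  exact_mod_cast h2.trans h1

end Expansion

section Expansion

variable {V ι : Type*} [Fintype V] [DecidableEq V] [Fintype ι] [DecidableEq ι]

/-- The pairs of classes with an overlap larger than `h`. -/
def bigCells (c : V → Option ι) (h : ℕ) (g : V → Option ι) : Finset (ι × ι) :=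
  Finset.univ.filter fun p => h < (cell c g p).card

/-- The weight of an overlap of size `s` at `p`. -/
noncomputable def uW (n N a : ℕ) (v : ι → ℕ) (M : Finset (ι × ι)) (p : ι × ι) (s : ℕ) : ℝ :=
  (if p ∈ M then fillW n (v p.1) (v p.2) s * ((v p.2).descFactorial s : ℝ)
    else ((a : ℝ) / N) ^ s) * 2 ^ s.choose 2

theorem fillW_nonneg (n x y s : ℕ) : 0 ≤ fillW n x y s := Real.sqrt_nonneg _

omit [Fintype ι] in
theorem uW_nonneg (n N a : ℕ) (v : ι → ℕ) (M : Finset (ι × ι)) (p : ι × ι) (s : ℕ) :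
    0 ≤ uW n N a v M p s := by
  unfold uW
  split_ifs
  · have := fillW_nonneg n (v p.1) (v p.2) s
    positivity
  · positivity

theorem rowW_nonneg {ι : Type*} (n : ℕ) (v : ι → ℕ) (M : Finset (ι × ι)) : 0 ≤ rowW n v M :=
  div_nonneg (Finset.prod_nonneg fun _ _ => (gw_pos _).le) (Nat.cast_nonneg _)

theorem colW_nonneg {ι : Type*} (n : ℕ) (v : ι → ℕ) (M : Finset (ι × ι)) : 0 ≤ colW n v M :=
  div_nonneg (Finset.prod_nonneg fun _ _ => (gw_pos _).le) (Nat.cast_nonneg _)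

omit [DecidableEq ι] in
theorem two_le_sum_of_ne {f : ι → ℕ} {h : ℕ} {i j : ι} (hij : i ≠ j) (hi : h < f i)
    (hj : h < f j) : 2 * h + 2 ≤ ∑ i, f i := by
  classical
  calc 2 * h + 2 ≤ ∑ x ∈ ({i, j} : Finset ι), f x := by
        rw [Finset.sum_pair hij]; omega
    _ ≤ ∑ i, f i := Finset.sum_le_sum_of_subset (Finset.subset_univ _)

theorem isMat_bigCells {c g : V → Option ι} {a h : ℕ} (hv : ∀ i, csize c i ≤ a)
    (hah : a ≤ 2 * h + 1) (hcol : ∀ j, ∑ i, (cell c g (i, j)).card ≤ csize c j) :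
    IsMat (bigCells c h g) := by
  constructor
  · rintro ⟨i, j⟩ hp ⟨i', j'⟩ hp' (rfl : i = i')
    simp only [bigCells, Finset.coe_filter, Finset.mem_univ, true_and, Set.mem_ofPred_eq] at hp hp'
    by_contra hne
    have := two_le_sum_of_ne (f := fun j => (cell c g (i, j)).card) (fun h => hne (by rw [h]))
      hp hp'
    have := sum_cell_row_le c g i
    have := hv i
    omega
  · rintro ⟨i, j⟩ hp ⟨i', j'⟩ hp' (rfl : j = j')
    simp only [bigCells, Finset.coe_filter, Finset.mem_univ, true_and, Set.mem_ofPred_eq] at hp hp'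
    by_contra hne
    have := two_le_sum_of_ne (f := fun i => (cell c g (i, j)).card) (fun h => hne (by rw [h]))
      hp hp'
    have := hcol j
    have := hv j
    omega

theorem IsMat.sum_fst_le {M : Finset (ι × ι)} (hM : IsMat M) (v : ι → ℕ) :
    ∑ p ∈ M, v p.1 ≤ ∑ i, v i := by
  rw [← Finset.sum_image (f := v) (g := Prod.fst) hM.1]
  exact Finset.sum_le_sum_of_subset (Finset.subset_univ _)

theorem IsMat.sum_snd_le {M : Finset (ι × ι)} (hM : IsMat M) (v : ι → ℕ) :
    ∑ p ∈ M, v p.2 ≤ ∑ i, v i := by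
  rw [← Finset.sum_image (f := v) (g := Prod.snd) hM.2]
  exact Finset.sum_le_sum_of_subset (Finset.subset_univ _)

theorem target_term_le {c g : V → Option ι} {a h N : ℕ}
    (hv : ∀ i, csize c i ≤ a) (hah : a ≤ 2 * h + 1) (hN : 0 < N)
    (hn : N + ∑ i, csize c i ≤ Fintype.card V)
    (hcol : ∀ j, ∑ i, (cell c g (i, j)).card ≤ csize c j) :
    ((Fintype.card V - ∑ p, (cell c g p).card).factorial : ℝ) *
        (∏ j, ((csize c j).descFactorial (∑ i, (cell c g (i, j)).card) : ℝ)) *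
        ∏ p, (2 : ℝ) ^ (cell c g p).card.choose 2 ≤
      (Fintype.card V).factorial * ((rowW (Fintype.card V) (csize c) (bigCells c h g) +
        colW (Fintype.card V) (csize c) (bigCells c h g)) / 2 *
        ∏ p, uW (Fintype.card V) N a (csize c) (bigCells c h g) p (cell c g p).card) := by
  have hM := isMat_bigCells hv hah hcol
  set M := bigCells c h g with hMdef
  set n := Fintype.card V
  set v := csize c
  have hsum : ∑ p, (cell c g p).card ≤ ∑ i, v i := by
    rw [Fintype.sum_prod_type]
    exact Finset.sum_le_sum fun i _ => sum_cell_row_le c g i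
  have h1 := factorial_mul_prod_le hM (fun p => (cell c g p).card) v hv hN
    (by omega : N + ∑ p, (cell c g p).card ≤ n)
  have h2 := one_div_descFactorial_sum_le (M := M) (fun p => (cell c g p).card) v (n := n)
    (fun p _ => (Finset.single_le_sum (f := fun j => (cell c g (p.1, j)).card)
      (fun _ _ => Nat.zero_le _) (Finset.mem_univ p.2)).trans (sum_cell_row_le c g p.1))
    (fun p _ => (Finset.single_le_sum (f := fun i => (cell c g (i, p.2)).card)
      (fun _ _ => Nat.zero_le _) (Finset.mem_univ p.1)).trans (hcol p.2))
    (by have := hM.sum_fst_le v; omega) (by have := hM.sum_snd_le v; omega)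
  calc _ ≤ (n.factorial * ((rowW n v M + colW n v M) / 2 *
          ∏ p ∈ M, fillW n (v p.1) (v p.2) (cell c g p).card) *
        ∏ p, if p ∈ M then ((v p.2).descFactorial (cell c g p).card : ℝ)
          else ((a : ℝ) / N) ^ (cell c g p).card) *
        ∏ p, (2 : ℝ) ^ (cell c g p).card.choose 2 := by
        refine mul_le_mul_of_nonneg_right (h1.trans ?_) (by positivity)
        refine mul_le_mul_of_nonneg_right (mul_le_mul_of_nonneg_left h2 (by positivity)) ?_
        refine Finset.prod_nonneg fun p _ => ?_
        split_ifs <;> positivity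
    _ = _ := by
        have h3 : ∏ p ∈ M, fillW n (v p.1) (v p.2) (cell c g p).card =
            ∏ p, if p ∈ M then fillW n (v p.1) (v p.2) (cell c g p).card else 1 := by
          rw [Finset.prod_ite_mem, Finset.univ_inter]
        have h4 : ∀ p, uW n N a v M p (cell c g p).card =
            (if p ∈ M then fillW n (v p.1) (v p.2) (cell c g p).card else 1) *
            (if p ∈ M then ((v p.2).descFactorial (cell c g p).card : ℝ)
              else ((a : ℝ) / N) ^ (cell c g p).card) * 2 ^ (cell c g p).card.choose 2 := by
          intro p
          unfold uW
          split_ifs <;> ring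
        simp_rw [h4, Finset.prod_mul_distrib, h3]
        ring

/-- The total weight of large overlaps of classes of sizes `x` and `y`. -/
noncomputable def bigQ (n h x y : ℕ) : ℝ :=
  ∑ s ∈ Finset.Ioc h (min x y),
    (x.choose s : ℝ) * y.choose s * s.factorial * 2 ^ s.choose 2 * fillW n x y s

theorem fillW_comm (n x y s : ℕ) : fillW n x y s = fillW n y x s := by
  unfold fillW
  rw [mul_comm]

theorem bigQ_comm (n h x y : ℕ) : bigQ n h x y = bigQ n h y x := by
  unfold bigQ
  rw [min_comm]
  refine Finset.sum_congr rfl fun s _ => ?_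
  rw [fillW_comm]
  ring

theorem bigQ_nonneg (n h x y : ℕ) : 0 ≤ bigQ n h x y :=
  Finset.sum_nonneg fun s _ => mul_nonneg (by positivity) (fillW_nonneg _ _ _ _)

/-- The total weight of small overlaps of a class of size `x`. -/
noncomputable def smallQ (h x : ℕ) (y : ℝ) : ℝ :=
  ∑ s ∈ (Finset.range (h + 1)).filter (· ≠ 1), (x.choose s : ℝ) * 2 ^ s.choose 2 * y ^ s

/-- The sets that may occur as the cell at `p` when the large cells are at `M`. -/
def cellSet (c : V → Option ι) (h : ℕ) (M : Finset (ι × ι)) (p : ι × ι) : Finset (Finset V) :=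
  (Finset.univ.filter fun x => c x = some p.1).powerset.filter fun S =>
    if p ∈ M then h < S.card ∧ S.card ≤ csize c p.2 else S.card ≤ h ∧ S.card ≠ 1

omit [DecidableEq V] [Fintype ι] in
theorem sum_cellSet_big (c : V → Option ι) (n N a h : ℕ) {M : Finset (ι × ι)} {p : ι × ι}
    (hp : p ∈ M) :
    ∑ S ∈ cellSet c h M p, uW n N a (csize c) M p S.card = bigQ n h (csize c p.1) (csize c p.2) := by
  unfold cellSet
  simp only [hp, if_true]
  rw [Finset.sum_filter, Finset.sum_powerset_apply_card
    (fun s => if h < s ∧ s ≤ csize c p.2 then uW n N a (csize c) M p s else 0)]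
  simp only [smul_ite, smul_zero, ← Finset.sum_filter]
  unfold bigQ
  refine Finset.sum_congr ?_ ?_
  · ext s
    rw [Finset.mem_filter, Finset.mem_range, Finset.mem_Ioc, le_min_iff]
    change s < csize c p.1 + 1 ∧ _ ↔ _
    omega
  · intro s _
    unfold uW
    rw [if_pos hp, nsmul_eq_mul, Nat.descFactorial_eq_factorial_mul_choose]
    push_cast
    unfold csize
    ring

omit [DecidableEq V] [Fintype ι] in
theorem sum_cellSet_small (c : V → Option ι) (n N a h : ℕ) {M : Finset (ι × ι)} {p : ι × ι}
    (hp : p ∉ M) :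
    ∑ S ∈ cellSet c h M p, uW n N a (csize c) M p S.card ≤
      smallQ h (csize c p.1) ((a : ℝ) / N) := by
  unfold cellSet
  simp only [hp, if_false]
  rw [Finset.sum_filter, Finset.sum_powerset_apply_card
    (fun s => if s ≤ h ∧ s ≠ 1 then uW n N a (csize c) M p s else 0)]
  simp only [smul_ite, smul_zero, ← Finset.sum_filter]
  unfold smallQ
  refine (Finset.sum_le_sum_of_subset_of_nonneg (t := (Finset.range (h + 1)).filter (· ≠ 1)) ?_
    fun s _ _ => ?_).trans (le_of_eq ?_)
  · intro s
    simp only [Finset.mem_filter, Finset.mem_range]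
    omega
  · exact nsmul_nonneg (uW_nonneg _ _ _ _ _ _ _) _
  · refine Finset.sum_congr rfl fun s _ => ?_
    unfold uW
    rw [if_neg hp, nsmul_eq_mul]
    unfold csize
    ring

omit [DecidableEq V] [Fintype ι] in
theorem cell_injOn (c : V → Option ι) : Set.InjOn (cell c) {g | IsTarget c g} := by
  have key : ∀ g : V → Option ι, IsTarget c g → ∀ x j, g x = some j ↔ ∃ i, x ∈ cell c g (i, j) := by
    intro g hg x j
    simp only [cell, Finset.mem_filter, Finset.mem_univ, true_and]
    constructor
    · intro hx
      obtain ⟨i, hi⟩ : ∃ i, c x = some i := by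
        refine Option.ne_none_iff_exists'.1 fun hc => ?_
        rw [hg.1 x hc] at hx
        cases hx
      exact ⟨i, hi, hx⟩
    · rintro ⟨i, -, h⟩; exact h
  intro g hg g' hg' h
  ext x j
  rw [key g hg, key g' hg', h]

open scoped Classical in
theorem sum_overlap_le_sum_mat (c : V → Option ι) {a h N : ℕ} {σ : ℝ}
    (hv : ∀ i, csize c i ≤ a) (hah : a ≤ 2 * h + 1) (hN : 0 < N)
    (hn : N + ∑ i, csize c i ≤ Fintype.card V) (hσ : 0 ≤ σ)
    (hsmall : ∀ i, smallQ h (csize c i) ((a : ℝ) / N) ≤ 1 + σ) :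
    ∑ ρ : Equiv.Perm V, ∏ i, ∏ j, (2 : ℝ) ^ (overlap c ρ i j).card.choose 2 ≤
      (Fintype.card V).factorial * ((1 + σ) ^ (Fintype.card ι ^ 2) *
        ∑ M ∈ Finset.univ.filter (IsMat (ι := ι)), rowW (Fintype.card V) (csize c) M *
          ∏ p ∈ M, bigQ (Fintype.card V) h (csize c p.1) (csize c p.2)) := by
  refine (sum_overlap_le_sum_target c).trans ?_
  set n := Fintype.card V
  set v := csize c
  have h1 : ∀ g ∈ Finset.univ.filter (IsTarget c),
      ¬ (∀ j, ∑ i, (cell c g (i, j)).card ≤ csize c j) →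
      ((n - ∑ p, (cell c g p).card).factorial : ℝ) *
          (∏ j, ((v j).descFactorial (∑ i, (cell c g (i, j)).card) : ℝ)) *
          ∏ p, (2 : ℝ) ^ (cell c g p).card.choose 2 = 0 := by
    intro g _ hg
    push Not at hg
    obtain ⟨j, hj⟩ := hg
    rw [Finset.prod_eq_zero (Finset.mem_univ j)]
    · simp
    · exact_mod_cast Nat.descFactorial_eq_zero_iff_lt.2 hj
  rw [← Finset.sum_filter_of_ne (fun g hg h0 => by
    by_contra hc
    exact h0 (h1 g hg hc)), Finset.filter_filter]
  set Gs := Finset.univ.filter fun g =>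
    IsTarget c g ∧ ∀ j, ∑ i, (cell c g (i, j)).card ≤ csize c j
  have hGs : ∀ g ∈ Gs, IsTarget c g ∧ ∀ j, ∑ i, (cell c g (i, j)).card ≤ csize c j :=
    fun g hg => (Finset.mem_filter.1 hg).2
  have hrow : ∀ M : Finset (ι × ι), 0 ≤ (rowW n v M + colW n v M) / 2 := fun M => by
    have := rowW_nonneg n v M
    have := colW_nonneg n v M
    linarith
  have hfib : ∀ M : Finset (ι × ι), ∑ g ∈ Gs with bigCells c h g = M,
      ((n - ∑ p, (cell c g p).card).factorial : ℝ) *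
          (∏ j, ((v j).descFactorial (∑ i, (cell c g (i, j)).card) : ℝ)) *
          ∏ p, (2 : ℝ) ^ (cell c g p).card.choose 2 ≤
      n.factorial * ((1 + σ) ^ (Fintype.card ι ^ 2) * ((rowW n v M + colW n v M) / 2 *
          ∏ p ∈ M, bigQ n h (v p.1) (v p.2))) := by
    intro M
    calc _ ≤ ∑ g ∈ Gs with bigCells c h g = M, n.factorial * ((rowW n v M + colW n v M) / 2 *
          ∏ p, uW n N a v M p (cell c g p).card) := by
          refine Finset.sum_le_sum fun g hg => ?_
          obtain ⟨hg', rfl⟩ := Finset.mem_filter.1 hg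
          exact target_term_le hv hah hN hn (hGs g hg').2
      _ = n.factorial * ((rowW n v M + colW n v M) / 2 * ∑ g ∈ Gs with bigCells c h g = M,
          ∏ p, uW n N a v M p (cell c g p).card) := by
          rw [Finset.mul_sum, Finset.mul_sum]
      _ ≤ n.factorial * ((rowW n v M + colW n v M) / 2 *
          ∑ S ∈ Fintype.piFinset (cellSet c h M), ∏ p, uW n N a v M p (S p).card) := by
          refine mul_le_mul_of_nonneg_left (mul_le_mul_of_nonneg_left ?_ (hrow M)) (by positivity)
          rw [← Finset.sum_image (f := fun S : ι × ι → Finset V =>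
            ∏ p, uW n N a v M p (S p).card) (g := cell c)]
          · refine Finset.sum_le_sum_of_subset_of_nonneg ?_ fun S _ _ =>
              Finset.prod_nonneg fun p _ => uW_nonneg _ _ _ _ _ _ _
            intro S hS
            obtain ⟨g, hg, rfl⟩ := Finset.mem_image.1 hS
            obtain ⟨hg', rfl⟩ := Finset.mem_filter.1 hg
            rw [Fintype.mem_piFinset]
            intro p
            rw [cellSet, Finset.mem_filter, Finset.mem_powerset]
            refine ⟨cell_subset c g p, ?_⟩
            split_ifs with hp
            · refine ⟨(Finset.mem_filter.1 hp).2, ?_⟩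
              exact (Finset.single_le_sum (f := fun i => (cell c g (i, p.2)).card)
                (fun _ _ => Nat.zero_le _) (Finset.mem_univ p.1)).trans ((hGs g hg').2 p.2)
            · refine ⟨?_, (hGs g hg').1.2 p⟩
              by_contra hc
              exact hp (Finset.mem_filter.2 ⟨Finset.mem_univ _, not_le.1 hc⟩)
          · intro g hg g' hg' hgg
            exact cell_injOn c (hGs g (Finset.mem_filter.1 hg).1).1
              (hGs g' (Finset.mem_filter.1 hg').1).1 hgg
      _ = n.factorial * ((rowW n v M + colW n v M) / 2 *
          ∏ p, ∑ S ∈ cellSet c h M p, uW n N a v M p S.card) := by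
          rw [Finset.prod_univ_sum]
      _ ≤ n.factorial * ((rowW n v M + colW n v M) / 2 *
          ∏ p, ((if p ∈ M then bigQ n h (v p.1) (v p.2) else 1) * (1 + σ))) := by
          refine mul_le_mul_of_nonneg_left (mul_le_mul_of_nonneg_left ?_ (hrow M)) (by positivity)
          refine Finset.prod_le_prod (fun p _ => Finset.sum_nonneg fun S _ => uW_nonneg ..)
            fun p _ => ?_
          split_ifs with hp
          · rw [sum_cellSet_big c n N a h hp]
            exact le_mul_of_one_le_right (bigQ_nonneg ..) (by linarith)
          · rw [one_mul]
            exact (sum_cellSet_small c n N a h hp).trans (hsmall p.1)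
      _ = _ := by
          rw [Finset.prod_mul_distrib, Finset.prod_ite_mem, Finset.univ_inter, Finset.prod_const,
            Finset.card_univ, Fintype.card_prod]
          ring
  rw [← Finset.sum_fiberwise_of_maps_to (s := Gs) (t := Finset.univ.filter (IsMat (ι := ι)))
    (g := bigCells c h) (fun g hg => by simpa using isMat_bigCells hv hah (hGs g hg).2)]
  refine (Finset.sum_le_sum fun M _ => hfib M).trans (le_of_eq ?_)
  rw [← Finset.mul_sum, ← Finset.mul_sum]
  congr 2
  have hswap : ∑ M ∈ Finset.univ.filter (IsMat (ι := ι)), colW n v M *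
        ∏ p ∈ M, bigQ n h (v p.1) (v p.2) =
      ∑ M ∈ Finset.univ.filter (IsMat (ι := ι)), rowW n v M *
        ∏ p ∈ M, bigQ n h (v p.1) (v p.2) := by
    refine Finset.sum_equiv (Equiv.finsetCongr (Equiv.prodComm ι ι)) ?_ ?_
    · intro M
      simp only [Finset.mem_filter, Finset.mem_univ, true_and, IsMat, Equiv.finsetCongr_apply,
        Finset.coe_map, Equiv.coe_toEmbedding, Set.InjOn]
      constructor
      · rintro ⟨h1, h2⟩
        constructor <;> rintro _ ⟨x, hx, rfl⟩ _ ⟨y, hy, rfl⟩ hxy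
        · rw [h2 hx hy hxy]
        · rw [h1 hx hy hxy]
      · rintro ⟨h1, h2⟩
        constructor <;> intro x hx y hy hxy
        · exact (Equiv.prodComm ι ι).injective (h2 ⟨x, hx, rfl⟩ ⟨y, hy, rfl⟩ hxy)
        · exact (Equiv.prodComm ι ι).injective (h1 ⟨x, hx, rfl⟩ ⟨y, hy, rfl⟩ hxy)
    · intro M _
      simp only [rowW, colW, Equiv.finsetCongr_apply, Finset.prod_map, Finset.sum_map,
        Equiv.coe_toEmbedding, Equiv.prodComm_apply, Prod.fst_swap]
      congr 1
      exact Finset.prod_congr rfl fun p _ => bigQ_comm _ _ _ _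
  simp_rw [add_div, add_mul, Finset.sum_add_distrib, div_mul_eq_mul_div, ← Finset.sum_div]
  rw [hswap]
  ring

end Expansion

section Matchings

theorem card_embedding_le {α ι T : Type*} [Fintype α] [Fintype ι] [Fintype T] [DecidableEq α]
    [DecidableEq ι] [DecidableEq T] (σ : α → T) (τ : ι → T) (E : Finset α) :
    (Finset.univ.filter fun f : α ↪ ι => ∀ x ∉ E, τ (f x) = σ x).card ≤
      Fintype.card ι ^ E.card * ∏ t, (Finset.univ.filter fun i => τ i = t).card.descFactorial
        (Finset.univ.filter fun x => x ∉ E ∧ σ x = t).card := by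
  let F : {f : α ↪ ι // ∀ x ∉ E, τ (f x) = σ x} →
      (E → ι) × ∀ t, ({x // x ∉ E ∧ σ x = t} ↪ {i // τ i = t}) := fun f =>
    (fun x => f.1 x, fun t => ⟨fun x => ⟨f.1 x.1, by rw [f.2 x.1 x.2.1, x.2.2]⟩, fun x y h => by
      apply Subtype.ext
      exact f.1.injective (congrArg Subtype.val h)⟩)
  have hF : Function.Injective F := by
    intro f f' h
    apply Subtype.ext
    ext x
    by_cases hx : x ∈ E
    · exact congrFun (congrArg Prod.fst h) ⟨x, hx⟩
    · have h2 := congrFun (congrArg Prod.snd h) (σ x)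
      exact congrArg Subtype.val (DFunLike.congr_fun h2 ⟨x, hx, rfl⟩)
  have := Fintype.card_le_of_injective F hF
  rw [Fintype.card_subtype, Fintype.card_prod, Fintype.card_fun, Fintype.card_coe,
    Fintype.card_pi] at this
  simp_rw [Fintype.card_embedding_eq, Fintype.card_subtype] at this
  exact this

theorem descFactorial_mul_factorial_le {k m d : ℕ} (hd : d ≤ m) (hm : m ≤ k) :
    k.descFactorial (m - d) * d.factorial ≤ k.descFactorial m := by
  obtain ⟨s, rfl⟩ := Nat.exists_eq_add_of_le' hd
  rw [Nat.add_sub_cancel, descFactorial_add]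
  refine Nat.mul_le_mul_left _ ?_
  rw [← Nat.descFactorial_self]
  exact Nat.descFactorial_le d (by omega)

theorem factorial_sum_le {T : Type*} [Fintype T] [DecidableEq T] (d : T → ℕ) :
    (∑ t, d t).factorial ≤ Fintype.card T ^ (∑ t, d t) * ∏ t, (d t).factorial := by
  rw [← Nat.multinomial_spec, mul_comm]
  refine Nat.mul_le_mul_right _ ?_
  have h := Finset.sum_pow_eq_sum_piAntidiag (R := ℕ) Finset.univ (fun _ : T => 1) (∑ t, d t)
  simp only [one_pow, Finset.prod_const_one, mul_one, Finset.sum_const, Finset.card_univ,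
    smul_eq_mul] at h
  rw [h]
  exact Finset.single_le_sum (f := fun k => Nat.multinomial Finset.univ k)
    (fun _ _ => Nat.zero_le _) (by simp [Finset.mem_piAntidiag])

theorem sum_choose_div_factorial_le (m k : ℕ) (hm : m ≤ k) {x : ℝ} (hx : 0 ≤ x) :
    ∑ d ∈ Finset.range (m + 1), (m.choose d : ℝ) * (x ^ d / d.factorial) ≤
      Real.exp (2 * √(k * x)) := by
  have h1 : ∀ d, (m.choose d : ℝ) * (x ^ d / d.factorial) ≤ (√(k * x) ^ d / d.factorial) ^ 2 := by
    intro d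
    have h2 : (m.choose d : ℝ) ≤ (k : ℝ) ^ d / d.factorial :=
      (Nat.choose_le_pow_div d m).trans (by gcongr)
    calc (m.choose d : ℝ) * (x ^ d / d.factorial)
        ≤ (k : ℝ) ^ d / d.factorial * (x ^ d / d.factorial) := by gcongr
      _ = _ := by
        rw [div_pow, ← pow_mul, mul_comm d 2, pow_mul, Real.sq_sqrt (by positivity), mul_pow]
        field_simp
  calc _ ≤ ∑ d ∈ Finset.range (m + 1), (√(k * x) ^ d / d.factorial) ^ 2 :=
        Finset.sum_le_sum fun d _ => h1 d
    _ ≤ (∑ d ∈ Finset.range (m + 1), √(k * x) ^ d / d.factorial) ^ 2 :=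
        Finset.sum_sq_le_sq_sum_of_nonneg fun d _ => by positivity
    _ ≤ (Real.exp (√(k * x))) ^ 2 := by
        gcongr
        exact Real.sum_le_exp_of_nonneg (Real.sqrt_nonneg _) _
    _ = _ := by rw [← Real.exp_nat_mul]; norm_num

theorem sum_embedding_le {α ι T : Type*} [Fintype α] [Fintype ι] [Fintype T] [DecidableEq α]
    [DecidableEq ι] [DecidableEq T] (e : α ↪ ι) (τ : ι → T) (q : ι → ι → ℝ) {ε ε' : ℝ}
    (hε : 0 ≤ ε) (hε' : 0 ≤ ε') (hq : ∀ i j, 0 ≤ q i j)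
    (h1 : ∀ i j, τ i = τ j → q i j ≤ 1 + ε) (h2 : ∀ i j, τ i ≠ τ j → q i j ≤ ε') :
    ∑ f : α ↪ ι, ∏ x, q (e x) (f x) ≤
      Real.exp (2 * √(Fintype.card ι * (Fintype.card ι * Fintype.card T * ε'))) *
        ((1 + ε) ^ Fintype.card α *
          ∏ t, ((Finset.univ.filter fun i => τ i = t).card.descFactorial
            (Finset.univ.filter fun x => τ (e x) = t).card : ℝ)) := by
  set k := Fintype.card ι
  set K : T → ℕ := fun t => (Finset.univ.filter fun i => τ i = t).card
  set m : T → ℕ := fun t => (Finset.univ.filter fun x => τ (e x) = t).card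
  have hmK : ∀ t, m t ≤ K t := fun t =>
    Finset.card_le_card_of_injOn e (fun x hx => by simpa using hx) e.injective.injOn
  have hterm : ∀ f : α ↪ ι, ∏ x, q (e x) (f x) ≤
      ∑ E : Finset α, (1 + ε) ^ Fintype.card α * ε' ^ E.card *
        if ∀ x ∉ E, τ (f x) = τ (e x) then 1 else 0 := by
    intro f
    have hb : ∏ x, q (e x) (f x) ≤ (1 + ε) ^ Fintype.card α *
        ε' ^ (Finset.univ.filter fun x => τ (f x) ≠ τ (e x)).card := by
      calc ∏ x, q (e x) (f x) ≤ ∏ x : α, ((1 + ε) * if τ (f x) ≠ τ (e x) then ε' else 1) := by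
            refine Finset.prod_le_prod (fun x _ => hq _ _) fun x _ => ?_
            split_ifs with h
            · exact (h2 _ _ (Ne.symm h)).trans (le_mul_of_one_le_left hε' (by linarith))
            · rw [mul_one]; exact h1 _ _ (not_not.1 h).symm
        _ = _ := by
            rw [Finset.prod_mul_distrib, Finset.prod_const, Finset.card_univ, Finset.prod_ite]
            simp
    refine hb.trans (le_trans (le_of_eq ?_) (Finset.single_le_sum (f := fun E : Finset α =>
      (1 + ε) ^ Fintype.card α * ε' ^ E.card *
        if ∀ x ∉ E, τ (f x) = τ (e x) then 1 else 0) (fun E _ => by positivity)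
      (Finset.mem_univ (Finset.univ.filter fun x => τ (f x) ≠ τ (e x)))))
    rw [if_pos, mul_one]
    intro x hx
    simpa using hx
  have hE : ∀ E : Finset α,
      ((Finset.univ.filter fun f : α ↪ ι => ∀ x ∉ E, τ (f x) = τ (e x)).card : ℝ) ≤
        (k * Fintype.card T : ℝ) ^ E.card / E.card.factorial *
          ∏ t, ((K t).descFactorial (m t) : ℝ) := by
    intro E
    set d : T → ℕ := fun t => (E.filter fun x => τ (e x) = t).card
    have hd : ∑ t, d t = E.card :=
      (Finset.card_eq_sum_card_fiberwise (f := fun x => τ (e x)) (t := Finset.univ)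
        (fun x _ => Finset.mem_coe.2 (Finset.mem_univ _))).symm
    have hdm : ∀ t, d t ≤ m t := fun t =>
      Finset.card_le_card (Finset.filter_subset_filter _ (Finset.subset_univ _))
    have hmd : ∀ t, (Finset.univ.filter fun x => x ∉ E ∧ τ (e x) = t).card = m t - d t := by
      intro t
      rw [← Finset.card_sdiff_of_subset (Finset.filter_subset_filter _ (Finset.subset_univ _))]
      congr 1
      ext x
      simp only [Finset.mem_filter, Finset.mem_univ, true_and, Finset.mem_sdiff]
      tauto
    have a1 := card_embedding_le (fun x => τ (e x)) τ E
    simp_rw [hmd] at a1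
    have a2 : (∏ t, (K t).descFactorial (m t - d t)) * ∏ t, (d t).factorial ≤
        ∏ t, (K t).descFactorial (m t) := by
      rw [← Finset.prod_mul_distrib]
      exact Finset.prod_le_prod' fun t _ => descFactorial_mul_factorial_le (hdm t) (hmK t)
    have a3 := factorial_sum_le d
    rw [hd] at a3
    rw [div_mul_eq_mul_div, le_div_iff₀ (by positivity)]
    have : (Finset.univ.filter fun f : α ↪ ι => ∀ x ∉ E, τ (f x) = τ (e x)).card *
        E.card.factorial ≤ (k * Fintype.card T) ^ E.card * ∏ t, (K t).descFactorial (m t) := by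
      calc _ ≤ (k ^ E.card * ∏ t, (K t).descFactorial (m t - d t)) *
            (Fintype.card T ^ E.card * ∏ t, (d t).factorial) := Nat.mul_le_mul a1 a3
        _ = (k * Fintype.card T) ^ E.card * ((∏ t, (K t).descFactorial (m t - d t)) *
            ∏ t, (d t).factorial) := by rw [mul_pow]; ring
        _ ≤ _ := Nat.mul_le_mul_left _ a2
    exact_mod_cast this
  have hak : Fintype.card α ≤ k := Fintype.card_le_of_injective e e.injective
  calc ∑ f : α ↪ ι, ∏ x, q (e x) (f x)
      ≤ ∑ f : α ↪ ι, ∑ E : Finset α, (1 + ε) ^ Fintype.card α * ε' ^ E.card *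
        (if ∀ x ∉ E, τ (f x) = τ (e x) then 1 else 0) := Finset.sum_le_sum fun f _ => hterm f
    _ = ∑ E : Finset α, (1 + ε) ^ Fintype.card α * ε' ^ E.card *
        ((Finset.univ.filter fun f : α ↪ ι => ∀ x ∉ E, τ (f x) = τ (e x)).card : ℝ) := by
        rw [Finset.sum_comm]
        refine Finset.sum_congr rfl fun E _ => ?_
        rw [← Finset.mul_sum, Finset.sum_boole]
    _ ≤ ∑ E : Finset α, (1 + ε) ^ Fintype.card α * ε' ^ E.card *
        ((k * Fintype.card T : ℝ) ^ E.card / E.card.factorial *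
          ∏ t, ((K t).descFactorial (m t) : ℝ)) := by
        refine Finset.sum_le_sum fun E _ => mul_le_mul_of_nonneg_left (hE E) (by positivity)
    _ = (∑ E ∈ (Finset.univ : Finset α).powerset,
          (fun d => (k * Fintype.card T * ε' : ℝ) ^ d / d.factorial) E.card) *
        ((1 + ε) ^ Fintype.card α * ∏ t, ((K t).descFactorial (m t) : ℝ)) := by
        rw [Finset.sum_mul, Finset.powerset_univ]
        refine Finset.sum_congr rfl fun E _ => ?_
        simp only [mul_pow]
        ring
    _ ≤ _ := by
        refine mul_le_mul_of_nonneg_right ?_ (by positivity)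
        rw [Finset.sum_powerset_apply_card
          (fun d => (k * Fintype.card T * ε' : ℝ) ^ d / d.factorial), Finset.card_univ]
        simp_rw [nsmul_eq_mul]
        exact sum_choose_div_factorial_le _ _ hak (by positivity)

/-- The matching given by the graph of an embedding. -/
def matOf {ι : Type*} [DecidableEq ι] {D : Finset ι} (f : D ↪ ι) : Finset (ι × ι) :=
  D.attach.image fun i => (i.1, f i)

theorem mem_matOf {ι : Type*} [DecidableEq ι] {D : Finset ι} {f : D ↪ ι} {p : ι × ι} :
    p ∈ matOf f ↔ ∃ i : D, (i.1, f i) = p := by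
  simp only [matOf, Finset.mem_image, Finset.mem_attach, true_and]

theorem graph_injOn {ι : Type*} {D : Finset ι} (f : D ↪ ι) (S : Set D) :
    Set.InjOn (fun i : D => (i.1, f i)) S :=
  fun _ _ _ _ h => Subtype.ext (congrArg Prod.fst h)

variable {ι : Type*} [Fintype ι] [DecidableEq ι]

open scoped Classical in
theorem sum_mat_eq (F : Finset (ι × ι) → ℝ) :
    ∑ M ∈ Finset.univ.filter (IsMat (ι := ι)), F M =
      ∑ D : Finset ι, ∑ f : D ↪ ι, F (matOf f) := by
  rw [← Fintype.sum_sigma' (fun (D : Finset ι) (f : D ↪ ι) => F (matOf f))]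
  symm
  refine Finset.sum_bij (fun x _ => matOf x.2) ?_ ?_ ?_ ?_
  · rintro ⟨D, f⟩ -
    simp only [Finset.mem_filter, Finset.mem_univ, true_and]
    constructor
    · rintro p hp p' hp' h
      obtain ⟨x, rfl⟩ := mem_matOf.1 hp
      obtain ⟨y, rfl⟩ := mem_matOf.1 hp'
      rw [Subtype.ext h]
    · rintro p hp p' hp' h
      obtain ⟨x, rfl⟩ := mem_matOf.1 hp
      obtain ⟨y, rfl⟩ := mem_matOf.1 hp'
      rw [f.injective h]
  · rintro ⟨D, f⟩ - ⟨D', f'⟩ - h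
    change matOf f = matOf f' at h
    have hD : ∀ (D : Finset ι) (f : D ↪ ι), D = (matOf f).image Prod.fst := by
      intro D f
      ext i
      rw [Finset.mem_image]
      constructor
      · exact fun hi => ⟨(i, f ⟨i, hi⟩), mem_matOf.2 ⟨⟨i, hi⟩, rfl⟩, rfl⟩
      · rintro ⟨p, hp, rfl⟩
        obtain ⟨x, rfl⟩ := mem_matOf.1 hp
        exact x.2
    obtain rfl : D = D' := by rw [hD D f, h, ← hD D' f']
    congr 1
    ext i
    have : (i.1, f i) ∈ matOf f := mem_matOf.2 ⟨i, rfl⟩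
    rw [h] at this
    obtain ⟨j, hj⟩ := mem_matOf.1 this
    rw [Prod.mk.injEq] at hj
    rw [← hj.2, Subtype.ext hj.1]
  · intro M hM
    have hM : IsMat M := by simpa using hM
    have hx : ∀ i : M.image Prod.fst, ∃ j, (i.1, j) ∈ M := by
      rintro ⟨i, hi⟩
      obtain ⟨p, hp, rfl⟩ := Finset.mem_image.1 hi
      exact ⟨p.2, hp⟩
    choose f hf using hx
    refine ⟨⟨M.image Prod.fst, ⟨f, fun x y hxy => Subtype.ext (congrArg Prod.fst
      (hM.2 (hf x) (hf y) hxy))⟩⟩, Finset.mem_univ _, ?_⟩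
    ext p
    rw [mem_matOf]
    constructor
    · rintro ⟨i, rfl⟩; exact hf i
    · intro hp
      refine ⟨⟨p.1, Finset.mem_image_of_mem _ hp⟩, ?_⟩
      exact hM.1 (hf _) hp rfl
  · intro x _
    rfl

open scoped Classical in
theorem sum_mat_le {T : Type*} [Fintype T] [DecidableEq T] (n : ℕ) (v : ι → ℕ) (τ : ι → T)
    (q : ι → ι → ℝ) {ε ε' : ℝ} (hε : 0 ≤ ε) (hε' : 0 ≤ ε') (hq : ∀ i j, 0 ≤ q i j)
    (h1 : ∀ i j, τ i = τ j → q i j ≤ 1 + ε) (h2 : ∀ i j, τ i ≠ τ j → q i j ≤ ε') :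
    ∑ M ∈ Finset.univ.filter (IsMat (ι := ι)), rowW n v M * ∏ p ∈ M, q p.1 p.2 ≤
      Real.exp (2 * √(Fintype.card ι * (Fintype.card ι * Fintype.card T * ε'))) *
        ∑ D : Finset ι, (∏ i ∈ D, gw (v i)) / n.descFactorial (∑ i ∈ D, v i) *
          ((1 + ε) ^ D.card * ∏ t, ((Finset.univ.filter fun i => τ i = t).card.descFactorial
            (D.filter fun i => τ i = t).card : ℝ)) := by
  rw [sum_mat_eq, Finset.mul_sum]
  refine Finset.sum_le_sum fun D _ => ?_
  have hr : ∀ f : D ↪ ι, rowW n v (matOf f) * ∏ p ∈ matOf f, q p.1 p.2 =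
      (∏ i ∈ D, gw (v i)) / n.descFactorial (∑ i ∈ D, v i) * ∏ x : D, q x (f x) := by
    intro f
    simp only [rowW, matOf]
    rw [Finset.prod_image (graph_injOn f _), Finset.prod_image (graph_injOn f _),
      Finset.sum_image (graph_injOn f _), Finset.prod_attach D (fun i => gw (v i)), Finset.sum_attach D v, Finset.univ_eq_attach]
  simp_rw [hr]
  rw [← Finset.mul_sum, mul_left_comm]
  refine mul_le_mul_of_nonneg_left ?_
    (div_nonneg (Finset.prod_nonneg fun _ _ => (gw_pos _).le) (Nat.cast_nonneg _))
  have := sum_embedding_le (Function.Embedding.subtype (· ∈ D)) τ q hε hε' hq h1 h2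
  rw [Fintype.card_coe] at this
  have hc : ∀ t, (Finset.univ.filter fun x : {x // x ∈ D} =>
      τ ((Function.Embedding.subtype (· ∈ D)) x) = t).card =
      (D.filter fun i => τ i = t).card := by
    intro t
    rw [← Finset.card_map (Function.Embedding.subtype (· ∈ D))]
    congr 1
    ext i
    rw [Finset.mem_map, Finset.mem_filter]
    constructor
    · rintro ⟨x, hx, rfl⟩
      exact ⟨x.2, (Finset.mem_filter.1 hx).2⟩
    · rintro ⟨hi, ht⟩
      exact ⟨⟨i, hi⟩, Finset.mem_filter.2 ⟨Finset.mem_univ _, ht⟩, rfl⟩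
  simp_rw [hc] at this
  exact this

end Matchings

section QBounds

/-- The relative weight of overlapping a class of size `v` in `s` vertices. -/
noncomputable def ovH (n v s : ℕ) : ℝ :=
  (v.choose s : ℝ) ^ 2 * s.factorial * 2 ^ s.choose 2 * ((n : ℝ) ^ (v - s) / gw v)

theorem ovH_nonneg (n v s : ℕ) : 0 ≤ ovH n v s := by
  have := gw_pos v
  unfold ovH
  positivity

theorem bigQ_eq (n h x y : ℕ) :
    bigQ n h x y = ∑ s ∈ Finset.Ioc h (min x y), √(ovH n x s * ovH n y s) := by
  unfold bigQ
  refine Finset.sum_congr rfl fun s _ => ?_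
  have hx := gw_pos x
  have hy := gw_pos y
  have : ovH n x s * ovH n y s = ((x.choose s : ℝ) * y.choose s * s.factorial * 2 ^ s.choose 2) ^ 2 *
      ((n : ℝ) ^ (x - s) / gw x * ((n : ℝ) ^ (y - s) / gw y)) := by
    unfold ovH
    ring
  rw [this, Real.sqrt_mul (by positivity), Real.sqrt_sq (by positivity), fillW]

theorem ovH_self (n v : ℕ) : ovH n v v = 1 := by
  unfold ovH gw
  rw [Nat.choose_self, Nat.sub_self]
  have : (v.factorial : ℝ) ≠ 0 := by positivity
  field_simp
  norm_num

theorem choose_two_add (s d : ℕ) : (s + d).choose 2 = s.choose 2 + d.choose 2 + s * d := by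
  rw [Nat.add_choose_eq, Finset.Nat.antidiagonal_succ, Finset.sum_cons]
  simp [Finset.Nat.antidiagonal_succ]
  ring

theorem two_mul_choose_two (s : ℕ) : 2 * s.choose 2 + s = s * s := by
  induction s with
  | zero => rfl
  | succ s ih => rw [Nat.choose_succ_succ' s 1, Nat.choose_one_right]; nlinarith

theorem ovH_le {n v s h a : ℕ} {δ : ℝ} (hs : h < s) (hsv : s < v) (hv : v ≤ a) (h0 : 0 ≤ δ)
    (h1 : δ ≤ 1) (hδ : ((a : ℝ) * n) ^ 2 ≤ δ ^ 2 * 2 ^ (v + h)) : ovH n v s ≤ δ := by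
  obtain ⟨d, rfl⟩ := Nat.exists_eq_add_of_lt hsv
  have e : s + d + 1 - s = d + 1 := by omega
  have hc : ((s + d + 1).choose s : ℝ) * s.factorial * (d + 1).factorial =
      (s + d + 1).factorial := by
    have := Nat.choose_mul_factorial_mul_factorial (n := s + d + 1) (k := s) (by omega)
    rw [e] at this
    exact_mod_cast this
  have hc2 : ((s + d + 1).choose s : ℝ) ≤ (a : ℝ) ^ (d + 1) := by
    rw [← Nat.choose_symm (by omega), e]
    exact_mod_cast (Nat.choose_le_pow _ _).trans (Nat.pow_le_pow_left hv _)
  have hexp : (s + d + 1).choose 2 = s.choose 2 + (d + 1).choose 2 + s * (d + 1) :=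
    choose_two_add s (d + 1)
  have key : ovH n (s + d + 1) s = (s + d + 1).choose s * (n : ℝ) ^ (d + 1) /
      ((d + 1).factorial * 2 ^ ((d + 1).choose 2 + s * (d + 1))) := by
    unfold ovH gw
    rw [e, ← hc, hexp, add_assoc (s.choose 2), pow_add (2 : ℝ) (s.choose 2)]
    have h4 : ((s + d + 1).choose s : ℝ) ≠ 0 := by
      exact_mod_cast (Nat.choose_pos (by omega : s ≤ s + d + 1)).ne'
    field_simp
  have h5 : ovH n (s + d + 1) s ≤ ((a : ℝ) * n) ^ (d + 1) / 2 ^ ((d + 1).choose 2 + s * (d + 1)) := by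
    rw [key, mul_pow]
    gcongr
    · have : (1 : ℝ) ≤ (d + 1).factorial := by exact_mod_cast Nat.factorial_pos _
      exact le_mul_of_one_le_left (by positivity) this
  have h6 : (((a : ℝ) * n) ^ (d + 1) / 2 ^ ((d + 1).choose 2 + s * (d + 1))) ^ 2 ≤
      (δ ^ (d + 1)) ^ 2 := by
    rw [div_pow, div_le_iff₀ (by positivity), ← pow_mul, mul_comm (d + 1) 2, pow_mul]
    calc (((a : ℝ) * n) ^ 2) ^ (d + 1) ≤ (δ ^ 2 * 2 ^ (s + d + 1 + h)) ^ (d + 1) := by gcongr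
      _ = (δ ^ (d + 1)) ^ 2 * 2 ^ ((s + d + 1 + h) * (d + 1)) := by ring
      _ ≤ (δ ^ (d + 1)) ^ 2 * 2 ^ (((d + 1).choose 2 + s * (d + 1)) * 2) := by
          refine mul_le_mul_of_nonneg_left (pow_le_pow_right₀ (by norm_num) ?_) (by positivity)
          have := two_mul_choose_two (d + 1)
          nlinarith [Nat.mul_le_mul_right (d + 1) hs]
      _ = _ := by rw [pow_mul (2 : ℝ) _ 2]
  have h7 := (pow_le_pow_iff_left₀ (by positivity) (by positivity) two_ne_zero).1 h6
  exact (h5.trans h7).trans (pow_le_of_le_one h0 h1 (by omega))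

theorem bigQ_le {n h x y a : ℕ} {δ : ℝ} (hx : x ≤ a) (hy : y ≤ a) (h0 : 0 ≤ δ) (h1 : δ ≤ 1)
    (hδx : ((a : ℝ) * n) ^ 2 ≤ δ ^ 2 * 2 ^ (x + h))
    (hδy : ((a : ℝ) * n) ^ 2 ≤ δ ^ 2 * 2 ^ (y + h)) :
    bigQ n h x y ≤ (if x = y then 1 else 0) + a * √δ := by
  have hle : ∀ v, v ≤ a → ((a : ℝ) * n) ^ 2 ≤ δ ^ 2 * 2 ^ (v + h) → ∀ s, h < s → s ≤ v →
      ovH n v s ≤ 1 := by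
    intro v hv hδ s hs hsv
    rcases hsv.eq_or_lt with rfl | hsv
    · rw [ovH_self]
    · exact (ovH_le hs hsv hv h0 h1 hδ).trans h1
  have hterm : ∀ s ∈ Finset.Ioc h (min x y), √(ovH n x s * ovH n y s) ≤
      (if x = y ∧ s = x then 1 else 0) + √δ := by
    intro s hs
    rw [Finset.mem_Ioc, le_min_iff] at hs
    have a1 := hle x hx hδx s hs.1 hs.2.1
    have a2 := hle y hy hδy s hs.1 hs.2.2
    have b1 := ovH_nonneg n x s
    have b2 := ovH_nonneg n y s
    split_ifs with hc
    · have : √(ovH n x s * ovH n y s) ≤ 1 := by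
        rw [← Real.sqrt_one]
        exact Real.sqrt_le_sqrt (mul_le_one₀ a1 b2 a2)
      linarith [Real.sqrt_nonneg δ]
    · rw [zero_add]
      refine Real.sqrt_le_sqrt ?_
      by_cases hsx : s = x
      · have hsy : s < y := lt_of_le_of_ne hs.2.2 fun h => hc ⟨hsx.symm.trans h, hsx⟩
        exact (mul_le_of_le_one_left b2 a1).trans (ovH_le hs.1 hsy hy h0 h1 hδy)
      · exact (mul_le_of_le_one_right b1 a2).trans
          (ovH_le hs.1 (lt_of_le_of_ne hs.2.1 hsx) hx h0 h1 hδx)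
  rw [bigQ_eq]
  refine (Finset.sum_le_sum hterm).trans ?_
  rw [Finset.sum_add_distrib]
  refine add_le_add ?_ ?_
  · split_ifs with hxy
    · simp only [hxy, true_and]
      rw [Finset.sum_ite_eq']
      split_ifs <;> norm_num
    · simp [hxy]
  · rw [Finset.sum_const, Nat.card_Ioc, nsmul_eq_mul]
    gcongr
    omega

theorem smallQ_le {h v a : ℕ} {y : ℝ} (hv : v ≤ a) (hy : 0 ≤ y)
    (hb : (a * y) ^ 2 * 2 ^ (h + 1) ≤ 1 / 4) : smallQ h v y ≤ 1 + 4 * (a * y) ^ 2 := by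
  unfold smallQ
  set b : ℝ := a * y
  have hb0 : 0 ≤ b := by positivity
  have hterm : ∀ s, s + 2 ≤ h → (v.choose (s + 2) : ℝ) * 2 ^ (s + 2).choose 2 * y ^ (s + 2) ≤
      2 * b ^ 2 * (1 / 2) ^ s := by
    intro s hs
    have h1 : (v.choose (s + 2) : ℝ) ≤ (a : ℝ) ^ (s + 2) := by
      exact_mod_cast (Nat.choose_le_pow _ _).trans (Nat.pow_le_pow_left hv _)
    have h2 : (b ^ s * 2 ^ (s + s.choose 2 + s)) ^ 2 ≤ ((1 / 2) ^ s) ^ 2 := by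
      have e : (s + s.choose 2 + s) * 2 = (s + 3) * s := by
        have := two_mul_choose_two s
        nlinarith
      calc (b ^ s * 2 ^ (s + s.choose 2 + s)) ^ 2 = (b ^ 2) ^ s * 2 ^ ((s + s.choose 2 + s) * 2) := by
            ring
        _ = (b ^ 2 * 2 ^ (s + 3)) ^ s := by rw [e, pow_mul (2 : ℝ) (s + 3) s, ← mul_pow]
        _ ≤ (b ^ 2 * 2 ^ (h + 1)) ^ s := by
            refine pow_le_pow_left₀ (by positivity) (mul_le_mul_of_nonneg_left
              (pow_le_pow_right₀ (by norm_num) (by omega)) (by positivity)) s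
        _ ≤ (1 / 4) ^ s := by gcongr
        _ = _ := by rw [← pow_mul, mul_comm, pow_mul]; norm_num
    have h3 := (pow_le_pow_iff_left₀ (by positivity) (by positivity) two_ne_zero).1 h2
    calc (v.choose (s + 2) : ℝ) * 2 ^ (s + 2).choose 2 * y ^ (s + 2)
        ≤ (a : ℝ) ^ (s + 2) * 2 ^ (s + 2).choose 2 * y ^ (s + 2) := by gcongr
      _ = b ^ (s + 2) * 2 ^ (s + 2).choose 2 := by rw [mul_right_comm, ← mul_pow]
      _ = 2 * b ^ 2 * (b ^ s * 2 ^ (s + s.choose 2 + s)) := by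
          rw [choose_two_add s 2, show s.choose 2 + (2 : ℕ).choose 2 + s * 2 =
            (s + s.choose 2 + s) + 1 by rw [Nat.choose_self]; ring]
          ring
      _ ≤ _ := by gcongr
  have hsub : (Finset.range (h + 1)).filter (· ≠ 1) ⊆
      insert 0 ((Finset.range (h - 1)).image (· + 2)) := by
    intro s
    simp only [Finset.mem_filter, Finset.mem_range, Finset.mem_insert, Finset.mem_image]
    rintro ⟨h1, h2⟩
    rcases s with _ | _ | s
    · exact Or.inl rfl
    · exact absurd rfl h2
    · exact Or.inr ⟨s, by omega, rfl⟩
  refine (Finset.sum_le_sum_of_subset_of_nonneg hsub fun _ _ _ => by positivity).trans ?_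
  rw [Finset.sum_insert (by simp), Finset.sum_image (by simp)]
  have h4 : ∑ s ∈ Finset.range (h - 1), (v.choose (s + 2) : ℝ) * 2 ^ (s + 2).choose 2 * y ^ (s + 2) ≤
      4 * b ^ 2 := by
    calc _ ≤ ∑ s ∈ Finset.range (h - 1), 2 * b ^ 2 * (1 / 2) ^ s :=
          Finset.sum_le_sum fun s hs => hterm s (by rw [Finset.mem_range] at hs; omega)
      _ = 2 * b ^ 2 * ∑ s ∈ Finset.range (h - 1), (1 / 2 : ℝ) ^ s := by rw [Finset.mul_sum]
      _ ≤ 2 * b ^ 2 * 2 := by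
          gcongr
          have := Summable.sum_le_tsum (f := fun s => (1 / 2 : ℝ) ^ s) (Finset.range (h - 1))
            (fun _ _ => by positivity) summable_geometric_two
          rwa [tsum_geometric_two] at this
      _ = _ := by ring
  simpa using h4

end QBounds

section Master

open scoped Classical in
/-- Second moment bound for partial colourings with prescribed class sizes. -/
theorem sum_overlap_le {V ι T : Type*} [Fintype V] [DecidableEq V] [Fintype ι] [DecidableEq ι]
    [Fintype T] [DecidableEq T] (c : V → Option ι) (τ : ι → T) (w : T → ℕ)
    (hw : Function.Injective w) (hc : ∀ i, csize c i = w (τ i)) {a h N : ℕ} {δ ε' : ℝ}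
    (hv : ∀ i, w (τ i) ≤ a) (hah : a ≤ 2 * h + 1) (hN : 0 < N)
    (hn : N + ∑ i, w (τ i) ≤ Fintype.card V)
    (hb : ((a : ℝ) ^ 2 / N) ^ 2 * 2 ^ (h + 1) ≤ 1 / 4) (h0 : 0 ≤ δ) (h1 : δ ≤ 1)
    (hδ : ∀ i, ((a : ℝ) * Fintype.card V) ^ 2 ≤ δ ^ 2 * 2 ^ (w (τ i) + h))
    (h2 : 0 ≤ ε') (hε' : ∀ i j, τ i ≠ τ j → a * √δ ≤ ε') :
    ∑ ρ : Equiv.Perm V, ∏ i, ∏ j, (2 : ℝ) ^ (overlap c ρ i j).card.choose 2 ≤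
      (Fintype.card V).factorial * ((1 + 4 * ((a : ℝ) ^ 2 / N) ^ 2) ^ (Fintype.card ι ^ 2) *
        (Real.exp (2 * √(Fintype.card ι * (Fintype.card ι * Fintype.card T * ε'))) *
        ∑ D : Finset ι, (∏ i ∈ D, gw (w (τ i))) /
          (Fintype.card V).descFactorial (∑ i ∈ D, w (τ i)) *
          ((1 + a * √δ) ^ D.card *
            ∏ t, ((Finset.univ.filter fun i => τ i = t).card.descFactorial
              (D.filter fun i => τ i = t).card : ℝ)))) := by
  have hcs : csize c = fun i => w (τ i) := funext hc
  have hb' : ((a : ℝ) * (a / N)) ^ 2 = ((a : ℝ) ^ 2 / N) ^ 2 := by ring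
  have hQ : ∀ i j, bigQ (Fintype.card V) h (w (τ i)) (w (τ j)) ≤
      (if w (τ i) = w (τ j) then 1 else 0) + a * √δ := fun i j =>
    bigQ_le (hv i) (hv j) h0 h1 (hδ i) (hδ j)
  have m1 := sum_overlap_le_sum_mat (σ := 4 * ((a : ℝ) ^ 2 / N) ^ 2) c (a := a) (h := h) (N := N)
    (by simpa [hcs] using hv) hah hN (by simpa [hcs] using hn) (by positivity) (fun i => by
      rw [← hb', hc]
      exact smallQ_le (hv i) (by positivity) (by rw [hb']; exact hb))
  refine m1.trans ?_
  rw [hcs]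
  have m2 := sum_mat_le (Fintype.card V) (fun i => w (τ i)) τ
    (fun i j => bigQ (Fintype.card V) h (w (τ i)) (w (τ j))) (ε := a * √δ) (ε' := ε')
    (by positivity) h2 (fun i j => bigQ_nonneg _ _ _ _)
    (fun i j hij => by simpa [hij] using hQ i j)
    (fun i j hij => by
      have := hQ i j
      rw [if_neg fun h => hij (hw h), zero_add] at this
      exact this.trans (hε' i j hij))
  gcongr

end Master

section Coupling

theorem colorable_iff_of_iso {V W : Type*} {G : SimpleGraph V} {H : SimpleGraph W} (e : G ≃g H)
    {k : ℕ} : G.Colorable k ↔ H.Colorable k :=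
  ⟨fun h => h.of_hom e.symm.toHom, fun h => h.of_hom e.toHom⟩

theorem frac_equiv {V W : Type*} (e : V ≃ W) (P : SimpleGraph W → Prop) :
    frac (fun G : SimpleGraph V => P (G.comap e.symm)) = frac P := by
  have he : Function.Bijective fun G : SimpleGraph V => G.comap e.symm := by
    refine Function.bijective_iff_has_inverse.2 ⟨fun G => G.comap e, fun G => ?_, fun G => ?_⟩ <;>
      ext <;> simp
  unfold frac
  rw [Nat.card_eq_of_bijective _ he]
  congr 2
  refine Set.ncard_congr (fun G _ => G.comap e.symm) (fun G hG => hG)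
    (fun G G' _ _ h => he.1 h) fun G hG => ?_
  obtain ⟨G', rfl⟩ := he.2 G
  exact ⟨G', hG, rfl⟩

theorem frac_comap_and {U W : Type*} [Fintype U] [Fintype W] (B : SimpleGraph U → Prop)
    (Q : SimpleGraph (U ⊕ W) → Prop)
    (hQ : ∀ (G : SimpleGraph (U ⊕ W)) (K : SimpleGraph U),
      Q (symmDiff G (K.map Function.Embedding.inl)) ↔ Q G) :
    frac (fun G => B (G.comap Sum.inl) ∧ Q G) = frac B * frac Q := by
  classical
  set N : ℕ := (Finset.univ.filter fun G : SimpleGraph (U ⊕ W) => G.comap Sum.inl = ⊥ ∧ Q G).card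
    with hN
  have hsd : ∀ (G : SimpleGraph (U ⊕ W)) (K : SimpleGraph U),
      (symmDiff G (K.map Function.Embedding.inl)).comap Sum.inl = symmDiff (G.comap Sum.inl) K := by
    intro G K
    ext x y
    simp [symmDiff]
  have hfib : ∀ H : SimpleGraph U,
      (Finset.univ.filter fun G : SimpleGraph (U ⊕ W) => G.comap Sum.inl = H ∧ Q G).card = N := by
    intro H
    refine Finset.card_bij' (fun G _ => symmDiff G (H.map Function.Embedding.inl))
      (fun G _ => symmDiff G (H.map Function.Embedding.inl)) ?_ ?_ ?_ ?_
    · intro G hG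
      simp only [Finset.mem_filter, Finset.mem_univ, true_and] at hG ⊢
      rw [hsd, hG.1, hQ, symmDiff_self]
      exact ⟨rfl, hG.2⟩
    · intro G hG
      simp only [Finset.mem_filter, Finset.mem_univ, true_and] at hG ⊢
      rw [hsd, hG.1, hQ, bot_symmDiff]
      exact ⟨rfl, hG.2⟩
    · intro G _
      exact symmDiff_symmDiff_cancel_right _ _
    · intro G _
      exact symmDiff_symmDiff_cancel_right _ _
  have hcount : ∀ B : SimpleGraph U → Prop,
      (Finset.univ.filter fun G : SimpleGraph (U ⊕ W) => B (G.comap Sum.inl) ∧ Q G).card =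
        (Finset.univ.filter B).card * N := by
    intro B
    rw [Finset.card_eq_sum_card_fiberwise (f := fun G => G.comap Sum.inl)
      (t := Finset.univ.filter B) (fun G hG => by
        simp only [Finset.coe_filter, Finset.mem_univ, true_and, Set.mem_ofPred_eq] at hG ⊢
        exact hG.1)]
    rw [Finset.sum_congr rfl (g := fun _ => N), Finset.sum_const, smul_eq_mul]
    intro H hH
    rw [← hfib H, Finset.filter_filter]
    congr 1
    ext G
    simp only [Finset.mem_filter, Finset.mem_univ, true_and] at hH ⊢
    constructor
    · rintro ⟨⟨_, h⟩, h'⟩; exact ⟨h', h⟩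
    · rintro ⟨rfl, h⟩; exact ⟨⟨hH, h⟩, rfl⟩
  have h1 := hcount fun _ => True
  simp only [true_and, Finset.filter_true, Finset.card_univ] at h1
  rw [frac_eq, frac_eq, frac_eq, hcount B, h1]
  have : (0 : ℝ) < Fintype.card (SimpleGraph U) := by exact_mod_cast Fintype.card_pos
  push_cast
  field_simp

theorem sum_subsets_le (r n a : ℕ) (g x : ℝ) (hg : 0 ≤ g) (hx : 0 ≤ x) (hn : 0 < n) :
    ∑ D : Finset (Fin r), (∏ _i ∈ D, g) / ((n + a * r).descFactorial (∑ _i ∈ D, a) : ℝ) *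
      (x ^ D.card * (r.descFactorial D.card : ℝ)) ≤ Real.exp (r ^ 2 * x * g / n ^ a) := by
  have h1 : ∀ D : Finset (Fin r), (∏ _i ∈ D, g) / ((n + a * r).descFactorial (∑ _i ∈ D, a) : ℝ) *
      (x ^ D.card * (r.descFactorial D.card : ℝ)) ≤ (r * x * g / n ^ a) ^ D.card := by
    intro D
    rw [Finset.prod_const, Finset.sum_const, smul_eq_mul]
    have hD : D.card ≤ r := by simpa using Finset.card_le_univ D
    have h2 : (n : ℝ) ^ (D.card * a) ≤ (n + a * r).descFactorial (D.card * a) := by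
      exact_mod_cast pow_le_descFactorial (by nlinarith)
    have h3 : (r.descFactorial D.card : ℝ) ≤ (r : ℝ) ^ D.card := by
      exact_mod_cast Nat.descFactorial_le_pow _ _
    calc _ ≤ g ^ D.card / (n : ℝ) ^ (D.card * a) * (x ^ D.card * (r : ℝ) ^ D.card) := by
          gcongr
      _ = _ := by rw [mul_comm D.card a, pow_mul]; ring
  refine (Finset.sum_le_sum fun D _ => h1 D).trans ?_
  have h4 := Finset.sum_powerset_apply_card (f := fun d => (r * x * g / (n : ℝ) ^ a) ^ d)
    (x := (Finset.univ : Finset (Fin r)))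
  rw [Finset.powerset_univ] at h4
  rw [h4, Finset.card_univ, Fintype.card_fin]
  refine le_trans (Finset.sum_le_sum fun d _ => ?_)
    (Real.sum_le_exp_of_nonneg (by positivity) (r + 1))
  rw [nsmul_eq_mul]
  have h5 : (r.choose d : ℝ) ≤ (r : ℝ) ^ d / d.factorial := Nat.choose_le_pow_div _ _
  calc _ ≤ (r : ℝ) ^ d / d.factorial * (r * x * g / (n : ℝ) ^ a) ^ d := by gcongr
    _ = _ := by ring

theorem coupling {n r a h T : ℕ} {δ : ℝ} (hn : 0 < n)
    (hT : 0.9 ≤ frac (fun G : SimpleGraph (Fin n) => G.Colorable T)) (hah : a ≤ 2 * h + 1)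
    (hb : ((a : ℝ) ^ 2 / n) ^ 2 * 2 ^ (h + 1) ≤ 1 / 4) (h0 : 0 ≤ δ) (h1 : δ ≤ 1)
    (hδ : ((a : ℝ) * (n + a * r : ℕ)) ^ 2 ≤ δ ^ 2 * 2 ^ (a + h))
    (hS : (1 + 4 * ((a : ℝ) ^ 2 / n) ^ 2) ^ (r ^ 2) *
      Real.exp (r ^ 2 * (1 + a * √δ) * gw a / n ^ a) ≤ 8) :
    0.1 < frac (fun G : SimpleGraph (Fin (n + a * r)) => G.Colorable (T + r)) := by
  classical
  let V := Fin n ⊕ (Fin r × Fin a)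
  have hV : Fintype.card V = n + a * r := by simp [V, mul_comm]
  let c : V → Option (Fin r) := Sum.elim (fun _ => none) fun p => some p.1
  have hcs : ∀ i, csize c i = a := by
    intro i
    unfold csize
    refine Eq.trans (Eq.symm ?_) (Finset.card_fin a)
    refine Finset.card_bij (fun j _ => (Sum.inr (i, j) : V)) ?_ ?_ ?_
    · intro j _; simp [c]
    · intro j _ j' _ h; exact (Prod.mk.inj (Sum.inr.inj h)).2
    · rintro (x | ⟨i', j⟩) hx
      · simp [c] at hx
      · simp only [c, Finset.mem_filter, Finset.mem_univ, true_and, Sum.elim_inr,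
          Option.some.injEq] at hx
        exact ⟨j, Finset.mem_univ _, by rw [hx]⟩
  let A : SimpleGraph V → Prop := fun G => G.Colorable (T + r)
  have hA : ∀ (τ : Equiv.Perm V) (G : SimpleGraph V), A (G.comap τ) ↔ A G := by
    intro τ G
    exact colorable_iff_of_iso (SimpleGraph.Iso.comap τ G)
  have hq : 0.9 * frac (fun G : SimpleGraph V => Avoids G c) ≤
      frac (fun G : SimpleGraph V => A G ∧ Avoids G c) := by
    have h3 : frac (fun G : SimpleGraph V => (G.comap Sum.inl).Colorable T ∧ Avoids G c) =
        frac (fun G : SimpleGraph (Fin n) => G.Colorable T) *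
          frac (fun G : SimpleGraph V => Avoids G c) := by
      refine frac_comap_and (fun G => G.Colorable T) (fun G => Avoids G c) fun G K => ?_
      refine forall₂_congr fun e he => not_congr ?_
      rw [mem_mono] at he
      obtain ⟨-, i, hi⟩ := he
      induction e with | _ x y =>
      have hx := hi x (by simp)
      rcases x with x | x
      · simp [c] at hx
      · simp [symmDiff]
    calc _ ≤ frac (fun G : SimpleGraph (Fin n) => G.Colorable T) *
          frac (fun G : SimpleGraph V => Avoids G c) := by
          have := frac_nonneg (fun G : SimpleGraph V => Avoids G c)
          gcongr
      _ ≤ _ := by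
          rw [← h3]
          refine frac_mono ?_
          rintro G ⟨⟨C⟩, hG⟩
          refine ⟨?_, hG⟩
          have : G.Coloring (Fin T ⊕ Fin r) := by
            refine SimpleGraph.Coloring.mk
              (Sum.elim (fun x => Sum.inl (C x)) fun p => Sum.inr p.1) ?_
            rintro (x | ⟨i, x⟩) (y | ⟨j, y⟩) hxy
            · simpa using C.valid (v := x) (w := y) hxy
            · simp
            · simp
            · simp only [Sum.elim_inr, ne_eq, Sum.inr.injEq]
              rintro rfl
              refine hG s(Sum.inr (i, x), Sum.inr (i, y)) ?_ hxy
              rw [mem_mono]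
              refine ⟨by simpa using hxy.ne, i, ?_⟩
              simp [c]
          have := this.colorable
          simpa [A] using this
  have h2 := second_moment c A hA (by norm_num) hq
  have h4 := sum_overlap_le c (fun _ => ()) (fun _ : Unit => a) (fun _ _ _ => rfl) hcs (a := a)
    (h := h) (N := n) (δ := δ) (ε' := 0) (fun _ => le_rfl) hah hn (by simp [hV, mul_comm]) hb h0 h1
    (fun _ => by rw [hV]; exact hδ) le_rfl (fun i j h => absurd rfl h)
  rw [hV] at h2 h4
  have h5 := sum_subsets_le r n a (gw a) (1 + a * √δ) (gw_pos a).le (by positivity) hn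
  simp only [Fintype.card_fin, mul_zero, Real.sqrt_zero, Real.exp_zero, one_mul,
    Fintype.univ_ofSubsingleton, Finset.prod_const, Finset.card_singleton, pow_one,
    Finset.filter_true, Finset.card_univ] at h4
  simp only [Finset.prod_const] at h5
  have h6 : (0 : ℝ) < (n + a * r).factorial := by exact_mod_cast Nat.factorial_pos _
  have h7 : (0 : ℝ) ≤ frac A := frac_nonneg A
  have h8 : ∑ ρ : Equiv.Perm V, ∏ i, ∏ j, (2 : ℝ) ^ (overlap c ρ i j).card.choose 2 ≤
      (n + a * r).factorial * 8 := by
    refine h4.trans ?_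
    gcongr
    refine le_trans ?_ hS
    gcongr
  have h9 : (0.81 : ℝ) * (n + a * r).factorial ≤ (frac A * 8) * (n + a * r).factorial := by
    calc _ = (0.9 : ℝ) ^ 2 * (n + a * r).factorial := by norm_num
      _ ≤ _ := h2
      _ ≤ frac A * ((n + a * r).factorial * 8) := by gcongr
      _ = _ := by ring
  have h10 := le_of_mul_le_mul_right h9 h6
  have e : V ≃ Fin (n + a * r) := Fintype.equivFinOfCardEq hV
  have h11 : frac A = frac (fun G : SimpleGraph (Fin (n + a * r)) => G.Colorable (T + r)) := by
    rw [← frac_equiv e]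
    congr 1
    funext G
    exact propext (colorable_iff_of_iso (SimpleGraph.Iso.comap e.symm G)).symm
  rw [← h11]
  linarith

end Coupling

section Stirling

theorem pow_le_exp_mul_factorial (n : ℕ) : (n : ℝ) ^ n ≤ Real.exp n * n.factorial := by
  have := Real.pow_div_factorial_le_exp (n : ℝ) (by positivity) n
  rwa [div_le_iff₀ (by positivity)] at this

theorem factorial_succ_le (n : ℕ) :
    ((n + 1).factorial : ℝ) ≤ (n + 1) ^ (n + 2) * Real.exp (-n) := by
  induction n with
  | zero => simp
  | succ n ih =>
    have h0 : (0 : ℝ) < n + 1 := by positivity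
    have h1 : Real.exp 1 ≤ (((n : ℝ) + 2) / (n + 1)) ^ (n + 2) := by
      have h2 : Real.exp (-(1 / ((n : ℝ) + 2))) ≥ 1 - 1 / (n + 2) := by
        have := Real.add_one_le_exp (-(1 / ((n : ℝ) + 2)))
        linarith
      have h3 : ((n : ℝ) + 1) / (n + 2) ≤ Real.exp (-(1 / ((n : ℝ) + 2))) := by
        refine le_trans (le_of_eq ?_) h2
        field_simp
        ring
      have h4 : Real.exp (1 / ((n : ℝ) + 2)) ≤ ((n : ℝ) + 2) / (n + 1) := by
        rw [Real.exp_neg] at h3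
        rw [le_div_iff₀ h0]
        rw [div_le_iff₀ (by positivity), inv_mul_eq_div, le_div_iff₀ (Real.exp_pos _)] at h3
        linarith
      calc Real.exp 1 = Real.exp (1 / ((n : ℝ) + 2)) ^ (n + 2) := by
            rw [← Real.exp_nat_mul]
            congr 1
            push_cast
            field_simp
        _ ≤ _ := by gcongr
    rw [div_pow, le_div_iff₀ (by positivity)] at h1
    rw [Nat.factorial_succ]
    push_cast
    calc ((n : ℝ) + 1 + 1) * (n + 1).factorial
        ≤ (n + 1 + 1) * ((n + 1) ^ (n + 2) * Real.exp (-n)) := by gcongr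
      _ = (n + 2) * (Real.exp 1 * (n + 1) ^ (n + 2)) * Real.exp (-(n + 1)) := by
          rw [show -(n : ℝ) = 1 + -(n + 1) by ring, Real.exp_add]
          ring_nf
      _ ≤ (n + 2) * (n + 2) ^ (n + 2) * Real.exp (-(n + 1)) := by gcongr
      _ = _ := by ring_nf

/-- An upper Stirling bound. -/
theorem factorial_le_stirling {A N : ℕ} {x : ℝ} (hN : 1 ≤ N) (hA : A ≤ N) (hx : A ≤ x) :
    (A.factorial : ℝ) ≤ Real.exp 1 * N * (x / Real.exp 1) ^ A := by
  have hN' : (1 : ℝ) ≤ N := by exact_mod_cast hN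
  rcases A with _ | n
  · have := Real.add_one_le_exp (1 : ℝ)
    simp only [Nat.factorial_zero, Nat.cast_one, pow_zero, mul_one]
    nlinarith
  · refine (factorial_succ_le n).trans ?_
    have h1 : ((n : ℝ) + 1) ≤ x := by exact_mod_cast hx
    have h2 : ((n : ℝ) + 1) ≤ N := by exact_mod_cast hA
    calc ((n : ℝ) + 1) ^ (n + 2) * Real.exp (-n)
        = (n + 1) * (n + 1) ^ (n + 1) * Real.exp (-n) := by ring
      _ ≤ N * x ^ (n + 1) * Real.exp (-n) := by gcongr
      _ = Real.exp 1 * N * (x / Real.exp 1) ^ (n + 1) := by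
          rw [div_pow, ← Real.exp_nat_mul, Real.exp_neg]
          push_cast
          rw [mul_one, Real.exp_add]
          field_simp

/-- A lower bound for falling factorials. -/
theorem pow_le_descFactorial_stirling {n m : ℕ} (hn : 1 ≤ n) (hm : m ≤ n) :
    (n : ℝ) ^ m ≤ n.descFactorial m * (Real.exp 1 * n *
      Real.exp (m - (n - m) * Real.log (n / (n - m)))) := by
  obtain ⟨x, rfl⟩ := Nat.exists_eq_add_of_le hm
  have h1 : (m + x).descFactorial m * x.factorial = (m + x).factorial := by
    rw [mul_comm]
    simpa using Nat.factorial_mul_descFactorial hm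
  have h2 := pow_le_exp_mul_factorial (m + x)
  have h3 := factorial_le_stirling (A := x) (x := x) hn (by omega) le_rfl
  have h4 : (x : ℝ) ^ x = ((m + x : ℕ) : ℝ) ^ x * Real.exp (-(x * Real.log ((m + x : ℕ) / x))) := by
    rcases Nat.eq_zero_or_pos x with rfl | hx
    · simp
    · have hx' : (0 : ℝ) < x := by exact_mod_cast hx
      have hmx : (0 : ℝ) < (m + x : ℕ) := by exact_mod_cast hn
      rw [Real.exp_neg, Real.exp_nat_mul, Real.exp_log (by positivity), div_pow]
      field_simp
  have hmx : (0 : ℝ) < (m + x : ℕ) := by exact_mod_cast hn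
  have e1 : ((m + x : ℕ) : ℝ) - m = x := by push_cast; ring
  rw [e1]
  have h5 : ((m + x : ℕ) : ℝ) ^ m * (m + x : ℕ) ^ x ≤
      (m + x).descFactorial m * (Real.exp 1 * (m + x : ℕ) *
        Real.exp (m - x * Real.log ((m + x : ℕ) / x))) * (m + x : ℕ) ^ x := by
    calc ((m + x : ℕ) : ℝ) ^ m * (m + x : ℕ) ^ x = ((m + x : ℕ) : ℝ) ^ (m + x) := by ring
      _ ≤ Real.exp (m + x : ℕ) * ((m + x).descFactorial m * x.factorial) := by
          refine h2.trans ?_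
          rw [← h1]
          push_cast
          exact le_rfl
      _ ≤ Real.exp (m + x : ℕ) * ((m + x).descFactorial m *
            (Real.exp 1 * (m + x : ℕ) * (x / Real.exp 1) ^ x)) := by gcongr
      _ = _ := by
          rw [div_pow, h4, ← Real.exp_nat_mul, sub_eq_add_neg, Real.exp_add (m : ℝ)]
          push_cast
          rw [Real.exp_add, mul_one]
          field_simp
  exact le_of_mul_le_mul_right h5 (by positivity)

end Stirling

section Entropy

theorem log_forty_nine_le : Real.log 0.49 ≤ -0.713147 := by
  have h1 : (0.49 : ℝ) = 0.98 / 2 := by norm_num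
  rw [h1, Real.log_div (by norm_num) (by norm_num)]
  have := Real.log_le_sub_one_of_pos (show (0 : ℝ) < 0.98 by norm_num)
  have := Real.log_two_gt_d9
  linarith

theorem log_thirteen_le : Real.log 13 ≤ 2.58 := by
  rw [Real.log_le_iff_le_exp (by norm_num)]
  have h1 := Real.exp_one_gt_d9
  have h2 : Real.exp 5 = Real.exp 1 ^ 5 := by rw [← Real.exp_nat_mul]; norm_num
  have h3 : (148.3 : ℝ) ≤ Real.exp 5 := by
    rw [h2]
    calc (148.3 : ℝ) ≤ 2.718 ^ 5 := by norm_num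
      _ ≤ _ := by gcongr; linarith
  have h4 : Real.exp 5 = Real.exp 2.5 ^ 2 := by rw [← Real.exp_nat_mul]; norm_num
  have h5 : (12.17 : ℝ) ≤ Real.exp 2.5 := by
    refine le_of_sq_le_sq ?_ (Real.exp_pos _).le
    rw [← h4]
    refine le_trans ?_ h3
    norm_num
  have h6 := Real.add_one_le_exp (0.08 : ℝ)
  rw [show (2.58 : ℝ) = 2.5 + 0.08 by norm_num, Real.exp_add]
  nlinarith

theorem entropy_small {n m : ℝ} (hn : 0 < n) (hm : 0 ≤ m) (h : m ≤ 0.51 * n) :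
    m - (n - m) * Real.log (n / (n - m)) ≤ 0.315 * m := by
  have hx : 0 < n - m := by nlinarith
  set u := (n - m) / n with hu
  have hu0 : 0 < u := by positivity
  have hm' : m = (1 - u) * n := by rw [hu]; field_simp; ring
  have hu1 : u ≤ 1 := by rw [hu, div_le_one hn]; linarith
  have hu2 : 0.49 ≤ u := by rw [hu, le_div_iff₀ hn]; linarith
  have hl : Real.log (n / (n - m)) = - Real.log u := by rw [hu, ← Real.log_inv, inv_div]
  have hα : 0 ≤ (1 - u) / (0.51 : ℝ) := by apply div_nonneg <;> linarith
  have hβ : 0 ≤ (u - 0.49) / (0.51 : ℝ) := by apply div_nonneg <;> linarith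
  have hc := Real.convexOn_mul_log.2 (show (0.49 : ℝ) ∈ Set.Ici 0 by norm_num)
    (show (1 : ℝ) ∈ Set.Ici 0 by norm_num) hα hβ (by field_simp; ring)
  simp only [smul_eq_mul, Real.log_one, mul_zero, add_zero] at hc
  rw [show (1 - u) / 0.51 * 0.49 + (u - 0.49) / 0.51 * 1 = u by field_simp; ring] at hc
  have h2 : u * Real.log u ≤ (1 - u) * (-0.685) := by
    refine hc.trans ?_
    have := log_forty_nine_le
    have h0 : 0 ≤ 1 - u := by linarith
    rw [div_mul_eq_mul_div, mul_div_assoc]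
    refine mul_le_mul_of_nonneg_left ?_ h0
    rw [div_le_iff₀ (by norm_num)]
    linarith
  have h3 : n - m = u * n := by rw [hm']; ring
  rw [hl, h3, hm']
  nlinarith

theorem entropy_mono {n x x₀ : ℝ} (h0 : 0 < x₀) (h1 : x₀ ≤ x) (h2 : x ≤ n) :
    x₀ * (1 + Real.log (n / x₀)) ≤ x * (1 + Real.log (n / x)) := by
  have hx : 0 < x := by linarith
  have hn : 0 < n := by linarith
  have e1 : Real.log (n / x₀) = Real.log (n / x) + Real.log (x / x₀) := by
    rw [← Real.log_mul (by positivity) (by positivity)]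
    congr 1
    field_simp
  have e2 : x₀ * Real.log (x / x₀) ≤ x - x₀ := by
    have := Real.log_le_sub_one_of_pos (show 0 < x / x₀ by positivity)
    calc _ ≤ x₀ * (x / x₀ - 1) := by gcongr
      _ = _ := by field_simp
  have e3 : 0 ≤ Real.log (n / x) := Real.log_nonneg (by rwa [one_le_div hx])
  rw [e1]
  nlinarith

theorem entropy_missing {a n k D S x y : ℝ} (ha : 0 < a) (hD : 0 ≤ D) (hDk : D ≤ 0.501 * k)
    (hx : 0.999 * a * D ≤ x) (hxn : x ≤ n) (hn : 0.999 * a * k ≤ n)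
    (hy0 : 0 ≤ y) (hy : y ≤ a / 2 * Real.log 2) (hS : 0 < D → S * Real.log 2 ≤ D * Real.log (13 * k / D))
    (hS0 : D = 0 → S ≤ 0) :
    y * S - x * (1 + Real.log (n / x)) ≤ -0.03 * a * D := by
  rcases hD.eq_or_lt with rfl | hD
  · have h1 : y * S ≤ 0 := mul_nonpos_of_nonneg_of_nonpos hy0 (hS0 rfl)
    have h2 : 0 ≤ x := by linarith
    have h3 : 0 ≤ Real.log (n / x) := by
      rcases h2.eq_or_lt with rfl | h2
      · simp
      · exact Real.log_nonneg (by rwa [one_le_div h2])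
    have : 0 ≤ x * (1 + Real.log (n / x)) := by positivity
    linarith
  · have hk : 0 < k := by linarith
    set L := Real.log (k / D) with hL
    have hL1 : 0.69 ≤ L := by
      have h1 : (1.996 : ℝ) ≤ k / D := by rw [le_div_iff₀ hD]; linarith
      have h2 : Real.log 1.996 ≤ L := Real.log_le_log (by norm_num) h1
      have h3 : Real.log 1.996 = Real.log 2 - Real.log (2 / 1.996) := by
        rw [Real.log_div (by norm_num) (by norm_num)]; ring
      have h4 := Real.log_le_sub_one_of_pos (show (0 : ℝ) < 2 / 1.996 by norm_num)
      have h5 := Real.log_two_gt_d9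
      have : (2 : ℝ) / 1.996 - 1 ≤ 0.003 := by norm_num
      linarith
    have h1 := entropy_mono (by positivity) hx hxn
    have h2 : L ≤ Real.log (n / (0.999 * a * D)) := by
      refine Real.log_le_log (by positivity) ?_
      rw [div_le_div_iff₀ hD (by positivity)]
      nlinarith
    have h3 : Real.log (13 * k / D) = Real.log 13 + L := by
      rw [mul_div_assoc, Real.log_mul (by norm_num) (by positivity)]
    have h4 : y * S ≤ a / 2 * (D * (2.58 + L)) := by
      have h5 := hS hD
      rw [h3] at h5
      rcases le_or_gt S 0 with hS | hS
      · have : y * S ≤ 0 := mul_nonpos_of_nonneg_of_nonpos hy0 hS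
        have : 0 ≤ a / 2 * (D * (2.58 + L)) := by
          have : 0 ≤ 2.58 + L := by linarith
          positivity
        linarith
      · calc y * S ≤ a / 2 * Real.log 2 * S := by gcongr
          _ = a / 2 * (S * Real.log 2) := by ring
          _ ≤ a / 2 * (D * (Real.log 13 + L)) := by gcongr
          _ ≤ _ := by
            have := log_thirteen_le
            gcongr
    have h6 : 0.999 * a * D * (1 + L) ≤ x * (1 + Real.log (n / x)) := by
      refine le_trans ?_ h1
      gcongr
    have h7 : 0 < a * D := by positivity
    nlinarith

end Entropy

/-- A profile of class sizes `a - 1, …, a - J`: there are `k t` classes of size `a - (t + 1)`,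
where `k t` is the integer part of `P t`. -/
structure Profile (n a J : ℕ) (k : Fin J → ℕ) (P : Fin J → ℝ) (y R : ℝ) : Prop where
  a_pos : 1 ≤ a
  n_pos : 1 ≤ n
  J_le : 1000 * J ≤ a
  le : ∀ t, (k t : ℝ) ≤ P t
  le_add_one : ∀ t, P t ≤ k t + 1
  weight : ∀ t : Fin J, P t * gw (a - ((t : ℕ) + 1)) ≤
    (n : ℝ) ^ (a - ((t : ℕ) + 1)) * Real.exp (R - y * (t + 1 : ℕ) + 2 * (t + 1 : ℕ) ^ 2 / a)
  deficit : (∑ t : Fin J, P t * (R - 1 - y * (t + 1 : ℕ) + 2 * (t + 1 : ℕ) ^ 2 / a)) + (n : ℝ) ≤ 0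
  size : ∑ t : Fin J, P t * (a - (t + 1 : ℕ)) ≤ n
  card_le : (a : ℝ) * ∑ t, P t ≤ 1.02 * n
  tail : ∑ t : Fin J, P t * 2 ^ ((t : ℕ) + 1) ≤ 13 * ∑ t, P t
  J_small : 1000 * J ≤ ∑ t, P t
  y_le : y ≤ a / 2 * Real.log 2
  one_le_R : 1 ≤ R
  le_y : R + 0.326 * a ≤ y

/-- The contribution of a subfamily of classes to the second moment. -/
noncomputable def term (n a : ℕ) {J : ℕ} (k A : Fin J → ℕ) : ℝ :=
  (∏ t : Fin J, gw (a - (t + 1)) ^ A t) / n.descFactorial (∑ t : Fin J, A t * (a - (t + 1))) *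
    ∏ t, ((k t).descFactorial (A t) : ℝ)

theorem choose_le_pow_mul {l : ℝ} (hl : 0 < l) (k d : ℕ) :
    (k.choose d : ℝ) ≤ (l ^ d)⁻¹ * (1 + l) ^ k := by
  rw [inv_mul_eq_div, le_div_iff₀ (by positivity)]
  rcases le_or_gt d k with h | h
  · rw [add_comm 1 l, add_pow]
    have := Finset.single_le_sum (f := fun m => l ^ m * 1 ^ (k - m) * (k.choose m : ℝ))
      (fun i _ => by positivity) (Finset.mem_range.2 (Nat.lt_succ_of_le h))
    simpa [mul_comm] using this
  · rw [Nat.choose_eq_zero_of_lt h]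
    simp only [Nat.cast_zero, zero_mul]
    positivity

namespace Profile

variable {n a J : ℕ} {k : Fin J → ℕ} {P : Fin J → ℝ} {y R : ℝ} (H : Profile n a J k P y R)

include H

theorem P_nonneg (t : Fin J) : 0 ≤ P t := le_trans (Nat.cast_nonneg _) (H.le t)

theorem succ_le (t : Fin J) : (t : ℕ) + 1 ≤ a := by
  have := t.2; have := H.J_le; omega

theorem succ_le_real (t : Fin J) : ((t + 1 : ℕ) : ℝ) ≤ 0.001 * a := by
  have h1 := t.2
  have h2 := H.J_le
  have : 1000 * ((t : ℕ) + 1) ≤ a := by omega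
  have : (1000 : ℝ) * ((t + 1 : ℕ) : ℝ) ≤ a := by exact_mod_cast this
  linarith

theorem cast_sub (t : Fin J) : ((a - (t + 1) : ℕ) : ℝ) = a - (t + 1 : ℕ) := by
  rw [Nat.cast_sub (H.succ_le t)]

theorem prod_le (A : Fin J → ℕ) :
    ∏ t : Fin J, (P t / Real.exp 1) ^ A t * gw (a - (t + 1)) ^ A t ≤
      (n : ℝ) ^ (∑ t : Fin J, A t * (a - (t + 1))) *
        Real.exp (∑ t : Fin J, A t * (R - 1 - y * (t + 1 : ℕ) + 2 * (t + 1 : ℕ) ^ 2 / a)) := by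
  rw [← Finset.prod_pow_eq_pow_sum, Real.exp_sum, ← Finset.prod_mul_distrib]
  refine Finset.prod_le_prod (fun t _ => ?_) fun t _ => ?_
  · have := H.P_nonneg t
    have := gw_pos (a - (t + 1))
    positivity
  · rw [← mul_pow, mul_comm (A t), pow_mul, Real.exp_nat_mul, ← mul_pow]
    have h0 := H.P_nonneg t
    have h1 := gw_pos (a - (t + 1))
    refine pow_le_pow_left₀ (by positivity) ?_ _
    have h2 := H.weight t
    rw [div_mul_eq_mul_div, div_le_iff₀ (Real.exp_pos 1), mul_assoc, ← Real.exp_add]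
    refine h2.trans_eq ?_
    congr 2
    ring

theorem sum_k_le : ∑ t, (k t : ℝ) ≤ ∑ t, P t := Finset.sum_le_sum fun t _ => H.le t

theorem size_le : ∑ t : Fin J, k t * (a - (t + 1)) ≤ n := by
  have : ∑ t : Fin J, (k t : ℝ) * ((a - (t + 1) : ℕ) : ℝ) ≤ n := by
    refine le_trans (Finset.sum_le_sum fun t _ => ?_) H.size
    rw [← H.cast_sub t]
    have := H.le t
    gcongr
  exact_mod_cast this

theorem sum_mul_le {A : Fin J → ℕ} (hA : ∀ t, A t ≤ k t) :
    ∑ t : Fin J, A t * (a - (t + 1)) ≤ n :=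
  (Finset.sum_le_sum fun t _ => Nat.mul_le_mul_right _ (hA t)).trans H.size_le

theorem descFactorial_pos {A : Fin J → ℕ} (hA : ∀ t, A t ≤ k t) :
    (0 : ℝ) < n.descFactorial (∑ t : Fin J, A t * (a - (t + 1))) := by
  have : n.descFactorial (∑ t : Fin J, A t * (a - (t + 1))) ≠ 0 := by
    rw [Ne, Nat.descFactorial_eq_zero_iff_lt, not_lt]
    exact H.sum_mul_le hA
  exact_mod_cast Nat.pos_of_ne_zero this

theorem term_le {A : Fin J → ℕ} (hA : ∀ t, A t ≤ k t) {X : ℝ} (hX0 : 0 ≤ X)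
    (hX : ∏ t, ((k t).descFactorial (A t) : ℝ) ≤ X * ∏ t, (P t / Real.exp 1) ^ A t) {m : ℝ}
    (hm : m = ∑ t : Fin J, (A t : ℝ) * (a - (t + 1 : ℕ))) :
    term n a k A ≤ X * (Real.exp 1 * n * Real.exp (
      (∑ t : Fin J, A t * (R - 1 - y * (t + 1 : ℕ) + 2 * (t + 1 : ℕ) ^ 2 / a)) +
        (m - (n - m) * Real.log (n / (n - m))))) := by
  have hm' : m = ((∑ t : Fin J, A t * (a - (t + 1)) : ℕ) : ℝ) := by
    rw [hm]
    push_cast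
    refine Finset.sum_congr rfl fun t _ => ?_
    rw [H.cast_sub t]
    push_cast
    rfl
  have h1 := pow_le_descFactorial_stirling H.n_pos (H.sum_mul_le hA)
  have h2 := H.prod_le A
  have h3 := H.descFactorial_pos hA
  rw [← hm'] at h1
  unfold term
  rw [div_mul_eq_mul_div, div_le_iff₀ h3]
  have hg : 0 ≤ ∏ t : Fin J, gw (a - (t + 1)) ^ A t :=
    Finset.prod_nonneg fun t _ => pow_nonneg (gw_pos _).le _
  calc _ ≤ (∏ t : Fin J, gw (a - (t + 1)) ^ A t) * (X * ∏ t, (P t / Real.exp 1) ^ A t) := by gcongr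
    _ = X * ∏ t : Fin J, (P t / Real.exp 1) ^ A t * gw (a - (t + 1)) ^ A t := by
        rw [Finset.prod_mul_distrib]; ring
    _ ≤ X * ((n : ℝ) ^ (∑ t : Fin J, A t * (a - (t + 1))) *
        Real.exp (∑ t : Fin J, A t * (R - 1 - y * (t + 1 : ℕ) + 2 * (t + 1 : ℕ) ^ 2 / a))) := by
        gcongr
    _ ≤ X * (n.descFactorial (∑ t : Fin J, A t * (a - (t + 1))) * (Real.exp 1 * n *
      Real.exp (m - (n - m) * Real.log (n / (n - m)))) *
        Real.exp (∑ t : Fin J, A t * (R - 1 - y * (t + 1 : ℕ) + 2 * (t + 1 : ℕ) ^ 2 / a))) := by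
        gcongr
    _ = _ := by rw [Real.exp_add]; ring

theorem term_small {A : Fin J → ℕ} (hA : ∀ t, A t ≤ k t) (h : 2 * ∑ t, A t ≤ ∑ t, k t) :
    term n a k A ≤ Real.exp 1 * n * Real.exp (-(0.01 * a * ∑ t, (A t : ℝ))) := by
  have ha : (0 : ℝ) < a := by exact_mod_cast H.a_pos
  have hn : (0 : ℝ) < n := by exact_mod_cast H.n_pos
  have hX : ∏ t, ((k t).descFactorial (A t) : ℝ) ≤
      Real.exp (∑ t, (A t : ℝ)) * ∏ t, (P t / Real.exp 1) ^ A t := by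
    rw [Real.exp_sum, ← Finset.prod_mul_distrib]
    refine Finset.prod_le_prod (fun t _ => by positivity) fun t _ => ?_
    rw [div_pow, ← Real.exp_nat_mul, mul_one, mul_div_cancel₀ _ (Real.exp_pos _).ne']
    calc ((k t).descFactorial (A t) : ℝ) ≤ (k t : ℝ) ^ A t := by
          exact_mod_cast Nat.descFactorial_le_pow _ _
      _ ≤ _ := by have := H.le t; gcongr
  refine (H.term_le hA (Real.exp_pos _).le hX rfl).trans ?_
  set m := ∑ t : Fin J, (A t : ℝ) * (a - (t + 1 : ℕ)) with hm
  have hm0 : 0 ≤ m := Finset.sum_nonneg fun t _ => by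
    rw [← H.cast_sub t]; positivity
  have hAa : m ≤ a * ∑ t, (A t : ℝ) := by
    rw [hm, Finset.mul_sum]
    refine Finset.sum_le_sum fun t _ => ?_
    have : (0 : ℝ) ≤ (A t : ℝ) * (t + 1 : ℕ) := by positivity
    linarith
  have hm1 : m ≤ 0.51 * n := by
    have h1 : 2 * ∑ t, (A t : ℝ) ≤ ∑ t, P t := le_trans (by exact_mod_cast h) H.sum_k_le
    have h2 := H.card_le
    have h3 : (a : ℝ) * (2 * ∑ t, (A t : ℝ)) ≤ a * ∑ t, P t := by gcongr
    linarith
  have h4 := entropy_small hn hm0 hm1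
  rw [mul_left_comm, ← Real.exp_add]
  gcongr
  have h5 : ∑ t, (A t : ℝ) + (∑ t : Fin J, (A t : ℝ) *
      (R - 1 - y * (t + 1 : ℕ) + 2 * (t + 1 : ℕ) ^ 2 / a) + 0.315 * m) ≤
        -(0.01 * a * ∑ t, (A t : ℝ)) := by
    rw [hm, Finset.mul_sum, Finset.mul_sum, ← Finset.sum_add_distrib, ← Finset.sum_add_distrib,
      ← Finset.sum_neg_distrib]
    refine Finset.sum_le_sum fun t _ => ?_
    have h6 := H.succ_le_real t
    have h7 : (1 : ℝ) ≤ (t + 1 : ℕ) := by exact_mod_cast Nat.succ_le_succ (Nat.zero_le _)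
    set j : ℝ := (((t : ℕ) + 1 : ℕ) : ℝ)
    have h8 : 2 * j ^ 2 / a ≤ 0.002 * j := by
      rw [div_le_iff₀ ha]
      nlinarith
    have h9 := H.le_y
    have h10 := H.one_le_R
    have h11 : (A t : ℝ) * (R + 0.315 * a + 0.01 * a + 2 * j ^ 2 / a - y * j) ≤ 0 := by
      refine mul_nonpos_of_nonneg_of_nonpos (by positivity) ?_
      nlinarith
    nlinarith [show (0 : ℝ) ≤ A t by positivity]
  linarith

theorem term_missing {A : Fin J → ℕ} (hA : ∀ t, A t ≤ k t) (h : ∑ t, k t ≤ 2 * ∑ t, A t) :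
    term n a k A ≤ (1 + Real.exp (-(0.01 * a))) ^ (∑ t, k t) * (Real.exp 1 * n) ^ (J + 1) *
      Real.exp (-(0.01 * a * ∑ t, ((k t : ℝ) - A t))) := by
  have ha : (0 : ℝ) < a := by exact_mod_cast H.a_pos
  have hn : (0 : ℝ) < n := by exact_mod_cast H.n_pos
  have hAr : ∀ t, (A t : ℝ) ≤ k t := fun t => by exact_mod_cast hA t
  set l := Real.exp (-(0.01 * a)) with hl
  have hl0 : 0 < l := Real.exp_pos _
  set X : ℝ := ∏ t : Fin J, ((l ^ (k t - A t))⁻¹ * (1 + l) ^ k t * (Real.exp 1 * n)) with hXdef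
  have hX : ∏ t, ((k t).descFactorial (A t) : ℝ) ≤ X * ∏ t, (P t / Real.exp 1) ^ A t := by
    rw [hXdef, ← Finset.prod_mul_distrib]
    refine Finset.prod_le_prod (fun t _ => by positivity) fun t _ => ?_
    have hAn : A t ≤ n := by
      have h1 : k t * (a - (t + 1)) ≤ n :=
        (Finset.single_le_sum (f := fun t : Fin J => k t * (a - (t + 1)))
          (fun _ _ => Nat.zero_le _) (Finset.mem_univ t)).trans H.size_le
      have h2 : 1 ≤ a - ((t : ℕ) + 1) := by
        have := t.2; have := H.J_le; omega
      exact (hA t).trans ((Nat.le_mul_of_pos_right _ h2).trans h1)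
    have h3 := factorial_le_stirling H.n_pos hAn ((hAr t).trans (H.le t))
    have h4 := choose_le_pow_mul hl0 (k t) (k t - A t)
    rw [Nat.choose_symm (hA t)] at h4
    have h0 := H.P_nonneg t
    rw [Nat.descFactorial_eq_factorial_mul_choose, Nat.cast_mul]
    calc _ ≤ (Real.exp 1 * n * (P t / Real.exp 1) ^ A t) *
        ((l ^ (k t - A t))⁻¹ * (1 + l) ^ k t) := by gcongr
      _ = _ := by ring
  refine (H.term_le hA (by positivity) hX rfl).trans ?_
  set m := ∑ t : Fin J, (A t : ℝ) * (a - (t + 1 : ℕ)) with hm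
  have hm0 : 0 ≤ m := Finset.sum_nonneg fun t _ => by
    rw [← H.cast_sub t]; positivity
  set K := ∑ t, P t with hK
  set D := ∑ t, (P t - A t) with hD
  set S := ∑ t : Fin J, (P t - A t) * ((t + 1 : ℕ) : ℝ) with hS
  have hQ : ∀ t, 0 ≤ P t - A t := fun t => by linarith [hAr t, H.le t]
  have hy0 : 0 ≤ y := by linarith [H.le_y, H.one_le_R]
  have hD0 : 0 ≤ D := Finset.sum_nonneg fun t _ => hQ t
  have hdD : ∑ t, ((k t : ℝ) - A t) ≤ D :=
    Finset.sum_le_sum fun t _ => by linarith [H.le t]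
  have hmain : y * S - (n - m) * (1 + Real.log (n / (n - m))) ≤ -0.03 * a * D := by
    refine entropy_missing (k := K) ha hD0 ?_ ?_ (by linarith) ?_ hy0 H.y_le ?_ ?_
    · have h1 : K ≤ ∑ t, (k t : ℝ) + J := by
        rw [hK]
        calc _ ≤ ∑ t, ((k t : ℝ) + 1) := Finset.sum_le_sum fun t _ => H.le_add_one t
          _ = _ := by simp [Finset.sum_add_distrib]
      have h2 : ∑ t, (k t : ℝ) ≤ 2 * ∑ t, (A t : ℝ) := by exact_mod_cast h
      have h3 := H.J_small
      rw [hD, Finset.sum_sub_distrib]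
      linarith
    · have h1 := H.size
      have h2 : 0.999 * a * D ≤ ∑ t : Fin J, (P t - A t) * (a - (t + 1 : ℕ)) := by
        rw [hD, Finset.mul_sum]
        refine Finset.sum_le_sum fun t _ => ?_
        rw [mul_comm]
        exact mul_le_mul_of_nonneg_left (by linarith [H.succ_le_real t]) (hQ t)
      simp only [sub_mul _ _ ((a : ℝ) - _), Finset.sum_sub_distrib] at h2
      linarith
    · refine le_trans ?_ H.size
      rw [hK, Finset.mul_sum]
      refine Finset.sum_le_sum fun t _ => ?_
      rw [mul_comm]
      exact mul_le_mul_of_nonneg_left (by linarith [H.succ_le_real t]) (H.P_nonneg t)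
    · intro hDp
      have hKp : 0 < K := by
        refine lt_of_lt_of_le hDp ?_
        rw [hD, hK]
        exact Finset.sum_le_sum fun t _ => by linarith [(Nat.cast_nonneg (A t) : (0 : ℝ) ≤ A t)]
      set u := 13 * K / D with hu
      have hup : 0 < u := by positivity
      have h1 : ∀ j : ℕ, (j : ℝ) * Real.log 2 ≤ Real.log u + 2 ^ j / u - 1 := by
        intro j
        have := Real.log_le_sub_one_of_pos (show (0 : ℝ) < 2 ^ j / u by positivity)
        rw [Real.log_div (by positivity) hup.ne', Real.log_pow] at this
        linarith
      have h2 : S * Real.log 2 ≤ ∑ t : Fin J, ((P t - A t) * (Real.log u - 1) +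
          P t * 2 ^ ((t : ℕ) + 1) / u) := by
        rw [hS, Finset.sum_mul]
        refine Finset.sum_le_sum fun t _ => ?_
        have h3 := mul_le_mul_of_nonneg_left (h1 (t + 1)) (hQ t)
        have h4 : (P t - A t) * (2 ^ ((t : ℕ) + 1) / u) ≤ P t * (2 ^ ((t : ℕ) + 1) / u) := by
          gcongr
          linarith [(Nat.cast_nonneg (A t) : (0 : ℝ) ≤ A t)]
        rw [mul_div_assoc]
        linarith
      rw [Finset.sum_add_distrib, ← Finset.sum_mul, ← Finset.sum_div] at h2
      have h3 : (∑ t : Fin J, P t * 2 ^ ((t : ℕ) + 1)) / u ≤ D := by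
        rw [div_le_iff₀ hup, hu, mul_div_cancel₀ _ hDp.ne']
        exact H.tail
      rw [← hD] at h2
      linarith
    · intro hD00
      have h1 : ∀ t ∈ Finset.univ, P t - A t = 0 :=
        (Finset.sum_eq_zero_iff_of_nonneg fun t _ => hQ t).1 hD00
      rw [hS]
      exact (Finset.sum_eq_zero fun t ht => by rw [h1 t ht, zero_mul]).le
  have hexp : (∑ t : Fin J, (A t : ℝ) * (R - 1 - y * (t + 1 : ℕ) + 2 * (t + 1 : ℕ) ^ 2 / a)) +
      (m - (n - m) * Real.log (n / (n - m))) ≤ -0.03 * a * D := by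
    have h1 := H.deficit
    have h2 : y * S ≥ (∑ t : Fin J, (A t : ℝ) *
        (R - 1 - y * (t + 1 : ℕ) + 2 * (t + 1 : ℕ) ^ 2 / a)) -
        ∑ t : Fin J, P t * (R - 1 - y * (t + 1 : ℕ) + 2 * (t + 1 : ℕ) ^ 2 / a) := by
      rw [hS, Finset.mul_sum, ← Finset.sum_sub_distrib]
      refine Finset.sum_le_sum fun t _ => ?_
      have h3 : 0 ≤ (P t - A t) * (R - 1 + 2 * ((t + 1 : ℕ) : ℝ) ^ 2 / a) :=
        mul_nonneg (hQ t) (add_nonneg (by linarith [H.one_le_R]) (by positivity))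
      linarith
    linarith
  have hXe : X = Real.exp (0.01 * a * ∑ t, ((k t : ℝ) - A t)) * (1 + l) ^ (∑ t, k t) *
      (Real.exp 1 * n) ^ J := by
    rw [hXdef, Finset.prod_mul_distrib, Finset.prod_mul_distrib, Finset.prod_const,
      Finset.card_univ, Fintype.card_fin, Finset.prod_pow_eq_pow_sum, Finset.mul_sum, Real.exp_sum]
    congr 2
    refine Finset.prod_congr rfl fun t _ => ?_
    rw [hl, ← Real.exp_nat_mul, ← Real.exp_neg, Nat.cast_sub (hA t)]
    congr 1
    ring
  rw [hXe]
  calc _ ≤ Real.exp (0.01 * a * ∑ t, ((k t : ℝ) - A t)) * (1 + l) ^ (∑ t, k t) *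
      (Real.exp 1 * n) ^ J * (Real.exp 1 * n * Real.exp (-0.03 * a * D)) := by gcongr
    _ = (1 + l) ^ (∑ t, k t) * (Real.exp 1 * n) ^ (J + 1) *
        Real.exp (0.01 * a * ∑ t, ((k t : ℝ) - A t) + -0.03 * a * D) := by
        rw [Real.exp_add]; ring
    _ ≤ _ := by
        gcongr
        have : 0.01 * a * ∑ t, ((k t : ℝ) - A t) ≤ 0.01 * a * D := by gcongr
        have : 0 ≤ 0.01 * a * D := by positivity
        linarith

end Profile

namespace Profile

variable {n a J : ℕ} {k : Fin J → ℕ} {P : Fin J → ℝ} {y R : ℝ} (H : Profile n a J k P y R)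

include H

theorem term_le_add {A : Fin J → ℕ} (hA : ∀ t, A t ≤ k t) :
    term n a k A ≤ (1 + Real.exp (-(0.01 * a))) ^ (∑ t, k t) * (Real.exp 1 * n) ^ (J + 1) *
      (Real.exp (-(0.01 * a)) ^ (∑ t, A t) +
        Real.exp (-(0.01 * a)) ^ (∑ t, k t - ∑ t, A t)) := by
  set l := Real.exp (-(0.01 * a)) with hl
  have hl0 : 0 < l := Real.exp_pos _
  have hn : (1 : ℝ) ≤ n := by exact_mod_cast H.n_pos
  have he : (1 : ℝ) ≤ Real.exp 1 := Real.one_le_exp zero_le_one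
  have hen : 1 ≤ Real.exp 1 * n := by nlinarith
  have h1l : 1 ≤ (1 + l) ^ (∑ t, k t) := one_le_pow₀ (by linarith)
  have hle : ∑ t, A t ≤ ∑ t, k t := Finset.sum_le_sum fun t _ => hA t
  rw [mul_add]
  rcases le_total (2 * ∑ t, A t) (∑ t, k t) with h | h
  · refine le_trans ?_ (le_add_of_nonneg_right (by positivity))
    refine (H.term_small hA h).trans ?_
    have h1 : Real.exp 1 * n ≤ (Real.exp 1 * n) ^ (J + 1) := le_self_pow₀ hen (by simp)
    have h2 : Real.exp (-(0.01 * a * ∑ t, (A t : ℝ))) = l ^ (∑ t, A t) := by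
      rw [hl, ← Real.exp_nat_mul]
      congr 1
      push_cast
      ring
    rw [h2]
    refine mul_le_mul_of_nonneg_right ?_ (by positivity)
    calc _ = 1 * (Real.exp 1 * n) := (one_mul _).symm
      _ ≤ _ := by gcongr
  · refine le_trans ?_ (le_add_of_nonneg_left (by positivity))
    refine (H.term_missing hA h).trans_eq ?_
    congr 1
    rw [hl, ← Real.exp_nat_mul, Nat.cast_sub hle]
    congr 1
    push_cast
    rw [Finset.sum_sub_distrib]
    ring

theorem sum_term_le {x : ℝ} (hx : 0 ≤ x) :
    ∑ D : Finset (Σ t : Fin J, Fin (k t)), (∏ i ∈ D, gw (a - (i.1 + 1))) /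
        n.descFactorial (∑ i ∈ D, (a - (i.1 + 1))) *
      ((1 + x) ^ D.card * ∏ t, ((Finset.univ.filter fun i : Σ t : Fin J, Fin (k t) =>
        i.1 = t).card.descFactorial (D.filter fun i => i.1 = t).card : ℝ)) ≤
      2 * (Real.exp 1 * n) ^ (J + 1) * (1 + Real.exp (-(0.01 * a))) ^ (2 * ∑ t, k t) *
        (1 + x) ^ (∑ t, k t) := by
  classical
  set l := Real.exp (-(0.01 * a)) with hl
  have hl0 : 0 < l := Real.exp_pos _
  have hcard : Fintype.card (Σ t : Fin J, Fin (k t)) = ∑ t, k t := by simp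
  have hfib : ∀ t, (Finset.univ.filter fun i : Σ t : Fin J, Fin (k t) => i.1 = t).card = k t := by
    intro t
    refine Eq.trans (Eq.symm ?_) (Finset.card_fin (k t))
    refine Finset.card_bij (fun j _ => (⟨t, j⟩ : Σ t : Fin J, Fin (k t))) (by simp) ?_ ?_
    · intro j _ j' _ h
      simpa using h
    · rintro ⟨t', j⟩ h
      simp only [Finset.mem_filter, Finset.mem_univ, true_and] at h
      subst h
      exact ⟨j, Finset.mem_univ _, rfl⟩
  have hD : ∀ D : Finset (Σ t : Fin J, Fin (k t)), (∏ i ∈ D, gw (a - (i.1 + 1))) /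
        n.descFactorial (∑ i ∈ D, (a - (i.1 + 1))) *
      ((1 + x) ^ D.card * ∏ t, ((Finset.univ.filter fun i : Σ t : Fin J, Fin (k t) =>
        i.1 = t).card.descFactorial (D.filter fun i => i.1 = t).card : ℝ)) ≤
      ((1 + l) ^ (∑ t, k t) * (Real.exp 1 * n) ^ (J + 1) * (1 + x) ^ (∑ t, k t)) *
      (l ^ D.card + l ^ (∑ t, k t - D.card)) := by
    intro D
    set A : Fin J → ℕ := fun t => (D.filter fun i => i.1 = t).card with hAdef
    have hA : ∀ t, A t ≤ k t := fun t => by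
      rw [← hfib t]
      exact Finset.card_le_card (Finset.filter_subset_filter _ (Finset.subset_univ _))
    have hAs : ∑ t, A t = D.card :=
      (Finset.card_eq_sum_card_fiberwise (f := Sigma.fst) (t := Finset.univ) (by simp)).symm
    have hp : ∏ i ∈ D, gw (a - (i.1 + 1)) = ∏ t : Fin J, gw (a - (t + 1)) ^ A t := by
      rw [← Finset.prod_fiberwise_of_maps_to (g := Sigma.fst) (t := Finset.univ) (by simp)]
      refine Finset.prod_congr rfl fun t _ => ?_
      rw [hAdef, ← Finset.prod_const]
      refine Finset.prod_congr rfl fun i hi => ?_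
      rw [(Finset.mem_filter.1 hi).2]
    have hs : ∑ i ∈ D, (a - (i.1 + 1)) = ∑ t : Fin J, A t * (a - (t + 1)) := by
      rw [← Finset.sum_fiberwise_of_maps_to (g := Sigma.fst) (t := Finset.univ) (by simp)]
      refine Finset.sum_congr rfl fun t _ => ?_
      rw [hAdef, ← smul_eq_mul, ← Finset.sum_const]
      refine Finset.sum_congr rfl fun i hi => ?_
      rw [(Finset.mem_filter.1 hi).2]
    have ht := H.term_le_add hA
    rw [hAs] at ht
    have hDk : D.card ≤ ∑ t, k t := by rw [← hcard]; exact Finset.card_le_univ D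
    have ht0 : 0 ≤ term n a k A := by
      unfold term
      have : 0 ≤ ∏ t : Fin J, gw (a - (t + 1)) ^ A t :=
        Finset.prod_nonneg fun t _ => pow_nonneg (gw_pos _).le _
      positivity
    have hx1 : (1 + x) ^ D.card ≤ (1 + x) ^ (∑ t, k t) := pow_le_pow_right₀ (by linarith) hDk
    simp only [hfib]
    rw [hp, hs]
    calc _ = (1 + x) ^ D.card * term n a k A := by unfold term; ring
      _ ≤ (1 + x) ^ (∑ t, k t) * ((1 + l) ^ (∑ t, k t) * (Real.exp 1 * n) ^ (J + 1) *
          (l ^ D.card + l ^ (∑ t, k t - D.card))) := by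
          gcongr
      _ = _ := by ring
  refine (Finset.sum_le_sum fun D _ => hD D).trans ?_
  rw [← Finset.mul_sum, Finset.sum_add_distrib]
  have e1 := Finset.sum_pow_mul_eq_add_pow l 1 (Finset.univ : Finset (Σ t : Fin J, Fin (k t)))
  have e2 := Finset.sum_pow_mul_eq_add_pow 1 l (Finset.univ : Finset (Σ t : Fin J, Fin (k t)))
  simp only [Finset.powerset_univ, one_pow, mul_one, one_mul, Finset.card_univ, hcard] at e1 e2
  rw [e1, e2, add_comm l 1]
  refine le_of_eq ?_
  rw [two_mul (∑ t, k t), pow_add]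
  ring

theorem one_le_frac_mul {N h : ℕ} {δ : ℝ} (hN : 0 < N)
    (hNn : N + ∑ t : Fin J, k t * (a - (t + 1)) = n) (hah : a ≤ 2 * h + 1)
    (hb : ((a : ℝ) ^ 2 / N) ^ 2 * 2 ^ (h + 1) ≤ 1 / 4) (h0 : 0 ≤ δ) (h1 : δ ≤ 1)
    (hδ : ((a : ℝ) * n) ^ 2 ≤ δ ^ 2 * 2 ^ (a - J + h)) :
    1 ≤ frac (fun G : SimpleGraph (Fin n) => G.Colorable (∑ t, k t + N)) *
      ((1 + 4 * ((a : ℝ) ^ 2 / N) ^ 2) ^ ((∑ t, k t) ^ 2) *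
        (Real.exp (2 * √((∑ t, k t : ℕ) * ((∑ t, k t : ℕ) * J * (a * √δ)))) *
          (2 * (Real.exp 1 * n) ^ (J + 1) * (1 + Real.exp (-(0.01 * a))) ^ (2 * ∑ t, k t) *
            (1 + a * √δ) ^ (∑ t, k t)))) := by
  classical
  let ι := Σ t : Fin J, Fin (k t)
  have hι : Fintype.card ι = ∑ t, k t := by simp [ι]
  let V := Fin N ⊕ (Σ i : ι, Fin (a - (i.1 + 1)))
  have hsum : ∑ i : ι, (a - ((i.1 : ℕ) + 1)) = ∑ t : Fin J, k t * (a - (t + 1)) := by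
    rw [Fintype.sum_sigma]
    simp
  have hV : Fintype.card V = n := by
    rw [← hNn, ← hsum]
    simp [V]
  let c : V → Option ι := Sum.elim (fun _ => none) fun p => some p.1
  have hcs : ∀ i : ι, csize c i = a - ((i.1 : ℕ) + 1) := by
    intro i
    unfold csize
    refine Eq.trans (Eq.symm ?_) (Finset.card_fin _)
    refine Finset.card_bij (fun j _ => (Sum.inr ⟨i, j⟩ : V)) ?_ ?_ ?_
    · intro j _; simp [c]
    · intro j _ j' _ h
      exact eq_of_heq (Sigma.mk.inj_iff.1 (Sum.inr.inj h)).2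
    · rintro (x | ⟨i', j⟩) hx
      · simp [c] at hx
      · simp only [c, Finset.mem_filter, Finset.mem_univ, true_and, Sum.elim_inr,
          Option.some.injEq] at hx
        subst hx
        exact ⟨j, Finset.mem_univ _, rfl⟩
  let A : SimpleGraph V → Prop := fun G => G.Colorable (∑ t, k t + N)
  have hA : ∀ (τ : Equiv.Perm V) (G : SimpleGraph V), A (G.comap τ) ↔ A G := by
    intro τ G
    exact colorable_iff_of_iso (SimpleGraph.Iso.comap τ G)
  have hq : 1 * frac (fun G : SimpleGraph V => Avoids G c) ≤
      frac (fun G : SimpleGraph V => A G ∧ Avoids G c) := by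
    rw [one_mul]
    refine frac_mono ?_
    intro G hG
    refine ⟨?_, hG⟩
    have : G.Coloring (ι ⊕ Fin N) := by
      refine SimpleGraph.Coloring.mk
        (Sum.elim (fun x => Sum.inr x) fun p => Sum.inl p.1) ?_
      rintro (x | ⟨i, x⟩) (y | ⟨j, y⟩) hxy
      · exact fun e => hxy.ne (congrArg _ (Sum.inr.inj e))
      · simp
      · simp
      · simp only [Sum.elim_inr, ne_eq, Sum.inl.injEq]
        rintro rfl
        refine hG s(Sum.inr ⟨i, x⟩, Sum.inr ⟨i, y⟩) ?_ hxy
        rw [mem_mono]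
        refine ⟨by simpa using hxy.ne, i, ?_⟩
        simp [c]
    have := this.colorable
    rwa [Fintype.card_sum, hι, Fintype.card_fin] at this
  have h2 := second_moment c A hA (by norm_num) hq
  have hinj : Function.Injective fun t : Fin J => a - ((t : ℕ) + 1) := by
    intro t t' htt
    have e1 := H.succ_le t
    have e2 := H.succ_le t'
    simp only at htt
    exact Fin.ext (by omega)
  have h4 := sum_overlap_le c (fun i : ι => i.1) (fun t : Fin J => a - ((t : ℕ) + 1)) hinj hcs
    (a := a) (h := h) (N := N) (δ := δ) (ε' := a * √δ) (fun _ => Nat.sub_le _ _) hah hN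
    (by rw [hsum, hV, hNn]) hb h0 h1 (fun i => by
      rw [hV]
      refine hδ.trans ?_
      gcongr
      · norm_num
      · have := i.1.2
        omega) (by positivity) (fun i j _ => le_rfl)
  rw [hV] at h2 h4
  rw [hι, Fintype.card_fin] at h4
  have h5 := H.sum_term_le (x := a * √δ) (by positivity)
  have h6 : (0 : ℝ) < n.factorial := by exact_mod_cast Nat.factorial_pos _
  have h7 : (0 : ℝ) ≤ frac A := frac_nonneg A
  have e : V ≃ Fin n := Fintype.equivFinOfCardEq hV
  have h11 : frac A = frac (fun G : SimpleGraph (Fin n) => G.Colorable (∑ t, k t + N)) := by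
    rw [← frac_equiv e]
    congr 1
    funext G
    exact propext (colorable_iff_of_iso (SimpleGraph.Iso.comap e.symm G)).symm
  rw [← h11]
  refine le_of_mul_le_mul_right ?_ h6
  calc 1 * (n.factorial : ℝ) = 1 ^ 2 * n.factorial := by ring
    _ ≤ _ := h2
    _ ≤ frac A * _ := mul_le_mul_of_nonneg_left h4 h7
    _ ≤ frac A * (n.factorial * ((1 + 4 * ((a : ℝ) ^ 2 / N) ^ 2) ^ ((∑ t, k t) ^ 2) *
        (Real.exp (2 * √((∑ t, k t : ℕ) * ((∑ t, k t : ℕ) * J * (a * √δ)))) *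
          (2 * (Real.exp 1 * n) ^ (J + 1) * (1 + Real.exp (-(0.01 * a))) ^ (2 * ∑ t, k t) *
            (1 + a * √δ) ^ (∑ t, k t))))) := by
        gcongr
    _ = _ := by ring

end Profile

section Fibers

variable {V ι : Type*} [Fintype V] [DecidableEq V] [DecidableEq ι]

/-- The colour class of `i`. -/
def fiber (f : V → ι) (i : ι) : Finset V := Finset.univ.filter fun x => f x = i

omit [DecidableEq V] in
theorem mem_fiber {f : V → ι} {i : ι} {x : V} : x ∈ fiber f i ↔ f x = i := by simp [fiber]

theorem sum_choose_le_card_mono [Fintype ι] (f : V → ι) :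
    ∑ i, (fiber f i).card.choose 2 ≤ (mono fun x => some (f x)).card := by
  have hd : ∀ i ∈ (Finset.univ : Finset ι), ∀ j ∈ (Finset.univ : Finset ι), i ≠ j →
      Disjoint ((fiber f i).offDiag.image Sym2.mk.uncurry)
        ((fiber f j).offDiag.image Sym2.mk.uncurry) := by
    intro i _ j _ hij
    rw [Finset.disjoint_left]
    intro e he he'
    simp only [Finset.mem_image, Finset.mem_offDiag, mem_fiber] at he he'
    obtain ⟨⟨x, y⟩, ⟨hx, hy, -⟩, rfl⟩ := he
    obtain ⟨⟨x', y'⟩, ⟨hx', hy', -⟩, h⟩ := he'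
    simp only [Function.uncurry_apply_pair, Sym2.eq_iff] at h
    rcases h with ⟨rfl, rfl⟩ | ⟨rfl, rfl⟩
    · exact hij (hx.symm.trans hx')
    · exact hij (hy.symm.trans hx')
  rw [Finset.sum_congr rfl fun i _ => (Sym2.card_image_offDiag (fiber f i)).symm,
    ← Finset.card_biUnion hd]
  refine Finset.card_le_card fun e he => ?_
  simp only [Finset.mem_biUnion, Finset.mem_univ, true_and, Finset.mem_image, Finset.mem_offDiag,
    mem_fiber] at he
  obtain ⟨i, ⟨x, y⟩, ⟨hx, hy, hxy⟩, rfl⟩ := he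
  rw [mem_mono]
  refine ⟨by simpa using hxy, i, ?_⟩
  simp [hx, hy]

theorem card_filter_fiber_mul_le [Fintype ι] (s : ι → ℕ) :
    (Finset.univ.filter fun f : V → ι => ∀ i, (fiber f i).card = s i).card * ∏ i, (s i).factorial ≤
      (Fintype.card V).factorial := by
  classical
  set F := Finset.univ.filter fun f : V → ι => ∀ i, (fiber f i).card = s i with hF
  rcases F.eq_empty_or_nonempty with h | ⟨f₀, h₀⟩
  · simp [h]
  rw [← Fintype.card_perm, ← Finset.card_univ]
  have hs : ∀ f ∈ F, ∀ i, Fintype.card {x // f x = i} = s i := by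
    intro f hf i
    rw [← (Finset.mem_filter.1 hf).2 i, Fintype.card_subtype, fiber]
  have hfib : ∀ f ∈ F, ∏ i, (s i).factorial ≤
      (Finset.univ.filter fun ρ : Equiv.Perm V => f₀ ∘ ρ = f).card := by
    intro f hf
    have e : ∀ i, {x // f x = i} ≃ {x // f₀ x = i} := fun i =>
      Fintype.equivOfCardEq (by rw [hs f hf, hs f₀ h₀])
    have hc : Fintype.card (∀ i, {x // f x = i} ≃ {x // f₀ x = i}) = ∏ i, (s i).factorial := by
      rw [Fintype.card_pi]
      exact Finset.prod_congr rfl fun i _ => by rw [Fintype.card_equiv (e i), hs f hf]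
    rw [← hc, ← Finset.card_univ]
    refine Finset.card_le_card_of_injOn (fun u => Equiv.ofFiberEquiv u) ?_ ?_
    · intro u _
      simp only [Finset.coe_filter, Finset.mem_univ, true_and, Set.mem_ofPred_eq]
      funext x
      exact Equiv.ofFiberEquiv_map u x
    · intro u _ u' _ huu
      funext i
      ext ⟨x, rfl⟩
      exact congrArg (fun ρ : Equiv.Perm V => ρ x) huu
  have := Finset.card_nsmul_le_sum F
    (fun f => (Finset.univ.filter fun ρ : Equiv.Perm V => f₀ ∘ ρ = f).card) _ hfib
  rw [smul_eq_mul] at this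
  refine this.trans ?_
  rw [← Finset.card_biUnion]
  · exact Finset.card_le_card (Finset.subset_univ _)
  · intro f _ g _ hfg
    rw [Function.onFun, Finset.disjoint_left]
    intro ρ h1 h2
    exact hfg ((Finset.mem_filter.1 h1).2.symm.trans (Finset.mem_filter.1 h2).2)

theorem sum_prod_fiber_le [Fintype ι] {a : ℕ} (φ : ℕ → ℝ) (h0 : ∀ s, 0 ≤ φ s)
    (hφ : ∀ s, a < s → φ s = 0) {x : ℝ} (hx : 0 ≤ x) :
    (∑ f : V → ι, ∏ i, φ (fiber f i).card) * x ^ Fintype.card V ≤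
      (Fintype.card V).factorial *
        (∑ s ∈ Finset.range (a + 1), φ s * x ^ s / s.factorial) ^ Fintype.card ι := by
  classical
  set B := Fintype.piFinset fun _ : ι => Finset.range (a + 1) with hB
  have hsize : ∀ f : V → ι, ∑ i, (fiber f i).card = Fintype.card V := by
    intro f
    rw [← Finset.card_univ]
    exact (Finset.card_eq_sum_card_fiberwise (f := f) (t := Finset.univ) (by simp)).symm
  have h1 : (∑ f : V → ι, ∏ i, φ (fiber f i).card) * x ^ Fintype.card V =
      ∑ f ∈ Finset.univ.filter fun f : V → ι => (fun i => (fiber f i).card) ∈ B,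
        ∏ i, φ (fiber f i).card * x ^ (fiber f i).card := by
    rw [Finset.sum_mul, Finset.sum_filter]
    refine Finset.sum_congr rfl fun f _ => ?_
    split_ifs with h
    · rw [Finset.prod_mul_distrib, Finset.prod_pow_eq_pow_sum, hsize]
    · rw [hB, Fintype.mem_piFinset] at h
      push Not at h
      obtain ⟨i, hi⟩ := h
      rw [Finset.mem_range, not_lt] at hi
      rw [Finset.prod_eq_zero (Finset.mem_univ i) (hφ _ (by omega)), zero_mul]
  rw [h1, ← Finset.card_univ (α := ι), ← Finset.prod_const, Finset.prod_univ_sum, Finset.mul_sum,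
    ← Finset.sum_fiberwise_of_maps_to (g := fun f i => (fiber f i).card) (t := B)
      (fun f hf => (Finset.mem_filter.1 hf).2)]
  refine Finset.sum_le_sum fun s hs => ?_
  have h2 : ∀ f ∈ (Finset.univ.filter fun f : V → ι => (fun i => (fiber f i).card) ∈ B).filter
      (fun f => (fun i => (fiber f i).card) = s),
      ∏ i, φ (fiber f i).card * x ^ (fiber f i).card = ∏ i, φ (s i) * x ^ s i := by
    intro f hf
    have := (Finset.mem_filter.1 hf).2
    subst this
    rfl
  rw [Finset.sum_congr rfl h2, Finset.sum_const, nsmul_eq_mul]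
  have h3 : ((Finset.univ.filter fun f : V → ι => (fun i => (fiber f i).card) ∈ B).filter
      (fun f => (fun i => (fiber f i).card) = s)).card * ∏ i, (s i).factorial ≤
        (Fintype.card V).factorial := by
    refine le_trans (Nat.mul_le_mul_right _ (Finset.card_le_card ?_)) (card_filter_fiber_mul_le s)
    intro f hf
    simp only [Finset.mem_filter, Finset.mem_univ, true_and] at hf ⊢
    exact fun i => congrFun hf.2 i
  have h4 : (((Finset.univ.filter fun f : V → ι => (fun i => (fiber f i).card) ∈ B).filter
      (fun f => (fun i => (fiber f i).card) = s)).card : ℝ) * ∏ i, ((s i).factorial : ℝ) ≤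
        (Fintype.card V).factorial := by exact_mod_cast h3
  have h5 : 0 < ∏ i, ((s i).factorial : ℝ) :=
    Finset.prod_pos fun i _ => by exact_mod_cast Nat.factorial_pos _
  rw [Finset.prod_div_distrib, mul_div_assoc', le_div_iff₀ h5, mul_right_comm]
  refine mul_le_mul_of_nonneg_right h4 (Finset.prod_nonneg fun i _ => ?_)
  have := h0 (s i)
  positivity

end Fibers

section FirstMoment

variable {V : Type*} [Fintype V] [DecidableEq V]

open scoped Classical in
/-- The independent sets of size `t`. -/
noncomputable def indepSets (G : SimpleGraph V) (t : ℕ) : Finset (Finset V) :=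
  (Finset.univ.powersetCard t).filter fun S => ∀ u ∈ S, ∀ v ∈ S, ¬ G.Adj u v

theorem mem_indepSets {G : SimpleGraph V} {t : ℕ} {S : Finset V} :
    S ∈ indepSets G t ↔ S.card = t ∧ ∀ u ∈ S, ∀ v ∈ S, ¬ G.Adj u v := by
  simp [indepSets, Finset.mem_powersetCard]

theorem frac_indep (S : Finset V) :
    frac (fun G : SimpleGraph V => ∀ u ∈ S, ∀ v ∈ S, ¬ G.Adj u v) =
      (1 / 2) ^ S.card.choose 2 := by
  rw [← Sym2.card_image_offDiag, ← frac_avoid]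
  · congr 1
    funext G
    refine propext ⟨fun h e he => ?_, fun h u hu v hv huv => ?_⟩
    · simp only [Finset.mem_image, Finset.mem_offDiag] at he
      obtain ⟨⟨x, y⟩, ⟨hx, hy, -⟩, rfl⟩ := he
      exact h x hx y hy
    · refine h s(u, v) ?_ huv
      rw [Finset.mem_image]
      exact ⟨(u, v), Finset.mem_offDiag.2 ⟨hu, hv, huv.ne⟩, rfl⟩
  · intro e he
    simp only [Finset.mem_image, Finset.mem_offDiag] at he
    obtain ⟨⟨x, y⟩, ⟨-, -, hxy⟩, rfl⟩ := he
    simpa using hxy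

omit [Fintype V] [DecidableEq V] in
theorem sum_div_card_eq [Fintype (SimpleGraph V)] {β : Type*} (s : Finset β) (w : β → ℝ)
    (Q : β → SimpleGraph V → Prop) [∀ b, DecidablePred (Q b)] :
    (∑ G : SimpleGraph V, ∑ b ∈ s, if Q b G then w b else 0) / Fintype.card (SimpleGraph V) =
      ∑ b ∈ s, w b * frac (Q b) := by
  rw [Finset.sum_comm, Finset.sum_div]
  refine Finset.sum_congr rfl fun b _ => ?_
  rw [frac_eq, ← Finset.sum_filter, Finset.sum_const, nsmul_eq_mul]
  ring

theorem frac_le_card_indepSets (t : ℕ) {m : ℝ} (hm : 0 < m) :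
    frac (fun G : SimpleGraph V => m ≤ (indepSets G t).card) ≤
      (Fintype.card V).choose t * (1 / 2) ^ t.choose 2 / m := by
  classical
  refine (frac_markov (fun G => ((indepSets G t).card : ℝ)) (fun _ => by positivity) hm).trans ?_
  gcongr
  have h1 : ∀ G : SimpleGraph V, ((indepSets G t).card : ℝ) =
      ∑ S ∈ Finset.univ.powersetCard t, if ∀ u ∈ S, ∀ v ∈ S, ¬ G.Adj u v then (1 : ℝ) else 0 := by
    intro G
    rw [Finset.sum_boole, indepSets]
  simp only [h1]
  rw [sum_div_card_eq _ (fun _ => 1) fun (S : Finset V) G => ∀ u ∈ S, ∀ v ∈ S, ¬ G.Adj u v]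
  refine le_of_eq ?_
  rw [Finset.sum_congr rfl (g := fun _ => (1 / 2 : ℝ) ^ t.choose 2), Finset.sum_const,
    Finset.card_powersetCard, Finset.card_univ, nsmul_eq_mul]
  intro S hS
  rw [one_mul, frac_indep, (Finset.mem_powersetCard.1 hS).2]

theorem exists_surjective_coloring {G : SimpleGraph V} {K : ℕ} (h : G.Colorable K)
    (hK : K ≤ Fintype.card V) :
    ∃ f : V → Fin K, Function.Surjective f ∧ ∀ u v, G.Adj u v → f u ≠ f v := by
  classical
  obtain ⟨C⟩ := h
  set F := Finset.univ.filter fun f : V → Fin K => ∀ u v, G.Adj u v → f u ≠ f v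
  obtain ⟨f, hf, hmax⟩ := Finset.exists_max_image F (fun f => (Finset.univ.image f).card)
    ⟨C, Finset.mem_filter.2 ⟨Finset.mem_univ _, fun u v huv => C.valid huv⟩⟩
  have hf' := (Finset.mem_filter.1 hf).2
  refine ⟨f, ?_, hf'⟩
  intro i
  by_contra! hi
  have hlt : (Finset.univ.image f).card < Fintype.card V := by
    refine lt_of_lt_of_le ?_ hK
    refine lt_of_lt_of_eq ?_ (Finset.card_fin K)
    refine Finset.card_lt_card (Finset.ssubset_univ_iff.2 fun h => ?_)
    have := Finset.mem_univ i
    rw [← h, Finset.mem_image] at this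
    obtain ⟨x, -, hx⟩ := this
    exact hi x hx
  obtain ⟨x, -, y, -, hxy, hfxy⟩ := Finset.exists_ne_map_eq_of_card_lt_of_maps_to
    (s := (Finset.univ : Finset V)) (by rwa [Finset.card_univ])
    (fun x _ => Finset.mem_image_of_mem f (Finset.mem_univ x))
  have hg : Function.update f x i ∈ F := by
    refine Finset.mem_filter.2 ⟨Finset.mem_univ _, fun u v huv => ?_⟩
    rcases eq_or_ne u x with rfl | hu
    · rw [Function.update_self, Function.update_of_ne huv.ne']
      exact (hi v).symm
    · rcases eq_or_ne v x with rfl | hv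
      · rw [Function.update_self, Function.update_of_ne hu]
        exact hi u
      · rw [Function.update_of_ne hu, Function.update_of_ne hv]
        exact hf' u v huv
  have h1 := hmax _ hg
  have h2 : insert i (Finset.univ.image f) ⊆ Finset.univ.image (Function.update f x i) := by
    intro j hj
    rw [Finset.mem_insert] at hj
    rw [Finset.mem_image]
    rcases hj with rfl | hj
    · exact ⟨x, Finset.mem_univ _, Function.update_self ..⟩
    · obtain ⟨u, -, rfl⟩ := Finset.mem_image.1 hj
      rcases eq_or_ne u x with rfl | hu
      · exact ⟨y, Finset.mem_univ _, by rw [Function.update_of_ne hxy.symm, hfxy]⟩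
      · exact ⟨u, Finset.mem_univ _, Function.update_of_ne hu ..⟩
  have h3 := Finset.card_le_card h2
  rw [Finset.card_insert_of_notMem (by simpa using hi)] at h3
  omega

/-- The weight of a colour class of size `s`. -/
noncomputable def classW (a : ℕ) (θ : ℝ) (s : ℕ) : ℝ :=
  if 1 ≤ s ∧ s ≤ a then (if s = a then θ⁻¹ else 1) else 0

theorem classW_nonneg {a : ℕ} {θ : ℝ} (hθ : 0 ≤ θ) (s : ℕ) : 0 ≤ classW a θ s := by
  unfold classW
  split_ifs <;> positivity

theorem one_le_prod_classW {G : SimpleGraph V} {a m K : ℕ} {θ : ℝ} (hθ : 1 ≤ θ) {f : V → Fin K}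
    (hs : Function.Surjective f) (hf : ∀ u v, G.Adj u v → f u ≠ f v)
    (hm : (indepSets G a).card ≤ m) (h0 : (indepSets G (a + 1)).card = 0) :
    1 ≤ θ ^ m * ∏ i, classW a θ (fiber f i).card := by
  classical
  have hind : ∀ i, ∀ u ∈ fiber f i, ∀ v ∈ fiber f i, ¬ G.Adj u v := by
    intro i u hu v hv huv
    rw [mem_fiber] at hu hv
    exact hf u v huv (hu.trans hv.symm)
  have hpos : ∀ i, 1 ≤ (fiber f i).card := by
    intro i
    obtain ⟨x, hx⟩ := hs i
    exact Finset.card_pos.2 ⟨x, mem_fiber.2 hx⟩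
  have hle : ∀ i, (fiber f i).card ≤ a := by
    intro i
    by_contra! h
    obtain ⟨S, hS, hSc⟩ := Finset.exists_subset_card_eq (Nat.succ_le_of_lt h)
    have : S ∈ indepSets G (a + 1) :=
      mem_indepSets.2 ⟨hSc, fun u hu v hv => hind i u (hS hu) v (hS hv)⟩
    rw [Finset.card_eq_zero.1 h0] at this
    simp at this
  have hw : ∏ i, classW a θ (fiber f i).card =
      θ⁻¹ ^ (Finset.univ.filter fun i => (fiber f i).card = a).card := by
    rw [← Finset.prod_const, Finset.prod_filter]
    refine Finset.prod_congr rfl fun i _ => ?_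
    rw [classW, if_pos ⟨hpos i, hle i⟩]
  have hc : (Finset.univ.filter fun i => (fiber f i).card = a).card ≤ m := by
    refine le_trans ?_ hm
    refine Finset.card_le_card_of_injOn (fiber f) ?_ ?_
    · intro i hi
      simp only [Finset.coe_filter, Finset.mem_univ, true_and, Set.mem_ofPred_eq] at hi
      exact mem_indepSets.2 ⟨hi, hind i⟩
    · intro i _ j _ hij
      obtain ⟨x, hx⟩ := hs i
      have : x ∈ fiber f j := by rw [← hij]; exact mem_fiber.2 hx
      exact hx.symm.trans (mem_fiber.1 this)
  rw [hw, inv_pow, ← div_eq_mul_inv, one_le_div (by positivity)]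
  exact pow_le_pow_right₀ hθ hc

theorem frac_colorable_and_le {a m K : ℕ} {θ x : ℝ} (hθ : 1 ≤ θ) (hx : 0 < x)
    (hK : K ≤ Fintype.card V) :
    frac (fun G : SimpleGraph V => G.Colorable K ∧ (indepSets G a).card ≤ m ∧
      (indepSets G (a + 1)).card = 0) ≤
    θ ^ m * ((Fintype.card V).factorial / x ^ Fintype.card V) *
      (∑ s ∈ Finset.range (a + 1), classW a θ s * x ^ s / gw s) ^ K / K.factorial := by
  classical
  have hfac : (0 : ℝ) < K.factorial := by exact_mod_cast Nat.factorial_pos _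
  have hθ0 : 0 ≤ θ := by linarith
  set W : (V → Fin K) → ℝ := fun f => θ ^ m * ∏ i, classW a θ (fiber f i).card with hW
  have hW0 : ∀ f, 0 ≤ W f := fun f =>
    mul_nonneg (by positivity) (Finset.prod_nonneg fun i _ => classW_nonneg hθ0 _)
  set Y : SimpleGraph V → ℝ := fun G =>
    ∑ f : V → Fin K, if Avoids G (fun x => some (f x)) then W f else 0 with hY
  have hY0 : ∀ G, 0 ≤ Y G := fun G => Finset.sum_nonneg fun f _ => by
    split_ifs
    · exact hW0 f
    · exact le_rfl
  have h1 : ∀ G : SimpleGraph V, (G.Colorable K ∧ (indepSets G a).card ≤ m ∧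
      (indepSets G (a + 1)).card = 0) → (K.factorial : ℝ) ≤ Y G := by
    rintro G ⟨hG, hm, h0⟩
    obtain ⟨f, hs, hf⟩ := exists_surjective_coloring hG hK
    have hinj : Function.Injective fun σ : Equiv.Perm (Fin K) => (σ ∘ f : V → Fin K) := by
      intro σ σ' h
      ext i
      obtain ⟨x, rfl⟩ := hs i
      exact congrArg Fin.val (congrFun h x)
    calc (K.factorial : ℝ) = ∑ _σ : Equiv.Perm (Fin K), (1 : ℝ) := by
          rw [Finset.sum_const, Finset.card_univ, Fintype.card_perm, Fintype.card_fin]; simp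
      _ ≤ ∑ σ : Equiv.Perm (Fin K), (fun g : V → Fin K =>
          if Avoids G (fun x => some (g x)) then W g else 0) (σ ∘ f) := by
          refine Finset.sum_le_sum fun σ _ => ?_
          have hp : ∀ u v, G.Adj u v → (σ ∘ f) u ≠ (σ ∘ f) v := fun u v huv h =>
            hf u v huv (σ.injective h)
          have hav : Avoids G (fun x => some ((σ ∘ f) x)) := by
            intro e he heG
            induction e with | _ x y =>
            rw [mem_mono] at he
            obtain ⟨-, i, hi⟩ := he
            have hx := hi x (by simp)
            have hy := hi y (by simp)
            exact hp x y heG (Option.some.inj (hx.trans hy.symm))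
          dsimp only
          rw [if_pos hav]
          exact one_le_prod_classW hθ (σ.surjective.comp hs) hp hm h0
      _ = ∑ g ∈ Finset.univ.image (fun σ : Equiv.Perm (Fin K) => (σ ∘ f : V → Fin K)),
          if Avoids G (fun x => some (g x)) then W g else 0 := by
          rw [Finset.sum_image fun σ _ σ' _ h => hinj h]
      _ ≤ Y G := Finset.sum_le_sum_of_subset_of_nonneg (Finset.subset_univ _) fun g _ _ => by
          split_ifs
          · exact hW0 g
          · exact le_rfl
  refine (frac_mono h1).trans ((frac_markov Y hY0 hfac).trans ?_)
  gcongr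
  rw [hY, sum_div_card_eq]
  have h2 : ∑ f : V → Fin K, W f * frac (fun G => Avoids G fun x => some (f x)) ≤
      θ ^ m * ∑ f : V → Fin K, ∏ i, (classW a θ (fiber f i).card *
        (1 / 2) ^ (fiber f i).card.choose 2) := by
    rw [Finset.mul_sum]
    refine Finset.sum_le_sum fun f _ => ?_
    rw [frac_avoids, Finset.prod_mul_distrib, Finset.prod_pow_eq_pow_sum, ← mul_assoc]
    refine mul_le_mul_of_nonneg_left ?_ (hW0 f)
    exact pow_le_pow_of_le_one (by norm_num) (by norm_num) (sum_choose_le_card_mono f)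
  refine h2.trans ?_
  have h3 := sum_prod_fiber_le (V := V) (ι := Fin K) (a := a)
    (fun s => classW a θ s * (1 / 2) ^ s.choose 2)
    (fun s => mul_nonneg (classW_nonneg hθ0 s) (by positivity))
    (fun s hs => by
      rw [classW, if_neg (by omega), zero_mul]) hx.le
  rw [Fintype.card_fin] at h3
  have hxN : 0 < x ^ Fintype.card V := by positivity
  rw [← le_div_iff₀ hxN] at h3
  calc _ ≤ θ ^ m * _ := mul_le_mul_of_nonneg_left h3 (by positivity)
    _ = _ := by
      have h4 : ∀ s, classW a θ s * (1 / 2) ^ s.choose 2 * x ^ s / s.factorial =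
          classW a θ s * x ^ s / gw s := by
        intro s
        have : (0 : ℝ) < s.factorial := by exact_mod_cast Nat.factorial_pos _
        unfold gw
        rw [one_div, inv_pow]
        field_simp
      simp only [h4]
      ring

end FirstMoment

/-- The relative frequency of colour classes of size `a - j`. -/
noncomputable def wt (z : ℝ) (j : ℕ) : ℝ := z ^ j / 2 ^ j.choose 2

theorem wt_succ (z : ℝ) (j : ℕ) : wt z (j + 1) = wt z j * (z / 2 ^ j) := by
  unfold wt
  rw [Nat.choose_succ_succ' j 1, Nat.choose_one_right, pow_succ, pow_add]
  field_simp

theorem wt_pos {z : ℝ} (hz : 0 < z) (j : ℕ) : 0 < wt z j := by unfold wt; positivity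

theorem two_pow_mul_wt_succ (z : ℝ) (j : ℕ) : 2 ^ (j + 1) * wt z (j + 1) = 2 * z * wt z j := by
  rw [wt_succ, pow_succ]
  field_simp

theorem continuous_wt (j : ℕ) : Continuous fun z => wt z j := by
  unfold wt; fun_prop

/-- The total weight. -/
noncomputable def wtSum (z : ℝ) (J : ℕ) : ℝ := ∑ i ∈ Finset.range J, wt z (i + 1)

/-- The average of `j` with respect to the weights `wt z j`. -/
noncomputable def wtMean (z : ℝ) (J : ℕ) : ℝ :=
  (∑ i ∈ Finset.range J, wt z (i + 1) * (i + 1 : ℕ)) / wtSum z J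

theorem twelve_le_wtSum {z : ℝ} (hz : 4 ≤ z) {J : ℕ} (hJ : 2 ≤ J) : 12 ≤ wtSum z J := by
  have h1 : wtSum z 2 ≤ wtSum z J :=
    Finset.sum_le_sum_of_subset_of_nonneg (by simpa using hJ) fun i _ _ => (wt_pos (by linarith) _).le
  have h2 : wtSum z 2 = z + z ^ 2 / 2 := by
    simp [wtSum, Finset.sum_range_succ, wt]
  nlinarith

theorem wt_le {z : ℝ} (h0 : 0 ≤ z) (hz : z ≤ 6) (j : ℕ) : wt z j ≤ 1024 / 2 ^ j := by
  have h1 : ∀ j : ℕ, (12 : ℝ) ^ j ≤ 1024 * 2 ^ j.choose 2 := by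
    intro j
    rcases lt_or_ge j 4 with h | h
    · interval_cases j <;> norm_num [Nat.choose]
    · induction j, h using Nat.le_induction with
      | base => norm_num [Nat.choose]
      | succ j hj ih =>
        rw [Nat.choose_succ_succ' j 1, Nat.choose_one_right, pow_succ, pow_add]
        have : (2 : ℝ) ^ 4 ≤ 2 ^ j := pow_le_pow_right₀ (by norm_num) hj
        have h3 : (0 : ℝ) < 2 ^ j.choose 2 := by positivity
        nlinarith
  unfold wt
  rw [div_le_div_iff₀ (by positivity) (by positivity), ← mul_pow]
  exact (pow_le_pow_left₀ (by positivity) (by linarith) j).trans (h1 j)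

theorem sum_wt_le {z : ℝ} (h0 : 0 ≤ z) (hz : z ≤ 6) {J L : ℕ} (h : J ≤ L) :
    wtSum z L ≤ wtSum z J + 1024 / 2 ^ J := by
  have : wtSum z L ≤ wtSum z J + (1024 / 2 ^ J - 1024 / 2 ^ L) := by
    induction L, h using Nat.le_induction with
    | base => simp
    | succ L hL ih =>
      have h1 : wtSum z (L + 1) = wtSum z L + wt z (L + 1) := Finset.sum_range_succ _ _
      have h2 := wt_le h0 hz (L + 1)
      have h3 : (1024 : ℝ) / 2 ^ L = 2 * (1024 / 2 ^ (L + 1)) := by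
        rw [pow_succ]; field_simp
      linarith
  have : (0 : ℝ) ≤ 1024 / 2 ^ L := by positivity
  linarith

theorem wtSum_le {z : ℝ} (h0 : 0 ≤ z) (hz : z ≤ 6) (J : ℕ) : wtSum z J ≤ 1024 := by
  have := sum_wt_le h0 hz (Nat.zero_le J)
  simpa [wtSum] using this

theorem sum_two_pow_wt_le {z : ℝ} (hz : 4 ≤ z) (hz' : z ≤ 6) {J : ℕ} (hJ : 2 ≤ J) :
    ∑ i ∈ Finset.range J, wt z (i + 1) * 2 ^ (i + 1) ≤ 13 * wtSum z J := by
  have h12 := twelve_le_wtSum hz hJ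
  have h1 : ∑ i ∈ Finset.range J, wt z (i + 1) * 2 ^ (i + 1) =
      2 * z * ∑ i ∈ Finset.range J, wt z i := by
    rw [Finset.mul_sum]
    exact Finset.sum_congr rfl fun i _ => by rw [mul_comm, two_pow_mul_wt_succ]
  have h2 : ∑ i ∈ Finset.range J, wt z i ≤ 1 + wtSum z J := by
    have h3 := Finset.sum_range_succ (fun i => wt z i) J
    have h4 := Finset.sum_range_succ' (fun i => wt z i) J
    have h5 := wt_pos (show 0 < z by linarith) J
    have h6 : wt z 0 = 1 := by simp [wt]
    unfold wtSum
    linarith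
  rw [h1]
  have h7 : 0 ≤ ∑ i ∈ Finset.range J, wt z i :=
    Finset.sum_nonneg fun i _ => (wt_pos (by linarith) _).le
  nlinarith

theorem sq_le_two_pow (j : ℕ) : (j : ℝ) ^ 2 ≤ 2 * 2 ^ j := by
  have : j ^ 2 ≤ 2 * 2 ^ j := by
    rcases lt_or_ge j 4 with h | h
    · interval_cases j <;> norm_num
    · induction j, h using Nat.le_induction with
      | base => norm_num
      | succ j hj ih => rw [pow_succ 2]; nlinarith
  exact_mod_cast this

theorem sum_sq_wt_le {z : ℝ} (hz : 4 ≤ z) (hz' : z ≤ 6) {J : ℕ} (hJ : 2 ≤ J) :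
    ∑ i ∈ Finset.range J, wt z (i + 1) * ((i + 1 : ℕ) : ℝ) ^ 2 ≤ 26 * wtSum z J := by
  have h1 := sum_two_pow_wt_le hz hz' hJ
  have h2 : ∑ i ∈ Finset.range J, wt z (i + 1) * ((i + 1 : ℕ) : ℝ) ^ 2 ≤
      2 * ∑ i ∈ Finset.range J, wt z (i + 1) * 2 ^ (i + 1) := by
    rw [Finset.mul_sum]
    refine Finset.sum_le_sum fun i _ => ?_
    have := mul_le_mul_of_nonneg_left (sq_le_two_pow (i + 1)) (wt_pos (show 0 < z by linarith) (i + 1)).le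
    linarith
  linarith

theorem wtMean_le {z : ℝ} (hz : 4 ≤ z) (hz' : z ≤ 6) {J : ℕ} (hJ : 2 ≤ J) : wtMean z J ≤ 13 := by
  unfold wtMean
  rw [div_le_iff₀ (by linarith [twelve_le_wtSum hz hJ])]
  refine le_trans (Finset.sum_le_sum fun i _ => ?_) (sum_two_pow_wt_le hz hz' hJ)
  refine mul_le_mul_of_nonneg_left ?_ (wt_pos (by linarith) _).le
  exact_mod_cast (Nat.lt_two_pow_self).le

theorem one_le_wtMean {z : ℝ} (hz : 4 ≤ z) {J : ℕ} (hJ : 2 ≤ J) : 1 ≤ wtMean z J := by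
  unfold wtMean
  rw [le_div_iff₀ (by linarith [twelve_le_wtSum hz hJ]), one_mul]
  refine Finset.sum_le_sum fun i _ => ?_
  refine le_mul_of_one_le_right (wt_pos (by linarith) _).le ?_
  exact_mod_cast Nat.succ_le_succ (Nat.zero_le i)

theorem continuousOn_wtMean {J : ℕ} (hJ : 2 ≤ J) :
    ContinuousOn (fun z => wtMean z J) (Set.Icc 4 6) := by
  unfold wtMean wtSum
  refine ContinuousOn.div ?_ ?_ fun z hz => ?_
  · exact (continuous_finsetSum _ fun i _ => (continuous_wt _).mul continuous_const).continuousOn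
  · exact (continuous_finsetSum _ fun i _ => continuous_wt _).continuousOn
  · have := twelve_le_wtSum hz.1 hJ
    unfold wtSum at this
    linarith

theorem wtMean_four_le {J : ℕ} (hJ : 8 ≤ J) : wtMean 4 J ≤ 2.7 := by
  unfold wtMean
  rw [div_le_iff₀ (by linarith [twelve_le_wtSum (z := 4) le_rfl (show 2 ≤ J by omega)])]
  have h1 : ∀ j : ℕ, 8 ≤ j → wt 4 j * j ≤ 1 / 2 ^ j := by
    intro j hj
    induction j, hj using Nat.le_induction with
    | base => norm_num [wt, Nat.choose]
    | succ j hj ih =>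
      rw [wt_succ]
      have h2 : (2 : ℝ) ^ 8 ≤ 2 ^ j := pow_le_pow_right₀ (by norm_num) hj
      have h3 : (8 : ℝ) ≤ j := by exact_mod_cast hj
      have h4 := wt_pos (show (0 : ℝ) < 4 by norm_num) j
      have h5 : wt 4 j * (4 / 2 ^ j) * ((j + 1 : ℕ) : ℝ) ≤ wt 4 j * j * (1 / 2) := by
        push_cast
        rw [mul_assoc, mul_assoc]
        refine mul_le_mul_of_nonneg_left ?_ h4.le
        rw [div_mul_eq_mul_div, div_le_iff₀ (by positivity)]
        nlinarith
      rw [pow_succ]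
      calc _ ≤ _ := h5
        _ ≤ 1 / 2 ^ j * (1 / 2) := by gcongr
        _ = _ := by field_simp
  have h6 : ∑ i ∈ Finset.range J, wt 4 (i + 1) * (((i + 1 : ℕ) : ℝ) - 2.7) ≤ - (1 / 2 ^ J) := by
    induction J, hJ using Nat.le_induction with
    | base => norm_num [Finset.sum_range_succ, wt, Nat.choose]
    | succ J hJ ih =>
      rw [Finset.sum_range_succ]
      have h7 := h1 (J + 1) (by omega)
      have h8 := wt_pos (show (0 : ℝ) < 4 by norm_num) (J + 1)
      have h9 : (1 : ℝ) / 2 ^ J = 2 * (1 / 2 ^ (J + 1)) := by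
        rw [pow_succ]; field_simp
      linarith
  have h10 : (0 : ℝ) < 1 / 2 ^ J := by positivity
  simp only [mul_sub, Finset.sum_sub_distrib, ← Finset.sum_mul] at h6
  unfold wtSum
  linarith

theorem three_le_wtMean_six {J : ℕ} (hJ : 5 ≤ J) : 3 ≤ wtMean 6 J := by
  unfold wtMean
  rw [le_div_iff₀ (by linarith [twelve_le_wtSum (z := 6) (by norm_num) (show 2 ≤ J by omega)])]
  have h6 : 0 ≤ ∑ i ∈ Finset.range J, wt 6 (i + 1) * (((i + 1 : ℕ) : ℝ) - 3) := by
    induction J, hJ using Nat.le_induction with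
    | base => norm_num [Finset.sum_range_succ, wt, Nat.choose]
    | succ J hJ ih =>
      rw [Finset.sum_range_succ]
      refine add_nonneg ih (mul_nonneg (wt_pos (by norm_num) _).le ?_)
      have : (5 : ℝ) ≤ J := by exact_mod_cast hJ
      push_cast
      linarith
  simp only [mul_sub, Finset.sum_sub_distrib, ← Finset.sum_mul] at h6
  unfold wtSum
  linarith

theorem gw_mul_two_pow (a j : ℕ) (h : j ≤ a) :
    gw a * 2 ^ j.choose 2 = gw (a - j) * a.descFactorial j * 2 ^ ((a - 1) * j) := by
  obtain ⟨b, rfl⟩ := Nat.exists_eq_add_of_le' h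
  rcases Nat.eq_zero_or_pos j with rfl | hj
  · simp
  have h1 := choose_two_add b j
  have h2 := two_mul_choose_two j
  have h3 : (b + j).choose 2 + j.choose 2 = b.choose 2 + (b + j - 1) * j := by
    obtain ⟨i, rfl⟩ := Nat.exists_eq_add_of_le' hj
    rw [h1, show b + (i + 1) - 1 = b + i by omega]
    nlinarith
  have h4 : (b + j).factorial = b.factorial * (b + j).descFactorial j := by
    rw [← Nat.factorial_mul_descFactorial (Nat.le_add_left j b), Nat.add_sub_cancel]
  unfold gw
  rw [Nat.add_sub_cancel, mul_assoc, ← pow_add, h3, h4, pow_add]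
  push_cast
  ring

/-- The expected number of independent sets of size `a` in a random graph on `n` vertices,
up to a factor close to one. -/
noncomputable def expSets (n a : ℕ) : ℝ := (n : ℝ) ^ a / gw a

/-- The logarithm of the ratio between the expected numbers of independent sets of sizes
`a - 1` and `a`, normalised by `z`. -/
noncomputable def logRatio (n a : ℕ) (z : ℝ) : ℝ := Real.log (a * 2 ^ (a - 1) / n / z)

theorem pow_div_gw_sub {n a j : ℕ} {z : ℝ} (hn : 0 < n) (ha : 0 < a) (hz : 0 < z) (h : j ≤ a) :
    (n : ℝ) ^ (a - j) / gw (a - j) = expSets n a * (a.descFactorial j / (a : ℝ) ^ j) *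
      (Real.exp (logRatio n a z * j) * wt z j) := by
  have h1 := gw_mul_two_pow a j h
  have hn' : (0 : ℝ) < n := by exact_mod_cast hn
  have ha' : (0 : ℝ) < a := by exact_mod_cast ha
  have h2 : Real.exp (logRatio n a z * j) = (a * 2 ^ (a - 1) / n / z) ^ j := by
    rw [mul_comm, Real.exp_nat_mul, logRatio, Real.exp_log (by positivity)]
  have h3 : (n : ℝ) ^ a = n ^ (a - j) * n ^ j := by rw [← pow_add]; congr 1; omega
  have g1 := gw_pos a
  have g2 := gw_pos (a - j)
  rw [h2, expSets, wt, h3]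
  have h4 : ((2 : ℝ) ^ (a - 1)) ^ j = 2 ^ ((a - 1) * j) := (pow_mul _ _ _).symm
  simp only [div_pow, mul_pow]
  rw [h4]
  field_simp
  rw [h1]

theorem descFactorial_div_pow_le (a j : ℕ) : (a.descFactorial j : ℝ) / (a : ℝ) ^ j ≤ 1 := by
  refine div_le_one_of_le₀ ?_ (by positivity)
  exact_mod_cast Nat.descFactorial_le_pow a j

theorem exp_le_descFactorial_div_pow {a j : ℕ} (ha : 0 < a) (h : 2 * j ≤ a) :
    Real.exp (-(2 * (j : ℝ) ^ 2 / a)) ≤ (a.descFactorial j : ℝ) / (a : ℝ) ^ j := by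
  have ha' : (0 : ℝ) < a := by exact_mod_cast ha
  induction j with
  | zero => simp
  | succ j ih =>
    have h1 := ih (by omega)
    have h2 : ((j : ℝ) + 1) * 2 ≤ a := by
      have : ((2 * (j + 1) : ℕ) : ℝ) ≤ a := by exact_mod_cast h
      push_cast at this
      linarith
    rw [Nat.descFactorial_succ, pow_succ (a : ℝ) j]
    have h3 : (((a - j) * a.descFactorial j : ℕ) : ℝ) / ((a : ℝ) ^ j * a)
        = (a.descFactorial j : ℝ) / (a : ℝ) ^ j * (1 - j / a) := by
      rw [Nat.cast_mul, Nat.cast_sub (by omega)]; field_simp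
    rw [h3]
    have h4 : Real.exp (-(2 * (j : ℝ) / a)) ≤ 1 - j / a := by
      have hx : (j : ℝ) / a ≤ 1 / 2 := by rw [div_le_div_iff₀ ha' (by norm_num)]; linarith
      have hx0 : 0 ≤ (j : ℝ) / a := by positivity
      have := Real.add_one_le_exp (2 * ((j : ℝ) / a))
      rw [show 2 * (j : ℝ) / a = 2 * (j / a) by ring, Real.exp_neg, inv_le_comm₀ (Real.exp_pos _) (by linarith)]
      refine le_trans ?_ this
      rw [inv_le_iff_one_le_mul₀ (by linarith)]
      nlinarith
    have h5 : Real.exp (-(2 * ((j + 1 : ℕ) : ℝ) ^ 2 / a)) ≤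
        Real.exp (-(2 * (j : ℝ) ^ 2 / a)) * Real.exp (-(2 * (j : ℝ) / a)) := by
      rw [← Real.exp_add, Real.exp_le_exp, ← neg_add, neg_le_neg_iff, ← add_div]
      push_cast
      gcongr
      nlinarith [(Nat.cast_nonneg j : (0:ℝ) ≤ j)]
    refine h5.trans ?_
    gcongr

/-- `n` is close to the largest number of vertices for which the expected number of independent
sets of size `a` is at most `n / (2000 a ^ 2)`. -/
structure Scale (n a : ℕ) : Prop where
  le_gw : 2000 * (a : ℝ) ^ 2 * n ^ a ≤ n * gw a
  gw_le : n * gw a ≤ 4000 * (a : ℝ) ^ 2 * n ^ a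
  sq_le : (n : ℝ) ^ 2 ≤ a ^ 2 * 2 ^ a
  le_sq : (a : ℝ) ^ 2 * 2 ^ a ≤ 25 * n ^ 2

theorem gw_sq (a : ℕ) : gw a ^ 2 = (a.factorial : ℝ) ^ 2 * (2 ^ a) ^ (a - 1) := by
  unfold gw
  rw [mul_pow, ← pow_mul, ← pow_mul]
  congr 2
  rcases Nat.eq_zero_or_pos a with rfl | h
  · simp
  obtain ⟨b, rfl⟩ := Nat.exists_eq_add_of_le' h
  have := two_mul_choose_two (b + 1)
  rw [Nat.add_sub_cancel]
  nlinarith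

theorem sq_le_of_pow_le {m a : ℕ} (ha : 2 ≤ a) (h : (m : ℝ) ^ (a - 1) * (2000 * a ^ 2) ≤ gw a) :
    (m : ℝ) ^ 2 ≤ a ^ 2 * 2 ^ a := by
  have ha' : (2 : ℝ) ≤ a := by exact_mod_cast ha
  have h1 : ((m : ℝ) ^ (a - 1) * a) ^ 2 ≤ gw a ^ 2 := by
    refine pow_le_pow_left₀ (by positivity) (le_trans ?_ h) 2
    gcongr; nlinarith
  have h2 : (a.factorial : ℝ) ≤ a ^ a := by exact_mod_cast Nat.factorial_le_pow a
  have h3 : (a : ℝ) ^ a = a ^ (a - 1) * a := by rw [← pow_succ]; congr 1; omega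
  rw [gw_sq] at h1
  have h4 : ((m : ℝ) ^ 2) ^ (a - 1) * (a : ℝ) ^ 2 ≤ (a ^ 2 * 2 ^ a) ^ (a - 1) * (a : ℝ) ^ 2 := by
    calc _ = ((m : ℝ) ^ (a - 1) * a) ^ 2 := by ring
      _ ≤ _ := h1
      _ ≤ (a ^ a) ^ 2 * (2 ^ a) ^ (a - 1) := by gcongr
      _ = _ := by rw [h3, mul_pow, mul_pow, pow_right_comm]; ring
  have h5 := le_of_mul_le_mul_right h4 (by positivity)
  exact (pow_le_pow_iff_left₀ (by positivity) (by positivity) (by omega)).1 h5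

theorem eventually_pow_le_gw : ∀ᶠ a : ℕ in atTop, ∀ m : ℕ, 16 * (m : ℝ) ^ 2 ≤ a ^ 2 * 2 ^ a →
    (m : ℝ) ^ (a - 1) * (2000 * a ^ 2) ≤ gw a := by
  have h0 := (isLittleO_pow_const_const_pow_of_one_lt (R := ℝ) 2 (one_lt_two)).def
    (show (0 : ℝ) < 1 / 64000000 by norm_num)
  filter_upwards [h0, eventually_ge_atTop 1] with a h ha m hm
  simp only [Real.norm_eq_abs] at h
  rw [abs_of_nonneg (by positivity), abs_of_nonneg (by positivity)] at h
  have ha' : (1 : ℝ) ≤ a := by exact_mod_cast ha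
  refine le_of_sq_le_sq ?_ (gw_pos a).le
  rw [gw_sq]
  have h1 := pow_le_exp_mul_factorial a
  have h1' : ((a : ℝ) ^ a) ^ 2 ≤ 8 ^ a * (a.factorial : ℝ) ^ 2 := by
    have e : Real.exp a ^ 2 ≤ 8 ^ a := by
      rw [← mul_one (a : ℝ), Real.exp_nat_mul, pow_right_comm]
      have := Real.exp_one_lt_d9
      have := Real.exp_pos 1
      gcongr
      nlinarith
    calc _ ≤ (Real.exp a * a.factorial) ^ 2 := by gcongr
      _ = Real.exp a ^ 2 * (a.factorial : ℝ) ^ 2 := by ring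
      _ ≤ _ := by gcongr
  have h3 : (a : ℝ) ^ a = a ^ (a - 1) * a := by rw [← pow_succ]; congr 1; omega
  have h16 : (16 : ℝ) ^ (a - 1) * 16 = 2 ^ a * 8 ^ a := by
    rw [← pow_succ, show a - 1 + 1 = a by omega, ← mul_pow]; norm_num
  have h5 : (16 * (m : ℝ) ^ 2) ^ (a - 1) ≤ (a ^ 2 * 2 ^ a) ^ (a - 1) := by gcongr
  have h6 : 8 ^ a * (16 * (((m : ℝ) ^ (a - 1) * (2000 * a ^ 2)) ^ 2) * 2 ^ a) ≤
      8 ^ a * (16 * ((a.factorial : ℝ) ^ 2 * (2 ^ a) ^ (a - 1)) * 2 ^ a) := by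
    calc _ = (16 * (m : ℝ) ^ 2) ^ (a - 1) * (16 * 16 * (4000000 * (a:ℝ) ^ 4)) := by
          rw [mul_pow 16, mul_pow]
          linear_combination (-16 * ((m : ℝ) ^ (a - 1)) ^ 2 * (4000000 * (a:ℝ) ^ 4)) * h16
      _ ≤ (a ^ 2 * 2 ^ a) ^ (a - 1) * (16 * 16 * (4000000 * (a:ℝ) ^ 4)) := by gcongr
      _ = (2 ^ a) ^ (a - 1) * ((a : ℝ) ^ a) ^ 2 * (16 * (64000000 * a ^ 2)) := by
          rw [h3, mul_pow]; ring
      _ ≤ (2 ^ a) ^ (a - 1) * (8 ^ a * (a.factorial : ℝ) ^ 2) * (16 * 2 ^ a) := by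
          gcongr; linarith
      _ = _ := by ring
  have h7 := le_of_mul_le_mul_left h6 (by positivity)
  have h8 := le_of_mul_le_mul_right h7 (by positivity)
  linarith

theorem exists_scale : ∀ᶠ a : ℕ in atTop, ∃ n, Scale n a := by
  classical
  filter_upwards [eventually_pow_le_gw, eventually_ge_atTop 10] with a ha h10
  let Q : ℕ → Prop := fun m => (m : ℝ) ^ (a - 1) * (2000 * a ^ 2) ≤ gw a
  have hQ : ∀ m, Q m → (m : ℝ) ^ 2 ≤ a ^ 2 * 2 ^ a := fun m hm => sq_le_of_pow_le (by omega) hm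
  have h10' : (10 : ℝ) ≤ a := by exact_mod_cast h10
  set n := Nat.findGreatest Q (a * 2 ^ a) with hn
  have h0 : Q n := by
    refine Nat.findGreatest_spec (Nat.zero_le _) (m := 0) ?_
    change ((0 : ℕ) : ℝ) ^ (a - 1) * (2000 * (a : ℝ) ^ 2) ≤ gw a
    rw [Nat.cast_zero, zero_pow (by omega), zero_mul]
    exact (gw_pos a).le
  have h1 : ¬ Q (n + 1) := by
    intro h
    have h2 : n + 1 ≤ a * 2 ^ a := by
      have h3 := hQ _ h
      have h4 : ((n + 1 : ℕ) : ℝ) ^ 2 ≤ (a * 2 ^ a) ^ 2 := by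
        refine h3.trans ?_
        rw [mul_pow]
        gcongr
        exact le_self_pow₀ (one_le_pow₀ (by norm_num)) (by norm_num)
      exact_mod_cast (pow_le_pow_iff_left₀ (by positivity) (by positivity) two_ne_zero).1 h4
    exact Nat.findGreatest_is_greatest (Nat.lt_succ_self _) h2 h
  have h2 : (a : ℝ) ^ 2 * 2 ^ a < 16 * ((n + 1 : ℕ) : ℝ) ^ 2 := by
    by_contra hc
    exact h1 (ha _ (not_lt.1 hc))
  have h3 : 2 * a ≤ n := by
    by_contra hc
    have h4 : ((n + 1 : ℕ) : ℝ) ≤ 2 * a := by exact_mod_cast (by omega : n + 1 ≤ 2 * a)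
    have h5 : (2 : ℝ) ^ 10 ≤ 2 ^ a := pow_le_pow_right₀ (by norm_num) h10
    have h6 : ((n + 1 : ℕ) : ℝ) ^ 2 ≤ (2 * a) ^ 2 := by gcongr
    nlinarith
  have h3' : 2 * (a : ℝ) ≤ n := by exact_mod_cast h3
  have hn0 : (0 : ℝ) < n := by linarith
  have hpow : (n : ℝ) ^ a = n * n ^ (a - 1) := by rw [← pow_succ']; congr 1; omega
  refine ⟨n, ⟨?_, ?_, hQ n h0, ?_⟩⟩
  · rw [hpow]
    calc _ = n * ((n : ℝ) ^ (a - 1) * (2000 * a ^ 2)) := by ring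
      _ ≤ _ := by gcongr
  · have h4 : gw a ≤ ((n + 1 : ℕ) : ℝ) ^ (a - 1) * (2000 * a ^ 2) := (not_le.1 h1).le
    have h5 : ((n + 1 : ℕ) : ℝ) ^ (a - 1) ≤ 2 * n ^ (a - 1) := by
      have e1 : ((n + 1 : ℕ) : ℝ) = n * (1 + 1 / n) := by push_cast; field_simp
      have e2 : (1 + 1 / (n : ℝ)) ^ (a - 1) ≤ Real.exp (1 / 2) := by
        calc _ ≤ Real.exp (1 / n) ^ (a - 1) := by
              gcongr; linarith [Real.add_one_le_exp (1 / (n : ℝ))]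
          _ = Real.exp ((a - 1 : ℕ) * (1 / n)) := (Real.exp_nat_mul _ _).symm
          _ ≤ _ := by
              rw [Real.exp_le_exp, Nat.cast_sub (by omega), mul_one_div, div_le_div_iff₀ hn0 (by norm_num)]
              push_cast; linarith
      have e3 : Real.exp (1 / 2) ≤ 2 := by
        have : Real.exp (1 / 2) ^ 2 = Real.exp 1 := by rw [← Real.exp_nat_mul]; norm_num
        nlinarith [Real.exp_one_lt_d9, Real.exp_pos (1 / 2)]
      rw [e1, mul_pow, mul_comm 2]
      gcongr
      linarith
    rw [hpow]
    calc n * gw a ≤ n * ((2 * n ^ (a - 1)) * (2000 * a ^ 2)) := by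
          gcongr; exact h4.trans (by gcongr)
      _ = _ := by ring
  · push_cast at h2
    nlinarith

/-- Conditions expressing that `a` and `n` are large. -/
structure Large (n a : ℕ) : Prop where
  le_a : 1000000 ≤ a
  log_le : 10000 * Real.log a ≤ a
  le_n : (a : ℝ) ^ 40 ≤ n
  le_log : 1000 ≤ Real.log a

theorem eventually_large : ∀ᶠ a : ℕ in atTop, ∀ n, Scale n a → Large n a := by
  have h0 := (isLittleO_pow_const_const_pow_of_one_lt (R := ℝ) 80 (one_lt_two)).def
    (show (0 : ℝ) < 1 by norm_num)
  have h1 := (Real.isLittleO_log_id_atTop.comp_tendsto tendsto_natCast_atTop_atTop).def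
    (show (0 : ℝ) < 1 / 10000 by norm_num)
  filter_upwards [h0, h1, eventually_ge_atTop 1000000,
    (Real.tendsto_log_atTop.comp tendsto_natCast_atTop_atTop).eventually_ge_atTop 1000] with a h0 h1 ha h2 n S
  have ha' : (1000000 : ℝ) ≤ a := by exact_mod_cast ha
  refine ⟨ha, ?_, ?_, h2⟩
  · simp only [Function.comp, id, Real.norm_eq_abs] at h1
    rw [abs_of_nonneg (Real.log_nonneg (by linarith)), abs_of_nonneg (by linarith)] at h1
    linarith
  · simp only [Real.norm_eq_abs] at h0
    rw [abs_of_nonneg (by positivity), abs_of_nonneg (by positivity)] at h0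
    have h2 := S.le_sq
    refine (pow_le_pow_iff_left₀ (by positivity) (by positivity) two_ne_zero).1 ?_
    rw [← pow_mul]
    norm_num1 at h0 ⊢
    have h3 : (25 : ℝ) * 2 ^ a ≤ a ^ 2 * 2 ^ a := by gcongr; nlinarith
    nlinarith

theorem logRatio_bounds {n a : ℕ} (S : Scale n a) (L : Large n a) {z : ℝ} (hz : z ∈ Set.Icc (4 : ℝ) 6) :
    a / 2 * Real.log 2 - 2.5 ≤ logRatio n a z ∧ logRatio n a z ≤ a / 2 * Real.log 2 := by
  obtain ⟨hz4, hz6⟩ := hz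
  have ha : (1000000 : ℝ) ≤ a := by exact_mod_cast L.le_a
  have hn : (0 : ℝ) < n := lt_of_lt_of_le (by positivity) L.le_n
  set X : ℝ := a * 2 ^ (a - 1) / n / z with hX
  have hX0 : 0 < X := by positivity
  have e1 : X ^ 2 * (4 * n ^ 2 * z ^ 2) = a ^ 2 * 2 ^ a * 2 ^ a := by
    have : (2 : ℝ) ^ a = 2 * 2 ^ (a - 1) := by
      rw [← pow_succ']; congr 1; have := L.le_a; omega
    rw [hX, this]
    field_simp
    ring
  have e2 : 2 * Real.log X = Real.log (X ^ 2) := by rw [Real.log_pow]; norm_num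
  have s1 := S.sq_le
  have s2 := S.le_sq
  have hp : (0 : ℝ) < 2 ^ a := by positivity
  have b1 : 2 ^ a / 144 ≤ X ^ 2 := by
    rw [div_le_iff₀ (by norm_num)]
    have : z ^ 2 ≤ 36 := by nlinarith
    have h3 : (n : ℝ) ^ 2 * 2 ^ a ≤ n ^ 2 * (X ^ 2 * 144) := by
      calc (n : ℝ) ^ 2 * 2 ^ a ≤ a ^ 2 * 2 ^ a * 2 ^ a := by gcongr
        _ = X ^ 2 * (4 * n ^ 2 * z ^ 2) := e1.symm
        _ ≤ X ^ 2 * (4 * n ^ 2 * 36) := by gcongr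
        _ = _ := by ring
    exact le_of_mul_le_mul_left h3 (by positivity)
  have b2 : X ^ 2 ≤ 2 ^ a := by
    have : 16 ≤ z ^ 2 := by nlinarith
    have h3 : (64 * (n : ℝ) ^ 2) * X ^ 2 ≤ (64 * n ^ 2) * 2 ^ a := by
      calc (64 * (n : ℝ) ^ 2) * X ^ 2 = X ^ 2 * (4 * n ^ 2 * 16) := by ring
        _ ≤ X ^ 2 * (4 * n ^ 2 * z ^ 2) := by gcongr
        _ = _ := e1
        _ ≤ 25 * n ^ 2 * 2 ^ a := by gcongr
        _ ≤ _ := by gcongr; norm_num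
    exact le_of_mul_le_mul_left h3 (by positivity)
  have c1 := Real.log_le_log (by positivity) b1
  have c2 := Real.log_le_log (by positivity) b2
  rw [← e2] at c1 c2
  rw [Real.log_div (by positivity) (by norm_num), Real.log_pow] at c1
  rw [Real.log_pow] at c2
  have c3 : Real.log 144 ≤ 5 := by
    rw [Real.log_le_iff_le_exp (by norm_num), show (5 : ℝ) = (5 : ℕ) * 1 by norm_num, Real.exp_nat_mul]
    have : (2.718 : ℝ) ^ 5 ≤ Real.exp 1 ^ 5 := by
      gcongr; linarith [Real.exp_one_gt_d9]
    refine le_trans ?_ this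
    norm_num
  change _ ≤ Real.log X ∧ Real.log X ≤ _
  constructor <;> linarith

/-- The number of colour classes of a balanced colouring. -/
noncomputable def classCount (n a J : ℕ) (z : ℝ) : ℝ := (n - n / (a : ℝ) ^ 5) / (a - wtMean z J)

/-- The logarithm of the ratio between the number of colour classes and the expected number of
independent sets. -/
noncomputable def logExcess (n a J : ℕ) (z : ℝ) : ℝ :=
  Real.log (classCount n a J z / (expSets n a * wtSum z J))

theorem classCount_bounds {n a J : ℕ} (L : Large n a) {z : ℝ} (hz : z ∈ Set.Icc (4 : ℝ) 6)
    (hJ : 8 ≤ J) : 0.99 * n ≤ a * classCount n a J z ∧ a * classCount n a J z ≤ 1.01 * n := by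
  have ha : (1000000 : ℝ) ≤ a := by exact_mod_cast L.le_a
  have hn : (0 : ℝ) < n := lt_of_lt_of_le (by positivity) L.le_n
  have m1 := one_le_wtMean hz.1 (show 2 ≤ J by omega)
  have m2 := wtMean_le hz.1 hz.2 (show 2 ≤ J by omega)
  have hf : 0 < (a : ℝ) - wtMean z J := by linarith
  have h5 : (n : ℝ) / a ^ 5 ≤ 0.001 * n := by
    rw [div_le_iff₀ (by positivity)]
    have : (a : ℝ) ≤ a ^ 5 := le_self_pow₀ (by linarith) (by norm_num)
    nlinarith
  have h5' : 0 ≤ (n : ℝ) / a ^ 5 := by positivity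
  unfold classCount
  rw [← mul_div_assoc]
  constructor
  · rw [le_div_iff₀ hf]; nlinarith
  · rw [div_le_iff₀ hf]; nlinarith

theorem logExcess_bounds {n a J : ℕ} (S : Scale n a) (L : Large n a) {z : ℝ}
    (hz : z ∈ Set.Icc (4 : ℝ) 6) (hJ : 8 ≤ J) :
    Real.log a ≤ logExcess n a J z ∧ logExcess n a J z ≤ Real.log a + 6 := by
  have ha : (1000000 : ℝ) ≤ a := by exact_mod_cast L.le_a
  have hn : (0 : ℝ) < n := lt_of_lt_of_le (by positivity) L.le_n
  obtain ⟨k1, k2⟩ := classCount_bounds L hz hJ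
  have w1 := twelve_le_wtSum hz.1 (show 2 ≤ J by omega)
  have w2 := wtSum_le (by linarith [hz.1]) hz.2 J
  set k := classCount n a J z
  set W := wtSum z J
  have g := gw_pos a
  have hm : 0 < expSets n a := by unfold expSets; positivity
  have m1 : 2000 * (a : ℝ) ^ 2 * expSets n a ≤ n := by
    unfold expSets; rw [← mul_div_assoc, div_le_iff₀ g]; exact S.le_gw
  have m2 : (n : ℝ) ≤ 4000 * (a : ℝ) ^ 2 * expSets n a := by
    unfold expSets; rw [← mul_div_assoc, le_div_iff₀ g]; exact S.gw_le
  have hk : 0 < k := by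
    by_contra hc
    nlinarith
  unfold logExcess
  have hW : 0 < expSets n a * W := by positivity
  constructor
  · refine Real.log_le_log (by linarith) ?_
    rw [le_div_iff₀ hW]
    refine le_of_mul_le_mul_left (a := (a : ℝ)) ?_ (by linarith)
    have : (a : ℝ) ^ 2 * expSets n a * W ≤ a ^ 2 * expSets n a * 1024 := by gcongr
    nlinarith
  · rw [Real.log_le_iff_le_exp (by positivity), Real.exp_add, Real.exp_log (by linarith), div_le_iff₀ hW]
    have e6 : 360 ≤ Real.exp 6 := by
      rw [show (6 : ℝ) = (6 : ℕ) * 1 by norm_num, Real.exp_nat_mul]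
      have : (2.71 : ℝ) ^ 6 ≤ Real.exp 1 ^ 6 := by
        gcongr; linarith [Real.exp_one_gt_d9]
      refine le_trans ?_ this
      norm_num
    refine le_of_mul_le_mul_left (a := (a : ℝ)) ?_ (by linarith)
    have h3 : (a : ℝ) ^ 2 * expSets n a * (360 * 12) ≤ a ^ 2 * expSets n a * (Real.exp 6 * W) := by gcongr
    nlinarith

/-- The parameters of a balanced colouring of a random graph. -/
structure Balanced (n a J : ℕ) (z : ℝ) : Prop where
  scale : Scale n a
  large : Large n a
  J_eq : J = a / 1000
  z_mem : z ∈ Set.Icc (4 : ℝ) 6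
  balance : wtMean z J * logRatio n a z - logExcess n a J z + 1 - (a - wtMean z J) = 60 / a

theorem exists_balanced {n a : ℕ} (S : Scale n a) (L : Large n a) : ∃ z, Balanced n a (a / 1000) z := by
  set J := a / 1000 with hJ
  have hJ8 : 8 ≤ J := by have := L.le_a; omega
  have ha : (1000000 : ℝ) ≤ a := by exact_mod_cast L.le_a
  have hn : (0 : ℝ) < n := lt_of_lt_of_le (by positivity) L.le_n
  have hlog := L.log_le
  let h : ℝ → ℝ := fun z => wtMean z J * logRatio n a z - logExcess n a J z + 1 - (a - wtMean z J)
  have hk : ∀ z ∈ Set.Icc (4 : ℝ) 6, 0 < classCount n a J z := by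
    intro z hz
    have := (classCount_bounds L hz hJ8).1
    by_contra hc
    nlinarith
  have hm : 0 < expSets n a := by unfold expSets; have := gw_pos a; positivity
  have hcM : ContinuousOn (fun z => wtMean z J) (Set.Icc 4 6) := continuousOn_wtMean (by omega)
  have hcW : ContinuousOn (fun z => wtSum z J) (Set.Icc 4 6) := by
    refine Continuous.continuousOn ?_
    unfold wtSum
    exact continuous_finsetSum _ fun i _ => continuous_wt _
  have hcy : ContinuousOn (fun z => logRatio n a z) (Set.Icc 4 6) := by
    unfold logRatio
    refine ContinuousOn.log (ContinuousOn.div continuousOn_const continuousOn_id ?_) ?_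
    · intro z hz; have := hz.1; linarith
    · intro z hz; have : (0 : ℝ) < z := by have := hz.1; linarith
      positivity
  have hck : ContinuousOn (fun z => classCount n a J z) (Set.Icc 4 6) := by
    unfold classCount
    refine ContinuousOn.div continuousOn_const (continuousOn_const.sub hcM) ?_
    intro z hz
    have := wtMean_le hz.1 hz.2 (show 2 ≤ J by omega)
    linarith
  have hcR : ContinuousOn (fun z => logExcess n a J z) (Set.Icc 4 6) := by
    unfold logExcess
    have hW : ∀ z ∈ Set.Icc (4 : ℝ) 6, expSets n a * wtSum z J ≠ 0 := by
      intro z hz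
      have := twelve_le_wtSum hz.1 (show 2 ≤ J by omega)
      positivity
    refine ContinuousOn.log (ContinuousOn.div hck (continuousOn_const.mul hcW) hW) ?_
    intro z hz
    exact div_ne_zero (hk z hz).ne' (hW z hz)
  have hc : ContinuousOn h (Set.Icc 4 6) :=
    (((hcM.mul hcy).sub hcR).add continuousOn_const).sub (continuousOn_const.sub hcM)
  have z4 : (4 : ℝ) ∈ Set.Icc (4 : ℝ) 6 := by norm_num
  have z6 : (6 : ℝ) ∈ Set.Icc (4 : ℝ) 6 := by norm_num
  have l1 := Real.log_two_gt_d9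
  have l2 := Real.log_two_lt_d9
  have hla : 0 ≤ Real.log a := Real.log_nonneg (by linarith)
  have h60 : (60 : ℝ) / a ≤ 1 := by rw [div_le_iff₀ (by linarith)]; linarith
  have h60' : 0 ≤ (60 : ℝ) / a := by positivity
  have h4 : h 4 ≤ 60 / a := by
    have y := (logRatio_bounds S L z4).2
    have y' := (logRatio_bounds S L z4).1
    have R := (logExcess_bounds S L z4 hJ8).1
    have M := wtMean_four_le hJ8
    change wtMean 4 J * logRatio n a 4 - logExcess n a J 4 + 1 - (a - wtMean 4 J) ≤ 60 / a
    have : wtMean 4 J * logRatio n a 4 ≤ 2.7 * logRatio n a 4 := by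
      gcongr
      nlinarith
    nlinarith
  have h6 : 60 / a ≤ h 6 := by
    have y := (logRatio_bounds S L z6).1
    have R := (logExcess_bounds S L z6 hJ8).2
    have M := three_le_wtMean_six (show 5 ≤ J by omega)
    change 60 / a ≤ wtMean 6 J * logRatio n a 6 - logExcess n a J 6 + 1 - (a - wtMean 6 J)
    have : 3 * logRatio n a 6 ≤ wtMean 6 J * logRatio n a 6 := by
      gcongr
      nlinarith
    nlinarith
  obtain ⟨z, hz, hz'⟩ := intermediate_value_Icc (by norm_num) hc ⟨h4, h6⟩
  exact ⟨z, S, L, rfl, hz, hz'⟩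

/-- The expected number of colour classes of size `a - j` in a balanced colouring. -/
noncomputable def sizeCount (n a J : ℕ) (z : ℝ) (j : ℕ) : ℝ :=
  classCount n a J z * wt z j / wtSum z J

namespace Balanced

variable {n a J : ℕ} {z : ℝ}

theorem le_a (H : Balanced n a J z) : (1000000 : ℝ) ≤ a := by exact_mod_cast H.large.le_a

theorem pow_le_n (H : Balanced n a J z) : (a : ℝ) ^ 40 ≤ n := H.large.le_n

theorem n_pos (H : Balanced n a J z) : (0 : ℝ) < n :=
  lt_of_lt_of_le (by have := H.le_a; positivity) H.large.le_n

theorem le_J (H : Balanced n a J z) : 8 ≤ J := by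
  have := H.large.le_a; have := H.J_eq; omega

theorem wtSum_pos (H : Balanced n a J z) : 0 < wtSum z J := by
  have := twelve_le_wtSum H.z_mem.1 (show 2 ≤ J by have := H.le_J; omega)
  linarith

theorem expSets_pos (H : Balanced n a J z) : 0 < expSets n a := by
  have := gw_pos a
  have := H.n_pos
  unfold expSets; positivity

theorem classCount_ge (H : Balanced n a J z) : 0.99 * n ≤ a * classCount n a J z :=
  (classCount_bounds H.large H.z_mem H.le_J).1

theorem classCount_le (H : Balanced n a J z) : a * classCount n a J z ≤ 1.01 * n :=
  (classCount_bounds H.large H.z_mem H.le_J).2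

theorem classCount_pos (H : Balanced n a J z) : 0 < classCount n a J z := by
  have := H.classCount_ge
  have := H.n_pos
  have := H.le_a
  by_contra hc
  nlinarith

theorem classCount_mul (H : Balanced n a J z) :
    classCount n a J z * (a - wtMean z J) = n - n / (a : ℝ) ^ 5 := by
  have := wtMean_le H.z_mem.1 H.z_mem.2 (show 2 ≤ J by have := H.le_J; omega)
  have := H.le_a
  unfold classCount
  rw [div_mul_cancel₀]
  linarith

theorem exp_logExcess (H : Balanced n a J z) :
    Real.exp (logExcess n a J z) * (expSets n a * wtSum z J) = classCount n a J z := by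
  have h1 := H.classCount_pos
  have h2 := H.expSets_pos
  have h3 := H.wtSum_pos
  rw [logExcess, Real.exp_log (by positivity)]
  field_simp

theorem sum_sizeCount_mul (_ : Balanced n a J z) (g : ℕ → ℝ) :
    ∑ t : Fin J, sizeCount n a J z (t + 1) * g (t + 1) =
      classCount n a J z * ((∑ i ∈ Finset.range J, wt z (i + 1) * g (i + 1)) / wtSum z J) := by
  rw [Fin.sum_univ_eq_sum_range (fun i => sizeCount n a J z (i + 1) * g (i + 1)), Finset.sum_div,
    Finset.mul_sum]
  exact Finset.sum_congr rfl fun i _ => by unfold sizeCount; ring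

theorem sum_sizeCount (H : Balanced n a J z) :
    ∑ t : Fin J, sizeCount n a J z (t + 1) = classCount n a J z := by
  have h := H.sum_sizeCount_mul fun _ => 1
  simp only [mul_one] at h
  rw [h, ← wtSum, div_self H.wtSum_pos.ne', mul_one]

theorem sum_sizeCount_mul_self (H : Balanced n a J z) :
    ∑ t : Fin J, sizeCount n a J z (t + 1) * ((t + 1 : ℕ) : ℝ) =
      classCount n a J z * wtMean z J :=
  H.sum_sizeCount_mul fun j => (j : ℝ)

theorem sum_sizeCount_mul_sub (H : Balanced n a J z) :
    ∑ t : Fin J, sizeCount n a J z (t + 1) * ((a : ℝ) - (t + 1 : ℕ)) = n - n / (a : ℝ) ^ 5 := by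
  rw [← H.classCount_mul, mul_sub, ← H.sum_sizeCount_mul_self, ← H.sum_sizeCount, Finset.sum_mul,
    ← Finset.sum_sub_distrib]
  exact Finset.sum_congr rfl fun t _ => by ring

theorem sum_sizeCount_mul_sq_le (H : Balanced n a J z) :
    ∑ t : Fin J, sizeCount n a J z (t + 1) * ((t + 1 : ℕ) : ℝ) ^ 2 ≤
      classCount n a J z * 26 := by
  rw [H.sum_sizeCount_mul fun j => (j : ℝ) ^ 2]
  have := H.classCount_pos
  gcongr
  rw [div_le_iff₀ H.wtSum_pos]
  exact sum_sq_wt_le H.z_mem.1 H.z_mem.2 (by have := H.le_J; omega)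

theorem sizeCount_nonneg (H : Balanced n a J z) (j : ℕ) : 0 ≤ sizeCount n a J z j := by
  have := H.classCount_pos
  have := H.wtSum_pos
  have := wt_pos (show 0 < z by linarith [H.z_mem.1]) j
  unfold sizeCount; positivity

theorem profile (H : Balanced n a J z) :
    Profile n a J (fun t => ⌊sizeCount n a J z (t + 1)⌋₊) (fun t => sizeCount n a J z (t + 1))
      (logRatio n a z) (logExcess n a J z) := by
  have ha := H.le_a
  have hn := H.n_pos
  have hJ := H.le_J
  have hK := H.classCount_pos
  have hK1 := H.classCount_ge
  have hK2 := H.classCount_le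
  have hz : 0 < z := by linarith [H.z_mem.1]
  obtain ⟨y1, y2⟩ := logRatio_bounds H.scale H.large H.z_mem
  obtain ⟨R1, R2⟩ := logExcess_bounds H.scale H.large H.z_mem hJ
  have hlog := H.large.log_le
  have hlog1 : 1 ≤ Real.log a := by
    rw [Real.le_log_iff_exp_le (by linarith)]
    linarith [Real.exp_one_lt_d9]
  have l1 := Real.log_two_gt_d9
  have hJa : 1000 * J ≤ a := by have := H.J_eq; omega
  have hbal := H.balance
  have hmul := H.classCount_mul
  have hn' : 1000000 * (a : ℝ) ^ 2 ≤ n := by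
    refine le_trans ?_ (le_trans (pow_le_pow_right₀ (by linarith) (by norm_num : 3 ≤ 40)) H.pow_le_n)
    nlinarith [sq_nonneg (a : ℝ)]
  refine ⟨by have := H.large.le_a; omega, by exact_mod_cast hn, hJa, ?_, ?_, ?_, ?_, ?_, ?_, ?_, ?_,
    y2, by linarith, by nlinarith⟩
  · exact fun t => Nat.floor_le (H.sizeCount_nonneg _)
  · exact fun t => (Nat.lt_floor_add_one _).le
  · intro t
    have hj : (t : ℕ) + 1 ≤ a := by have := t.2; omega
    have hj2 : 2 * ((t : ℕ) + 1) ≤ a := by have := t.2; omega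
    have g := gw_pos (a - ((t : ℕ) + 1))
    have e := pow_div_gw_sub (n := n) (z := z) (by exact_mod_cast hn) (by have := H.large.le_a; omega) hz hj
    have e2 := exp_le_descFactorial_div_pow (a := a) (by have := H.large.le_a; omega) hj2
    rw [← le_div_iff₀ g, div_eq_mul_inv, mul_right_comm, ← div_eq_mul_inv, e]
    have hw := wt_pos hz ((t : ℕ) + 1)
    have hm := H.expSets_pos
    have e3 : sizeCount n a J z (t + 1) =
        expSets n a * (Real.exp (logExcess n a J z) * wt z (t + 1)) := by
      unfold sizeCount
      rw [← H.exp_logExcess]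
      have := H.wtSum_pos
      field_simp
    rw [e3]
    calc expSets n a * (Real.exp (logExcess n a J z) * wt z (t + 1))
        = expSets n a * Real.exp (-(2 * ((t + 1 : ℕ) : ℝ) ^ 2 / a)) *
          (Real.exp (logRatio n a z * ((t + 1 : ℕ) : ℝ)) * wt z (t + 1)) *
          Real.exp (logExcess n a J z - logRatio n a z * ((t + 1 : ℕ) : ℝ) +
            2 * ((t + 1 : ℕ) : ℝ) ^ 2 / a) := by
          have : Real.exp (logExcess n a J z) = Real.exp (-(2 * ((t + 1 : ℕ) : ℝ) ^ 2 / a)) *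
              (Real.exp (logRatio n a z * ((t + 1 : ℕ) : ℝ)) *
              Real.exp (logExcess n a J z - logRatio n a z * ((t + 1 : ℕ) : ℝ) +
                2 * ((t + 1 : ℕ) : ℝ) ^ 2 / a)) := by
            rw [← Real.exp_add, ← Real.exp_add]; congr 1; ring
          rw [this]; ring
      _ ≤ _ := by gcongr
  · have s0 := H.sum_sizeCount
    have s1 := H.sum_sizeCount_mul_self
    have s2 := H.sum_sizeCount_mul_sq_le
    have e : ∑ t : Fin J, sizeCount n a J z (t + 1) *
        (logExcess n a J z - 1 - logRatio n a z * (t + 1 : ℕ) + 2 * (t + 1 : ℕ) ^ 2 / a) =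
        classCount n a J z * (logExcess n a J z - 1) -
        classCount n a J z * wtMean z J * logRatio n a z +
        (∑ t : Fin J, sizeCount n a J z (t + 1) * ((t + 1 : ℕ) : ℝ) ^ 2) * (2 / a) := by
      rw [← s1, ← s0, Finset.sum_mul, Finset.sum_mul, Finset.sum_mul, ← Finset.sum_sub_distrib,
        ← Finset.sum_add_distrib]
      exact Finset.sum_congr rfl fun t _ => by ring
    rw [e]
    have h1 : (∑ t : Fin J, sizeCount n a J z (t + 1) * ((t + 1 : ℕ) : ℝ) ^ 2) * (2 / a) ≤
        classCount n a J z * 26 * (2 / a) := by gcongr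
    have h2 : (n : ℝ) / a ^ 5 ≤ classCount n a J z * (8 / a) := by
      rw [← mul_div_assoc, div_le_div_iff₀ (by positivity) (by linarith)]
      have : (a : ℝ) * (n * a) ≤ a * (classCount n a J z * 8 * a ^ 5) := by
        calc (a : ℝ) * (n * a) ≤ a ^ 2 * ((a * classCount n a J z) * 8) := by nlinarith
          _ ≤ a ^ 5 * ((a * classCount n a J z) * 8) := by
            have : (a : ℝ) ^ 2 ≤ a ^ 5 := pow_le_pow_right₀ (by linarith) (by norm_num)
            gcongr
          _ = _ := by ring
      exact le_of_mul_le_mul_left this (by linarith)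
    have h3 : logExcess n a J z - 1 - wtMean z J * logRatio n a z = -(60 / a) - (a - wtMean z J) := by
      linarith
    have h4 : classCount n a J z * (logExcess n a J z - 1) -
        classCount n a J z * wtMean z J * logRatio n a z =
        -(classCount n a J z * (60 / a)) - (n - n / (a : ℝ) ^ 5) := by
      rw [← hmul]
      linear_combination classCount n a J z * h3
    have h5 : classCount n a J z * 26 * (2 / a) - classCount n a J z * (60 / a) =
      - (classCount n a J z * (8 / a)) := by ring
    linarith
  · rw [H.sum_sizeCount_mul_sub]
    have : 0 ≤ (n : ℝ) / a ^ 5 := by positivity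
    linarith
  · rw [H.sum_sizeCount]; linarith
  · rw [H.sum_sizeCount, H.sum_sizeCount_mul fun j => (2 : ℝ) ^ j]
    rw [mul_comm 13]
    gcongr
    rw [div_le_iff₀ H.wtSum_pos]
    exact sum_two_pow_wt_le H.z_mem.1 H.z_mem.2 (by omega)
  · rw [H.sum_sizeCount]
    have : (1000 * J : ℝ) ≤ a := by exact_mod_cast hJa
    refine this.trans (le_of_mul_le_mul_left (a := (a : ℝ)) ?_ (by linarith))
    nlinarith

theorem exp_neg_mul_le (H : Balanced n a J z) : Real.exp (-(a / 100)) * (1000 * (a : ℝ) ^ 12) ≤ 1 := by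
  have ha := H.le_a
  have hlog := H.large.log_le
  have e1 : (1000 : ℝ) ≤ Real.exp 7 := by
    rw [show (7 : ℝ) = (7 : ℕ) * 1 by norm_num, Real.exp_nat_mul]
    have : (2.71 : ℝ) ^ 7 ≤ Real.exp 1 ^ 7 := by
      gcongr; linarith [Real.exp_one_gt_d9]
    refine le_trans ?_ this
    norm_num
  have e2 : (a : ℝ) ^ 12 = Real.exp ((12 : ℕ) * Real.log a) := by
    rw [Real.exp_nat_mul, Real.exp_log (by linarith)]
  calc _ ≤ Real.exp (-(a / 100)) * (Real.exp 7 * Real.exp ((12 : ℕ) * Real.log a)) := by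
        rw [e2]; gcongr
    _ = Real.exp (-(a / 100) + (7 + (12 : ℕ) * Real.log a)) := by rw [Real.exp_add, Real.exp_add]
    _ ≤ 1 := by
      rw [Real.exp_le_one_iff]
      push_cast
      linarith

theorem log_n_le (H : Balanced n a J z) : Real.log n ≤ Real.log a + a / 2 * Real.log 2 := by
  have ha := H.le_a
  have hn := H.n_pos
  have h := Real.log_le_log (by positivity) H.scale.sq_le
  rw [Real.log_mul (by positivity) (by positivity), Real.log_pow, Real.log_pow, Real.log_pow] at h
  push_cast at h
  linarith

theorem le_log_n (H : Balanced n a J z) : Real.log a + a / 2 * Real.log 2 - 2 ≤ Real.log n := by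
  have ha := H.le_a
  have hn := H.n_pos
  have h := Real.log_le_log (by positivity) H.scale.le_sq
  rw [Real.log_mul (by positivity) (by positivity), Real.log_mul (by positivity) (by positivity),
    Real.log_pow, Real.log_pow, Real.log_pow] at h
  have h25 : Real.log 25 ≤ 4 := by
    rw [Real.log_le_iff_le_exp (by norm_num), show (4 : ℝ) = (4 : ℕ) * 1 by norm_num, Real.exp_nat_mul]
    have : (2.7 : ℝ) ^ 4 ≤ Real.exp 1 ^ 4 := by
      gcongr; linarith [Real.exp_one_gt_d9]
    refine le_trans ?_ this
    norm_num
  push_cast at h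
  linarith

theorem one_add_log_n_le (H : Balanced n a J z) : 1 + Real.log n ≤ a := by
  have := H.log_n_le
  have := H.large.log_le
  have := H.le_a
  have := Real.log_two_lt_d9
  nlinarith

theorem exp_neg_mul_sq_le (H : Balanced n a J z) {h : ℕ} (hh : a ≤ 2 * h + 1) :
    ((a : ℝ) * n) ^ 2 ≤ (Real.exp (-(a / 25))) ^ 2 * 2 ^ (a - J + h) := by
  have ha := H.le_a
  have hn := H.n_pos
  have hJ : 1000 * (J : ℝ) ≤ a := by
    exact_mod_cast (by have := H.J_eq; omega : 1000 * J ≤ a)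
  have hh' : (a : ℝ) ≤ 2 * h + 1 := by exact_mod_cast hh
  have hJa : J ≤ a := by have := H.J_eq; omega
  have l1 := Real.log_two_gt_d9
  have l2 := Real.log_two_lt_d9
  rw [← Real.log_le_log_iff (by positivity) (by positivity), Real.log_mul (by positivity) (by positivity),
    Real.log_pow, Real.log_pow, Real.log_pow, Real.log_exp, Real.log_mul (by positivity) (by positivity)]
  have hl := H.log_n_le
  have := H.large.log_le
  push_cast [Nat.cast_sub hJa]
  have : ((a : ℝ) * 1.499 - 0.5) * Real.log 2 ≤ (a - J + h) * Real.log 2 := by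
    gcongr; linarith
  nlinarith

theorem cast_size (H : Balanced n a J z) : 
    ((∑ t : Fin J, ⌊sizeCount n a J z (t + 1)⌋₊ * (a - (t + 1)) : ℕ) : ℝ) ≤ n - n / (a : ℝ) ^ 5 ∧
    n - n / (a : ℝ) ^ 5 - a ^ 2 ≤
      ((∑ t : Fin J, ⌊sizeCount n a J z (t + 1)⌋₊ * (a - (t + 1)) : ℕ) : ℝ) := by
  have hJa : 1000 * J ≤ a := by have := H.J_eq; omega
  have e : ((∑ t : Fin J, ⌊sizeCount n a J z (t + 1)⌋₊ * (a - (t + 1)) : ℕ) : ℝ) =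
      ∑ t : Fin J, (⌊sizeCount n a J z (t + 1)⌋₊ : ℝ) * ((a : ℝ) - (t + 1 : ℕ)) := by
    push_cast
    refine Finset.sum_congr rfl fun t _ => ?_
    rw [Nat.cast_sub (by have := t.2; omega)]
    push_cast; ring
  rw [e, ← H.sum_sizeCount_mul_sub]
  have h0 : ∀ t : Fin J, 0 ≤ (a : ℝ) - (t + 1 : ℕ) := by
    intro t
    have : ((t + 1 : ℕ) : ℝ) ≤ a := by exact_mod_cast (by have := t.2; omega : (t : ℕ) + 1 ≤ a)
    linarith
  constructor
  · refine Finset.sum_le_sum fun t _ => mul_le_mul_of_nonneg_right ?_ (h0 t)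
    exact Nat.floor_le (H.sizeCount_nonneg _)
  · have h1 : (∑ t : Fin J, (a : ℝ)) ≤ a ^ 2 := by
      rw [Finset.sum_const, Finset.card_univ, Fintype.card_fin, nsmul_eq_mul, sq]
      gcongr
      omega
    have h2 : ∑ t : Fin J, sizeCount n a J z (t + 1) * ((a : ℝ) - (t + 1 : ℕ)) - ∑ t : Fin J, (a : ℝ) ≤
        ∑ t : Fin J, (⌊sizeCount n a J z (t + 1)⌋₊ : ℝ) * ((a : ℝ) - (t + 1 : ℕ)) := by
      rw [← Finset.sum_sub_distrib]
      refine Finset.sum_le_sum fun t _ => ?_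
      have h3 := (Nat.lt_floor_add_one (sizeCount n a J z (t + 1))).le
      have h4 := mul_le_mul_of_nonneg_right h3 (h0 t)
      have : (0 : ℝ) ≤ (t + 1 : ℕ) := Nat.cast_nonneg _
      linarith
    linarith

theorem secondMoment_le (H : Balanced n a J z) {N s : ℕ} (hN : 0 < N) (hna : (n : ℝ) ≤ N * a ^ 5)
    (hsn : (s : ℝ) ≤ n) :
    (1 + 4 * ((a : ℝ) ^ 2 / N) ^ 2) ^ (s ^ 2) *
        (Real.exp (2 * √((s : ℕ) * ((s : ℕ) * J * (a * Real.exp (-((a : ℝ) / 100)) ^ 2)))) *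
          (2 * (Real.exp 1 * n) ^ (J + 1) * (1 + Real.exp (-((a : ℝ) / 100))) ^ (2 * s) *
            (1 + a * Real.exp (-((a : ℝ) / 100)) ^ 2) ^ s)) ≤
      Real.exp (n / (a : ℝ) ^ 10) := by
  have ha := H.le_a
  have hn := H.n_pos
  have hN0' : (0 : ℝ) < N := by exact_mod_cast hN
  have hE1 := H.exp_neg_mul_le
  set E := Real.exp (-((a : ℝ) / 100)) with hE
  have hE0 : 0 < E := Real.exp_pos _
  have hJa' : 1000 * (J : ℝ) ≤ a := by
    exact_mod_cast (by have := H.J_eq; omega : 1000 * J ≤ a)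
  have hpow : ∀ i : ℕ, i ≤ 40 → (a : ℝ) ^ i ≤ n := fun i hi =>
    le_trans (pow_le_pow_right₀ (by linarith) hi) H.pow_le_n
  have hu : ((a : ℝ) ^ 2 / N) ^ 2 * n ^ 2 ≤ a ^ 14 := by
    rw [div_pow, div_mul_eq_mul_div, div_le_iff₀ (by positivity)]
    calc _ ≤ ((a : ℝ) ^ 2) ^ 2 * (N * a ^ 5) ^ 2 := by gcongr
      _ = _ := by ring
  set X := (n : ℝ) / a ^ 10 with hX
  have hX0 : 0 < X := by positivity
  have hXa : ∀ i : ℕ, i ≤ 29 → 1000000 * (a : ℝ) ^ i ≤ X := by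
    intro i hi
    rw [hX, le_div_iff₀ (by positivity)]
    calc 1000000 * (a : ℝ) ^ i * (a : ℝ) ^ 10 ≤ (a : ℝ) * (a : ℝ) ^ i * (a : ℝ) ^ 10 := by gcongr
      _ = (a : ℝ) ^ (1 + i + 10) := by ring
      _ ≤ _ := hpow _ (by omega)
  have hEX : n * (a * E) ≤ X / 100 := by
    have : n * (a * E) * a ^ 10 * 1000 ≤ n := by
      calc n * (a * E) * a ^ 10 * 1000 = n * (E * (1000 * a ^ 11)) := by ring
        _ ≤ n * (E * (1000 * a ^ 12)) := by
          have : (a : ℝ) ^ 11 ≤ a ^ 12 := pow_le_pow_right₀ (by linarith) (by norm_num)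
          gcongr
        _ ≤ n * 1 := by gcongr
        _ = n := mul_one _
    rw [hX, div_div, le_div_iff₀ (by positivity)]
    have : 0 ≤ n * (a * E) * a ^ 10 := by positivity
    linarith
  have hE1' : E ≤ 1 := Real.exp_le_one_iff.2 (by linarith)
  have hsE : s * (a * E) ≤ X / 100 := le_trans (by gcongr) hEX
  have hone : ∀ (u : ℝ) (j : ℕ), 0 ≤ u → (1 + u) ^ j ≤ Real.exp (j * u) := by
    intro u j hu
    rw [Real.exp_nat_mul]
    gcongr
    linarith [Real.add_one_le_exp u]
  have f1 : (1 + 4 * ((a : ℝ) ^ 2 / N) ^ 2) ^ (s ^ 2) ≤ Real.exp (X / 10) := by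
    refine (hone _ _ (by positivity)).trans (Real.exp_le_exp.2 ?_)
    push_cast
    calc (s : ℝ) ^ 2 * (4 * ((a : ℝ) ^ 2 / N) ^ 2) = 4 * (((a : ℝ) ^ 2 / N) ^ 2 * s ^ 2) := by ring
      _ ≤ 4 * (((a : ℝ) ^ 2 / N) ^ 2 * n ^ 2) := by gcongr
      _ ≤ 4 * a ^ 14 := by gcongr
      _ ≤ X / 10 := by have := hXa 14 (by norm_num); linarith [pow_pos (show (0:ℝ) < a by linarith) 14]
  have f2 : Real.exp (2 * √((s : ℕ) * ((s : ℕ) * J * (a * E ^ 2)))) ≤ Real.exp (X / 10) := by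
    rw [Real.exp_le_exp]
    have : √((s : ℝ) * (s * J * (a * E ^ 2))) ≤ s * (a * E) := by
      refine Real.sqrt_le_iff.2 ⟨by positivity, ?_⟩
      calc (s : ℝ) * (s * J * (a * E ^ 2)) = (s ^ 2 * a * E ^ 2) * J := by ring
        _ ≤ (s ^ 2 * a * E ^ 2) * a := by gcongr; have := H.J_eq; omega
        _ = _ := by ring
    linarith
  have f3 : (2 : ℝ) ≤ Real.exp (X / 10) := by
    have := hXa 0 (by norm_num)
    have := Real.add_one_le_exp (X / 10)
    linarith
  have f4 : (Real.exp 1 * n) ^ (J + 1) ≤ Real.exp (X / 10) := by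
    have e : Real.exp 1 * n = Real.exp (1 + Real.log n) := by rw [Real.exp_add, Real.exp_log hn]
    rw [e, ← Real.exp_nat_mul, Real.exp_le_exp]
    have h1 := H.one_add_log_n_le
    have h2 : ((J + 1 : ℕ) : ℝ) ≤ a := by push_cast; linarith
    have h3 := hXa 2 (by norm_num)
    calc ((J + 1 : ℕ) : ℝ) * (1 + Real.log n) ≤ ((J + 1 : ℕ) : ℝ) * a := by gcongr
      _ ≤ a * a := by gcongr
      _ ≤ _ := by nlinarith
  have f5 : (1 + E) ^ (2 * s) ≤ Real.exp (X / 10) := by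
    refine (hone _ _ hE0.le).trans (Real.exp_le_exp.2 ?_)
    push_cast
    have : (s : ℝ) * (1 * E) ≤ s * (a * E) := by gcongr; linarith
    linarith
  have f6 : (1 + a * E ^ 2) ^ s ≤ Real.exp (X / 10) := by
    refine (hone _ _ (by positivity)).trans (Real.exp_le_exp.2 ?_)
    have : (s : ℝ) * (a * E ^ 2) ≤ s * (a * E) := by gcongr; nlinarith
    linarith
  calc _ ≤ Real.exp (X / 10) * (Real.exp (X / 10) *
        (Real.exp (X / 10) * Real.exp (X / 10) * Real.exp (X / 10) * Real.exp (X / 10))) := by gcongr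
    _ = Real.exp (6 * (X / 10)) := by
      rw [show 6 * (X / 10) = X / 10 + (X / 10 + (X / 10 + X / 10 + X / 10 + X / 10)) by ring]
      simp only [Real.exp_add]
    _ ≤ _ := Real.exp_le_exp.2 (by linarith)

theorem exp_neg_le_frac (H : Balanced n a J z) : ∃ T : ℕ,
    (T : ℝ) ≤ classCount n a J z + n / (a : ℝ) ^ 5 + a ^ 2 ∧
    Real.exp (-(n / (a : ℝ) ^ 10)) ≤ frac (fun G : SimpleGraph (Fin n) => G.Colorable T) := by
  have ha := H.le_a
  have hn := H.n_pos
  have hP := H.profile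
  obtain ⟨s1, s2⟩ := H.cast_size
  set k : Fin J → ℕ := fun t => ⌊sizeCount n a J z (t + 1)⌋₊ with hk
  change ((∑ t : Fin J, k t * (a - (t + 1)) : ℕ) : ℝ) ≤ _ at s1
  change _ ≤ ((∑ t : Fin J, k t * (a - (t + 1)) : ℕ) : ℝ) at s2
  set m := ∑ t : Fin J, k t * (a - (t + 1)) with hm
  have hmn : m ≤ n := hP.size_le
  set N := n - m with hN
  have hNr : (N : ℝ) = n - m := by rw [hN, Nat.cast_sub hmn]
  have hN1 : (n : ℝ) / a ^ 5 ≤ N := by linarith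
  have hN0 : 0 < N := by
    have : (0 : ℝ) < N := lt_of_lt_of_le (by positivity) hN1
    exact_mod_cast this
  have hN0' : (0 : ℝ) < N := by exact_mod_cast hN0
  have hna : (n : ℝ) ≤ N * a ^ 5 := by rwa [div_le_iff₀ (by positivity)] at hN1
  set h := a / 2 with hh
  have hh1 : a ≤ 2 * h + 1 := by omega
  set E := Real.exp (-((a : ℝ) / 100)) with hE
  have hE0 : 0 < E := Real.exp_pos _
  have hE1 := H.exp_neg_mul_le
  have hEsq : √(Real.exp (-((a : ℝ) / 25))) = E ^ 2 := by
    rw [hE, ← Real.exp_nat_mul, Real.sqrt_eq_iff_mul_self_eq (Real.exp_pos _).le (Real.exp_pos _).le, ← Real.exp_add]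
    congr 1; push_cast; ring
  have hpow : ∀ i : ℕ, i ≤ 40 → (a : ℝ) ^ i ≤ n := fun i hi =>
    le_trans (pow_le_pow_right₀ (by linarith) hi) H.pow_le_n
  have hu : ((a : ℝ) ^ 2 / N) ^ 2 * n ^ 2 ≤ a ^ 14 := by
    rw [div_pow, div_mul_eq_mul_div, div_le_iff₀ (by positivity)]
    calc _ ≤ ((a : ℝ) ^ 2) ^ 2 * (N * a ^ 5) ^ 2 := by gcongr
      _ = _ := by ring
  have hb : ((a : ℝ) ^ 2 / N) ^ 2 * 2 ^ (h + 1) ≤ 1 / 4 := by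
    have h1 : ((2 : ℝ) ^ h) ≤ n := by
      refine (pow_le_pow_iff_left₀ (by positivity) hn.le two_ne_zero).1 ?_
      rw [← pow_mul]
      have h2 : (2 : ℝ) ^ (h * 2) ≤ 2 ^ a := pow_le_pow_right₀ (by norm_num) (by omega)
      have h3 := H.scale.le_sq
      have h4 : 25 * (2 : ℝ) ^ a ≤ a ^ 2 * 2 ^ a := by gcongr; nlinarith
      linarith
    have h5 : ((a : ℝ) ^ 2 / N) ^ 2 * 2 ^ (h + 1) * n ≤ 1 / 4 * n := by
      calc ((a : ℝ) ^ 2 / N) ^ 2 * 2 ^ (h + 1) * n = ((a : ℝ) ^ 2 / N) ^ 2 * (2 ^ h * n) * 2 := by ring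
        _ ≤ ((a : ℝ) ^ 2 / N) ^ 2 * (n * n) * 2 := by gcongr
        _ ≤ a ^ 14 * 2 := by rw [← sq]; gcongr
        _ ≤ 1 / 4 * (a ^ 15) := by rw [pow_succ _ 14]; nlinarith [pow_pos (show (0:ℝ) < a by linarith) 14]
        _ ≤ _ := by gcongr; exact hpow 15 (by norm_num)
    exact le_of_mul_le_mul_right h5 hn
  have hmain := hP.one_le_frac_mul hN0 (by rw [← hm]; omega) hh1 hb (Real.exp_pos _).le
    (Real.exp_le_one_iff.2 (by linarith)) (H.exp_neg_mul_sq_le hh1)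
  rw [hEsq, show Real.exp (-(0.01 * (a : ℝ))) = E by rw [hE]; congr 1; ring] at hmain
  set s := ∑ t, k t with hs
  have hsK : (s : ℝ) ≤ classCount n a J z := by
    rw [hs, ← H.sum_sizeCount]; push_cast; exact hP.sum_k_le
  have hK2 := H.classCount_le
  have hsa : (a : ℝ) * s ≤ 1.01 * n := by nlinarith
  have hsn : (s : ℝ) ≤ n := by
    have : (0 : ℝ) ≤ s := Nat.cast_nonneg _
    nlinarith
  refine ⟨s + N, ?_, ?_⟩
  · push_cast; linarith
  rw [Real.exp_neg, inv_le_iff_one_le_mul₀ (Real.exp_pos _)]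
  exact hmain.trans (mul_le_mul_of_nonneg_left (H.secondMoment_le hN0 hna hsn) (frac_nonneg _))

theorem frac_chrom_le_gt (H : Balanced n a J z) :
    0.1 < frac (fun G : SimpleGraph (Fin n) =>
      (chrom G : ℝ) ≤ classCount n a J z + 5 * (n / (a : ℝ) ^ 5) + a ^ 2) := by
  have ha := H.le_a
  have hn := H.n_pos
  obtain ⟨T, hT, hT'⟩ := H.exp_neg_le_frac
  have ht : 0 ≤ 2 * ((n : ℝ) / a ^ 5) := by positivity
  have e : (2 * ((n : ℝ) / a ^ 5)) ^ 2 / (2 * n) = 2 * (n / a ^ 10) := by field_simp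
  have hX : 1 ≤ (n : ℝ) / a ^ 10 := by
    rw [one_le_div (by positivity)]
    exact le_trans (pow_le_pow_right₀ (by linarith) (by norm_num)) H.pow_le_n
  have h1 : Real.exp (-((2 * ((n : ℝ) / a ^ 5)) ^ 2 / (2 * n))) <
      frac (fun G : SimpleGraph (Fin n) => (chrom G : ℝ) ≤ T) := by
    refine lt_of_lt_of_le ?_ (hT'.trans (frac_mono fun G hG => ?_))
    · rw [e, Real.exp_lt_exp]; linarith
    · exact_mod_cast (chrom_le_iff G).2 hG
  have h2 := frac_chrom_le (by exact_mod_cast hn) ht h1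
  rw [e] at h2
  have h3 : Real.exp (-(2 * ((n : ℝ) / a ^ 10))) ≤ 1 / 2 := by
    rw [Real.exp_neg, inv_le_comm₀ (Real.exp_pos _) (by norm_num)]
    have := Real.add_one_le_exp (2 * ((n : ℝ) / a ^ 10))
    linarith
  have h4 := frac_mono (P := fun G : SimpleGraph (Fin n) => (chrom G : ℝ) ≤ T + 2 * (2 * ((n : ℝ) / a ^ 5)))
    (Q := fun G : SimpleGraph (Fin n) => (chrom G : ℝ) ≤ classCount n a J z + 5 * (n / (a : ℝ) ^ 5) + a ^ 2)
    fun G hG => by linarith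
  refine lt_of_lt_of_le ?_ h4
  refine lt_of_lt_of_le ?_ h2
  norm_num; linarith

end Balanced

theorem gw_succ (a : ℕ) : gw (a + 1) = gw a * ((a + 1) * 2 ^ a) := by
  unfold gw
  rw [Nat.choose_succ_succ' a 1, Nat.choose_one_right, pow_add, Nat.factorial_succ]
  push_cast; ring

theorem choose_mul_half_pow_le (N t : ℕ) :
    (N.choose t : ℝ) * (1 / 2) ^ t.choose 2 ≤ (N : ℝ) ^ t / gw t := by
  have h := Nat.choose_le_pow_div (α := ℝ) t N
  unfold gw
  rw [one_div, inv_pow, ← div_eq_mul_inv, ← div_div]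
  gcongr

theorem sum_classW_eq (a : ℕ) (θ x : ℝ) :
    ∑ s ∈ Finset.range (a + 1), classW a θ s * x ^ s / gw s =
      ∑ i ∈ Finset.range a, classW a θ (a - (i + 1)) * x ^ (a - (i + 1)) / gw (a - (i + 1)) +
        classW a θ a * x ^ a / gw a := by
  rw [Finset.sum_range_succ, ← Finset.sum_range_reflect]
  congr 1
  refine Finset.sum_congr rfl fun i _ => ?_
  rw [Nat.sub_sub, Nat.add_comm 1 i]

theorem pow_div_factorial_le {K : ℕ} (hK : 0 < K) {P k v : ℝ} (hP0 : 0 ≤ P)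
    (hP : P ≤ k * Real.exp v) :
    P ^ K / K.factorial ≤ Real.exp (K * (v + 1) - (K - k)) := by
  have hK' : (0 : ℝ) < K := by exact_mod_cast hK
  have h1 := pow_le_exp_mul_factorial K
  have h2 : k ≤ K * Real.exp ((k - K) / K) := by
    have := Real.add_one_le_exp ((k - K) / K)
    calc k = K * ((k - K) / K + 1) := by field_simp; ring
      _ ≤ _ := by gcongr
  rw [div_le_iff₀ (by positivity)]
  calc P ^ K ≤ (K * Real.exp ((k - K) / K) * Real.exp v) ^ K := by
        gcongr
        exact hP.trans (by gcongr)
    _ = (K : ℝ) ^ K * Real.exp (K * ((k - K) / K + v)) := by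
        rw [mul_assoc, ← Real.exp_add, mul_pow, ← Real.exp_nat_mul]
    _ ≤ Real.exp K * K.factorial * Real.exp (K * ((k - K) / K + v)) := by gcongr
    _ = Real.exp (K + K * ((k - K) / K + v)) * K.factorial := by rw [Real.exp_add]; ring
    _ = _ := by congr 2; field_simp; ring

theorem factorial_div_pow_le {n d : ℕ} (hn : 0 < n) (y : ℝ) :
    ((n + d).factorial : ℝ) / (n * Real.exp y) ^ (n + d) ≤
      Real.exp (1 + Real.log (n + d : ℕ) + (d : ℝ) ^ 2 / n - n - (n + d : ℕ) * y) := by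
  have hn' : (0 : ℝ) < n := by exact_mod_cast hn
  have h1 := factorial_le_stirling (A := n + d) (N := n + d) (x := (n + d : ℕ)) (by omega) le_rfl le_rfl
  rw [div_le_iff₀ (by positivity)]
  have hN : (0 : ℝ) < (n + d : ℕ) := by positivity
  have h2 : ((n + d : ℕ) : ℝ) ≤ n * Real.exp (d / n) := by
    have := Real.add_one_le_exp ((d : ℝ) / n)
    calc ((n + d : ℕ) : ℝ) = n * (d / n + 1) := by push_cast; field_simp; ring
      _ ≤ _ := by gcongr
  refine h1.trans ?_
  calc Real.exp 1 * (n + d : ℕ) * (((n + d : ℕ) : ℝ) / Real.exp 1) ^ (n + d)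
      ≤ Real.exp 1 * (n + d : ℕ) * ((n * Real.exp (d / n)) / Real.exp 1) ^ (n + d) := by gcongr
    _ = Real.exp 1 * Real.exp (Real.log (n + d : ℕ)) *
        (n * Real.exp y * Real.exp (d / n - 1 - y)) ^ (n + d) := by
        rw [Real.exp_log hN, mul_div_assoc, ← Real.exp_sub, mul_assoc (n : ℝ), ← Real.exp_add]
        congr 4; ring
    _ = Real.exp (1 + Real.log (n + d : ℕ) + (n + d : ℕ) * (d / n - 1 - y)) *
        (n * Real.exp y) ^ (n + d) := by
        rw [mul_pow, ← Real.exp_nat_mul, Real.exp_add, Real.exp_add]; ring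
    _ = _ := by
        congr 2; push_cast; field_simp; ring

namespace Balanced

variable {n a J : ℕ} {z : ℝ}

theorem expSets_le (H : Balanced n a J z) : 2000 * (a : ℝ) ^ 2 * expSets n a ≤ n := by
  unfold expSets; rw [← mul_div_assoc, div_le_iff₀ (gw_pos a)]; exact H.scale.le_gw

theorem add_pow_le (H : Balanced n a J z) {d : ℕ} (hd : a * d ≤ n) :
    ((n + d : ℕ) : ℝ) ^ a ≤ Real.exp 1 * n ^ a := by
  have hn := H.n_pos
  have hd' : (a : ℝ) * d ≤ n := by exact_mod_cast hd
  have : ((n + d : ℕ) : ℝ) = n * (d / n + 1) := by push_cast; field_simp; ring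
  rw [this, mul_pow, mul_comm]
  gcongr
  calc ((d : ℝ) / n + 1) ^ a ≤ Real.exp (d / n) ^ a := by gcongr; exact Real.add_one_le_exp _
    _ = Real.exp (a * (d / n)) := (Real.exp_nat_mul _ _).symm
    _ ≤ _ := by
      rw [Real.exp_le_exp, ← mul_div_assoc, div_le_one hn]
      exact hd'

theorem frac_indepSets_le (H : Balanced n a J z) {d : ℕ} (hd : a * d ≤ n) {m : ℝ}
    (hm : 4 * Real.exp 1 * expSets n a ≤ m) :
    frac (fun G : SimpleGraph (Fin (n + d)) => m ≤ (indepSets G a).card) ≤ 1 / 4 := by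
  have hX := H.expSets_pos
  have hm0 : 0 < m := lt_of_lt_of_le (by positivity) hm
  have g := gw_pos a
  refine (frac_le_card_indepSets a hm0).trans ?_
  rw [Fintype.card_fin, div_le_iff₀ hm0]
  refine (choose_mul_half_pow_le _ _).trans ?_
  have h1 := H.add_pow_le hd
  have h2 : ((n + d : ℕ) : ℝ) ^ a / gw a ≤ Real.exp 1 * expSets n a := by
    unfold expSets
    rw [← mul_div_assoc]
    gcongr
  linarith

theorem frac_indepSets_succ_le (H : Balanced n a J z) {d : ℕ} (hd : a * d ≤ n) :
    frac (fun G : SimpleGraph (Fin (n + d)) => (1 : ℝ) ≤ (indepSets G (a + 1)).card) ≤ 1 / 10 := by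
  have hX := H.expSets_pos
  have ha := H.le_a
  have hn := H.n_pos
  have g := gw_pos a
  refine (frac_le_card_indepSets (a + 1) one_pos).trans ?_
  rw [Fintype.card_fin, div_one]
  refine (choose_mul_half_pow_le _ _).trans ?_
  have h1 := H.add_pow_le hd
  have hd' : (a : ℝ) * d ≤ n := by exact_mod_cast hd
  have hdn : (d : ℝ) ≤ n := by
    have : (0 : ℝ) ≤ d := Nat.cast_nonneg d
    nlinarith
  have h3 := H.expSets_le
  have h4 := H.scale.sq_le
  have he := Real.exp_one_lt_d9
  rw [gw_succ, pow_succ, mul_div_mul_comm]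
  have h2 : ((n + d : ℕ) : ℝ) ^ a / gw a ≤ Real.exp 1 * expSets n a := by
    unfold expSets
    rw [← mul_div_assoc]
    gcongr
  have h5 : ((n + d : ℕ) : ℝ) / ((a + 1) * 2 ^ a) ≤ 2 * n / (a * 2 ^ a) := by
    push_cast
    gcongr <;> linarith
  calc _ ≤ Real.exp 1 * expSets n a * (2 * n / (a * 2 ^ a)) := by gcongr
    _ ≤ 1 / 10 := by
      rw [← mul_div_assoc, div_le_iff₀ (by positivity)]
      refine le_of_mul_le_mul_left (a := 2000 * (a : ℝ) ^ 2) ?_ (by positivity)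
      calc 2000 * (a : ℝ) ^ 2 * (Real.exp 1 * expSets n a * (2 * n))
          = (2000 * (a : ℝ) ^ 2 * expSets n a) * (2 * n) * Real.exp 1 := by ring
        _ ≤ (n : ℝ) * (2 * (n : ℝ)) * 3 := by gcongr; linarith
        _ = 6 * (n : ℝ) ^ 2 := by ring
        _ ≤ 6 * ((a : ℝ) ^ 2 * (2 : ℝ) ^ a) := by gcongr
        _ ≤ 200 * (a : ℝ) * ((a : ℝ) ^ 2 * (2 : ℝ) ^ a) := by gcongr; linarith
        _ = _ := by ring

theorem sum_classW_le (H : Balanced n a J z) :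
    ∑ s ∈ Finset.range (a + 1), classW a (a : ℝ) s * (n * Real.exp (logRatio n a z)) ^ s / gw s ≤
      classCount n a J z *
        Real.exp (logRatio n a z * a - logExcess n a J z + 1 / a) := by
  have ha := H.le_a
  have ha0 : 0 < a := by have := H.large.le_a; omega
  have hn := H.n_pos
  have hX := H.expSets_pos
  have hz : 0 < z := by linarith [H.z_mem.1]
  have hW := twelve_le_wtSum H.z_mem.1 (show 2 ≤ J by have := H.le_J; omega)
  have hJa : 1000 * J ≤ a := by have := H.J_eq; omega
  set y := logRatio n a z with hy
  set C := Real.exp (y * a) * expSets n a with hC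
  have hC0 : 0 < C := by positivity
  have h1 : classW a (a : ℝ) a * (n * Real.exp y) ^ a / gw a = C * (1 / a) := by
    have : classW a (a : ℝ) a = (a : ℝ)⁻¹ := by unfold classW; simp [Nat.one_le_iff_ne_zero, ha0.ne']
    rw [this, mul_pow, ← Real.exp_nat_mul, hC, expSets, mul_comm (a : ℝ) y]
    ring
  have h2 : ∀ i ∈ Finset.range a, classW a (a : ℝ) (a - (i + 1)) * (n * Real.exp y) ^ (a - (i + 1)) /
      gw (a - (i + 1)) ≤ C * wt z (i + 1) := by
    intro i hi
    have hi' : i + 1 ≤ a := Finset.mem_range.1 hi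
    have g := gw_pos (a - (i + 1))
    have hw := wt_pos hz (i + 1)
    have hcl : classW a (a : ℝ) (a - (i + 1)) ≤ 1 := by
      unfold classW
      split_ifs with h1 h2
      · omega
      · exact le_rfl
      · exact zero_le_one
    calc _ ≤ 1 * (n * Real.exp y) ^ (a - (i + 1)) / gw (a - (i + 1)) := by gcongr
      _ = (n : ℝ) ^ (a - (i + 1)) / gw (a - (i + 1)) * Real.exp (y * (a - (i + 1 : ℕ))) := by
        rw [one_mul, mul_pow, ← Real.exp_nat_mul, Nat.cast_sub hi', mul_comm y]; ring
      _ = expSets n a * (a.descFactorial (i + 1) / (a : ℝ) ^ (i + 1)) *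
          (Real.exp (y * (i + 1 : ℕ)) * wt z (i + 1)) * Real.exp (y * (a - (i + 1 : ℕ))) := by
        rw [pow_div_gw_sub (by exact_mod_cast hn) ha0 hz hi']
      _ ≤ expSets n a * 1 *
          (Real.exp (y * (i + 1 : ℕ)) * wt z (i + 1)) * Real.exp (y * (a - (i + 1 : ℕ))) := by
        gcongr; exact descFactorial_div_pow_le _ _
      _ = expSets n a * (Real.exp (y * (i + 1 : ℕ)) * Real.exp (y * (a - (i + 1 : ℕ)))) * wt z (i + 1) := by
        ring
      _ = _ := by rw [← Real.exp_add, hC]; ring_nf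
  have h3 : wtSum z a ≤ wtSum z J + 1 / a := by
    have e1 := sum_wt_le hz.le H.z_mem.2 (by omega : J ≤ a)
    have e2 : 1024 / (2 : ℝ) ^ J ≤ 1 / a := by
      have l1 := H.large.log_le
      have l2 : Real.log 1024 = 10 * Real.log 2 := by
        rw [show (1024 : ℝ) = 2 ^ (10 : ℕ) by norm_num, Real.log_pow]; norm_num
      have l3 := Real.log_two_gt_d9
      have l4 := Real.log_two_lt_d9
      have l5 : (a : ℝ) ≤ 1000 * J + 1000 := by
        have : a ≤ 1000 * J + 1000 := by have := H.J_eq; omega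
        exact_mod_cast this
      rw [div_le_div_iff₀ (by positivity) (by linarith), one_mul,
        ← Real.log_le_log_iff (by positivity) (by positivity),
        Real.log_mul (by norm_num) (by linarith), Real.log_pow, l2]
      nlinarith
    linarith
  rw [sum_classW_eq, h1]
  have h4 : ∑ i ∈ Finset.range a, classW a (a : ℝ) (a - (i + 1)) * (n * Real.exp y) ^ (a - (i + 1)) /
      gw (a - (i + 1)) ≤ C * wtSum z a := by
    rw [wtSum, Finset.mul_sum]
    exact Finset.sum_le_sum h2
  calc _ ≤ C * wtSum z a + C * (1 / a) := by gcongr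
    _ ≤ C * (wtSum z J + 1 / a) + C * (1 / a) := by gcongr
    _ = C * (wtSum z J + 2 * (1 / a)) := by ring
    _ ≤ C * (wtSum z J * Real.exp (1 / a)) := by
      gcongr
      have := Real.add_one_le_exp (1 / (a : ℝ))
      have h0 : 0 ≤ 1 / (a : ℝ) := by positivity
      nlinarith
    _ = _ := by
      rw [← H.exp_logExcess, hC, Real.exp_add, Real.exp_sub]
      field_simp

theorem logRatio_mul_sub (H : Balanced n a J z) :
    classCount n a J z * (logRatio n a z * a - logExcess n a J z + 1) =
      (n - n / (a : ℝ) ^ 5) * (1 + logRatio n a z) + 60 * (classCount n a J z / a) := by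
  have h := H.balance
  rw [← H.classCount_mul]
  have : logRatio n a z * a - logExcess n a J z + 1 =
      (a - wtMean z J) * (1 + logRatio n a z) + 60 / a := by linear_combination h
  rw [this]; ring

set_option maxHeartbeats 1000000 in
theorem firstMoment_exponent_le (H : Balanced n a J z) {d : ℕ} (h1 : n ≤ 2 * a * d) (h2 : a * d ≤ n)
    {m K : ℝ} (hm : m ≤ 4 * Real.exp 1 * expSets n a + 1)
    (hK : K ≤ classCount n a J z + d / a * (1 + Real.log a / a ^ 2)) :
    m * Real.log a + (1 + Real.log (n + d : ℕ) + (d : ℝ) ^ 2 / n - n - (n + d : ℕ) * logRatio n a z) +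
      (K * ((logRatio n a z * a - logExcess n a J z + 1 / a) + 1) - (K - classCount n a J z)) ≤
      -(n / (a : ℝ) ^ 2) := by
  have ha := H.le_a
  have hn := H.n_pos
  have hk := H.classCount_pos
  obtain ⟨y1, y2⟩ := logRatio_bounds H.scale H.large H.z_mem
  obtain ⟨R1, R2⟩ := logExcess_bounds H.scale H.large H.z_mem H.le_J
  have l1 := H.large.log_le
  have l0 := H.large.le_log
  have l3 := Real.log_two_gt_d9
  have l4 := Real.log_two_lt_d9
  have hbal := H.logRatio_mul_sub
  have hkle := H.classCount_le
  have hX := H.expSets_le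
  have he := Real.exp_one_lt_d9
  have he0 := Real.exp_one_gt_d9
  have hX0 := H.expSets_pos
  set y := logRatio n a z
  set R := logExcess n a J z
  set k := classCount n a J z
  set L := Real.log a
  set X := expSets n a
  have h1' : (n : ℝ) ≤ 2 * a * d := by exact_mod_cast h1
  have h2' : (a : ℝ) * d ≤ n := by exact_mod_cast h2
  have hd0 : (0 : ℝ) ≤ d := Nat.cast_nonneg d
  set Q := (n : ℝ) / a ^ 2 with hQ
  have hnQ : (n : ℝ) = Q * a ^ 2 := by rw [hQ]; field_simp
  have hQa : (a : ℝ) ≤ Q := by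
    rw [hQ, le_div_iff₀ (by positivity)]
    calc (a : ℝ) * (a : ℝ) ^ 2 = (a : ℝ) ^ 3 := by ring
      _ ≤ (a : ℝ) ^ 40 := pow_le_pow_right₀ (by linarith) (by norm_num)
      _ ≤ n := H.pow_le_n
  have hy0 : 0.3 * a ≤ y := by nlinarith
  have hy3 : y ≤ 0.35 * a := by nlinarith
  have hA : 0 ≤ y * a - R + 1 / a := by
    have : 0 ≤ 1 / (a : ℝ) := by positivity
    nlinarith
  set D := (d : ℝ) / a with hD
  have hdD : (d : ℝ) = D * a := by rw [hD]; field_simp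
  have hD1 : Q ≤ 2 * D := by
    rw [hQ, hD, div_le_iff₀ (by positivity)]
    have : 2 * ((d : ℝ) / a) * a ^ 2 = 2 * a * d := by field_simp
    linarith
  have hD2 : D ≤ Q := by
    rw [hQ, hD, le_div_iff₀ (by positivity)]
    have : ((d : ℝ) / a) * a ^ 2 = a * d := by field_simp
    linarith
  have hk2 : k / a ≤ 1.01 * Q := by
    rw [hQ, div_le_iff₀ (by linarith)]
    have : 1.01 * ((n : ℝ) / a ^ 2) * a = 1.01 * n / a := by field_simp
    rw [this, le_div_iff₀ (by linarith)]
    linarith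
  have hXQ : X ≤ Q / 2000 := by
    rw [hQ, div_div, le_div_iff₀ (by positivity)]
    linarith
  have hmL : m * L ≤ 0.006 * Q * L + L := by
    have e1 : Real.exp 1 * X ≤ 2.72 * (Q / 2000) := by gcongr; linarith
    have e2 : m ≤ 0.006 * Q + 1 := by linarith
    calc m * L ≤ (0.006 * Q + 1) * L := by gcongr
      _ = _ := by ring
  have hlog : Real.log (n + d : ℕ) ≤ a := by
    have h3 := H.one_add_log_n_le
    have h4 : ((n + d : ℕ) : ℝ) ≤ n * Real.exp 1 := by
      have e1 : (1 : ℝ) * d ≤ a * d := by gcongr; linarith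
      have e2 : (n : ℝ) * 2 ≤ n * Real.exp 1 := by gcongr; linarith
      push_cast; linarith
    calc _ ≤ Real.log (n * Real.exp 1) := Real.log_le_log (by push_cast; linarith) h4
      _ = Real.log n + 1 := by rw [Real.log_mul hn.ne' (Real.exp_pos _).ne', Real.log_exp]
      _ ≤ _ := by linarith
  have hd2 : (d : ℝ) ^ 2 / n ≤ Q := by
    rw [hQ, div_le_div_iff₀ hn (by positivity)]
    calc (d : ℝ) ^ 2 * (a : ℝ) ^ 2 = (a * d) ^ 2 := by ring
      _ ≤ (n : ℝ) ^ 2 := by gcongr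
      _ = _ := by ring
  set M := D * (1 + L / a ^ 2) with hM
  have hKA : K * (y * a - R + 1 / a) ≤ (k + M) * (y * a - R + 1 / a) := by gcongr
  have hLa : L / (a : ℝ) ^ 2 ≤ 1 := by
    rw [div_le_one (by positivity)]
    have : (a : ℝ) ≤ a ^ 2 := le_self_pow₀ (by linarith) (by norm_num)
    linarith
  have hLa0 : 0 ≤ L / (a : ℝ) ^ 2 := by positivity
  have hM2 : M * (1 / a) ≤ Q := by
    rw [mul_one_div, div_le_iff₀ (by linarith)]
    calc M ≤ D * (1 + 1) := by rw [hM]; gcongr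
      _ ≤ Q * (1 + 1) := by gcongr
      _ ≤ Q * a := by gcongr; linarith
  have hMA : M * (y * a - R) ≤ d * y - 0.65 * (D * L) := by
    have e : M * (y * a) = d * y + D * L * (y / a) := by rw [hM, hdD]; field_simp
    have e2 : y / a ≤ 0.35 := by rw [div_le_iff₀ (by linarith)]; linarith
    have e3 : D * L ≤ M * R := by
      calc D * L ≤ D * R := by gcongr
        _ ≤ M * R := by
          have hR : 0 ≤ R := by linarith
          gcongr
          rw [hM]
          exact le_mul_of_one_le_right (by positivity) (by linarith)
    have e4 : D * L * (y / a) ≤ D * L * 0.35 := by gcongr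
    rw [mul_sub, e]; linarith
  have hDL : Q * L ≤ 2 * D * L := by gcongr
  have hQ5 : 0 ≤ (n : ℝ) / a ^ 5 * (1 + y) := by
    have : 0 ≤ 1 + y := by linarith
    positivity
  have hQL : Q * 1000 ≤ Q * L := by gcongr
  have hka : k * (1 / a) = k / a := mul_one_div _ _
  push_cast at hlog ⊢
  linarith

theorem frac_chrom_le_half (H : Balanced n a J z) {d : ℕ} (h1 : n ≤ 2 * a * d) (h2 : a * d ≤ n) :
    frac (fun G : SimpleGraph (Fin (n + d)) =>
      (chrom G : ℝ) ≤ classCount n a J z + d / a * (1 + Real.log a / a ^ 2)) ≤ 0.5 := by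
  have ha := H.le_a
  have hn := H.n_pos
  have hn0 : 0 < n := by exact_mod_cast hn
  have hk := H.classCount_pos
  have hk1 := H.classCount_ge
  have hk2 := H.classCount_le
  have h2' : (a : ℝ) * d ≤ n := by exact_mod_cast h2
  have hd0 : (0 : ℝ) ≤ d := Nat.cast_nonneg d
  have l1 := H.large.log_le
  have l0 := H.large.le_log
  have han : (a : ℝ) ^ 3 ≤ n := le_trans (pow_le_pow_right₀ (by linarith) (by norm_num)) H.pow_le_n
  have ha1 : (a : ℝ) ≤ a ^ 3 := le_self_pow₀ (by linarith) (by norm_num)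
  set T := classCount n a J z + d / a * (1 + Real.log a / a ^ 2) with hT
  have hT0 : 0 ≤ (d : ℝ) / a * (1 + Real.log a / a ^ 2) := by
    have : 0 ≤ Real.log a := by linarith
    positivity
  have hT1 : 1 ≤ T := by
    have : 1 ≤ classCount n a J z := by nlinarith
    linarith
  have hT2 : T ≤ n := by
    have e1 : classCount n a J z ≤ 0.1 * n := by nlinarith
    have e2 : (d : ℝ) / a ≤ 0.1 * n := by rw [div_le_iff₀ (by linarith)]; nlinarith
    have e3 : Real.log a / (a : ℝ) ^ 2 ≤ 1 := by rw [div_le_one (by positivity)]; nlinarith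
    have : (d : ℝ) / a * (1 + Real.log a / a ^ 2) ≤ 0.1 * n * (1 + 1) := by
      have : 0 ≤ Real.log a := by linarith
      gcongr
    linarith
  set K := ⌊T⌋₊ with hK
  have hK0 : 0 < K := Nat.floor_pos.2 hT1
  have hKT : (K : ℝ) ≤ T := Nat.floor_le (by linarith)
  have hKn : K ≤ n + d := by
    have : (K : ℝ) ≤ n := hKT.trans hT2
    have : K ≤ n := by exact_mod_cast this
    omega
  have hX := H.expSets_pos
  set m := ⌈4 * Real.exp 1 * expSets n a⌉₊ with hm
  have hm1 : 4 * Real.exp 1 * expSets n a ≤ m := Nat.le_ceil _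
  have hm2 : (m : ℝ) ≤ 4 * Real.exp 1 * expSets n a + 1 := (Nat.ceil_lt_add_one (by positivity)).le
  have p1 := H.frac_indepSets_le h2 hm1
  have p2 := H.frac_indepSets_succ_le h2
  set y := logRatio n a z with hy
  have p3 := frac_colorable_and_le (V := Fin (n + d)) (a := a) (m := m) (K := K) (θ := a)
    (x := n * Real.exp y) (by linarith) (by positivity) (by rwa [Fintype.card_fin])
  rw [Fintype.card_fin] at p3
  have q1 := factorial_div_pow_le (n := n) (d := d) hn0 y
  have hS0 : 0 ≤ ∑ s ∈ Finset.range (a + 1), classW a (a : ℝ) s * (n * Real.exp y) ^ s / gw s :=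
    Finset.sum_nonneg fun s _ => by
      have g := gw_pos s
      have := classW_nonneg (a := a) (show (0 : ℝ) ≤ a by linarith) s
      positivity
  have q2 := pow_div_factorial_le hK0 hS0 H.sum_classW_le
  have q3 : (a : ℝ) ^ m = Real.exp (m * Real.log a) := by
    rw [Real.exp_nat_mul, Real.exp_log (by linarith)]
  have p4 := p3.trans (show _ ≤ (0.1 : ℝ) by
    rw [mul_div_assoc, q3]
    calc _ ≤ Real.exp (m * Real.log a) * Real.exp _ * Real.exp _ := by gcongr
      _ ≤ Real.exp (-(n / (a : ℝ) ^ 2)) := by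
        rw [← Real.exp_add, ← Real.exp_add, Real.exp_le_exp]
        exact H.firstMoment_exponent_le h1 h2 hm2 hKT
      _ ≤ 0.1 := by
        have e : 10 ≤ (n : ℝ) / a ^ 2 := by
          rw [le_div_iff₀ (by positivity)]; nlinarith [sq_nonneg (a : ℝ)]
        rw [Real.exp_neg, inv_le_comm₀ (Real.exp_pos _) (by norm_num)]
        have := Real.add_one_le_exp ((n : ℝ) / a ^ 2)
        norm_num; linarith)
  have p5 := frac_mono (P := fun G : SimpleGraph (Fin (n + d)) => (chrom G : ℝ) ≤ T)
    (Q := fun G => (G.Colorable K ∧ (indepSets G a).card ≤ m ∧ (indepSets G (a + 1)).card = 0) ∨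
      (((m : ℝ) ≤ (indepSets G a).card) ∨ ((1 : ℝ) ≤ (indepSets G (a + 1)).card))) fun G hG => by
    by_cases c1 : (m : ℝ) ≤ (indepSets G a).card
    · exact Or.inr (Or.inl c1)
    by_cases c2 : (1 : ℝ) ≤ (indepSets G (a + 1)).card
    · exact Or.inr (Or.inr c2)
    refine Or.inl ⟨(chrom_le_iff G).1 (Nat.le_floor hG), ?_, ?_⟩
    · exact_mod_cast (not_le.1 c1).le
    · have : (indepSets G (a + 1)).card < 1 := by exact_mod_cast not_le.1 c2
      omega
  have p6 := frac_or_le (fun G : SimpleGraph (Fin (n + d)) => G.Colorable K ∧ (indepSets G a).card ≤ m ∧ (indepSets G (a + 1)).card = 0)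
    (fun G => ((m : ℝ) ≤ (indepSets G a).card) ∨ ((1 : ℝ) ≤ (indepSets G (a + 1)).card))
  have p7 := frac_or_le (fun G : SimpleGraph (Fin (n + d)) => (m : ℝ) ≤ (indepSets G a).card)
    (fun G => (1 : ℝ) ≤ (indepSets G (a + 1)).card)
  norm_num at *
  linarith

theorem nine_mul_pow_mul_two_pow_le (H : Balanced n a J z) :
    9 * (a : ℝ) ^ 4 * 2 ^ a ≤ Real.exp (-(a / 25)) ^ 2 * 2 ^ (a + a / 2) := by
  have ha := H.le_a
  have l1 := H.large.log_le
  have l3 := Real.log_two_gt_d9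
  have h1 : (a : ℝ) ≤ 2 * (a / 2 : ℕ) + 1 := by exact_mod_cast (by omega : a ≤ 2 * (a / 2) + 1)
  have h2 : (9 : ℝ) ≤ Real.exp 3 := by
    rw [show (3 : ℝ) = (3 : ℕ) * 1 by norm_num, Real.exp_nat_mul]
    have : (2.7 : ℝ) ^ 3 ≤ Real.exp 1 ^ 3 := by
      gcongr; linarith [Real.exp_one_gt_d9]
    refine le_trans ?_ this
    norm_num
  have h3 : (a : ℝ) ^ 4 = Real.exp ((4 : ℕ) * Real.log a) := by
    rw [Real.exp_nat_mul, Real.exp_log (by linarith)]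
  have h4 : (2 : ℝ) ^ (a / 2) = Real.exp ((a / 2 : ℕ) * Real.log 2) := by
    rw [Real.exp_nat_mul, Real.exp_log (by norm_num)]
  rw [pow_add, mul_comm ((2 : ℝ) ^ a), ← mul_assoc]
  refine mul_le_mul_of_nonneg_right ?_ (by positivity)
  calc 9 * (a : ℝ) ^ 4 ≤ Real.exp 3 * Real.exp ((4 : ℕ) * Real.log a) := by rw [h3]; gcongr
    _ ≤ Real.exp ((2 : ℕ) * -((a : ℝ) / 25)) * Real.exp ((a / 2 : ℕ) * Real.log 2) := by
      rw [← Real.exp_add, ← Real.exp_add, Real.exp_le_exp]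
      push_cast
      nlinarith
    _ = _ := by rw [h4, Real.exp_nat_mul]

theorem two_pow_half_le (H : Balanced n a J z) : (2 : ℝ) ^ (a / 2) ≤ n := by
  have ha := H.le_a
  have hn := H.n_pos
  refine (pow_le_pow_iff_left₀ (by positivity) hn.le two_ne_zero).1 ?_
  rw [← pow_mul]
  have h2 : (2 : ℝ) ^ (a / 2 * 2) ≤ 2 ^ a := pow_le_pow_right₀ (by norm_num) (by omega)
  have h3 := H.scale.le_sq
  have h4 : 25 * (2 : ℝ) ^ a ≤ a ^ 2 * 2 ^ a := by gcongr; nlinarith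
  linarith

theorem coupling_step (H : Balanced n a J z) {N r T : ℕ} (hN : n ≤ N) (hN' : N ≤ 2 * n)
    (hr : 8000 * (a : ℝ) ^ 2 * r ^ 2 ≤ n)
    (hT : 0.9 ≤ frac (fun G : SimpleGraph (Fin N) => G.Colorable T)) :
    0.1 < frac (fun G : SimpleGraph (Fin (N + a * r)) => G.Colorable (T + r)) := by
  have ha := H.le_a
  have hn := H.n_pos
  have hNr : (n : ℝ) ≤ N := by exact_mod_cast hN
  have hNr' : (N : ℝ) ≤ 2 * n := by exact_mod_cast hN'
  have hN0 : (0 : ℝ) < N := hn.trans_le hNr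
  have hpow : ∀ i : ℕ, i ≤ 40 → (a : ℝ) ^ i ≤ n := fun i hi =>
    le_trans (pow_le_pow_right₀ (by linarith) hi) H.pow_le_n
  have hn1 : (1 : ℝ) ≤ n := by simpa using hpow 0 (by norm_num)
  have har : (a : ℝ) * r ≤ n := by
    refine (pow_le_pow_iff_left₀ (by positivity) hn.le two_ne_zero).1 ?_
    nlinarith [sq_nonneg ((a : ℝ) * r)]
  have hu : ((a : ℝ) ^ 2 / N) ^ 2 * n ≤ a ^ 4 / n := by
    calc ((a : ℝ) ^ 2 / N) ^ 2 * n ≤ ((a : ℝ) ^ 2 / n) ^ 2 * n := by gcongr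
      _ = _ := by field_simp
  have hu1 : (a : ℝ) ^ 4 / n ≤ 1 / 1000 := by
    rw [div_le_div_iff₀ hn (by norm_num)]
    have h5 := hpow 5 (by norm_num)
    have : (a : ℝ) ^ 4 * 1000 ≤ (a : ℝ) ^ 4 * a := by gcongr; linarith
    linarith [pow_succ (a : ℝ) 4]
  refine coupling (n := N) (a := a) (h := a / 2) (δ := Real.exp (-(a / 25))) (by exact_mod_cast hN0) hT
    (by omega) ?_ (Real.exp_pos _).le (Real.exp_le_one_iff.2 (by linarith [div_nonneg (show (0 : ℝ) ≤ a by linarith) (show (0 : ℝ) ≤ 25 by norm_num)])) ?_ ?_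
  · have := H.two_pow_half_le
    calc ((a : ℝ) ^ 2 / N) ^ 2 * 2 ^ (a / 2 + 1) = ((a : ℝ) ^ 2 / N) ^ 2 * 2 ^ (a / 2) * 2 := by ring
      _ ≤ ((a : ℝ) ^ 2 / N) ^ 2 * n * 2 := by gcongr
      _ ≤ 1 / 4 := by linarith
  · refine le_trans ?_ H.nine_mul_pow_mul_two_pow_le
    have h1 : ((N + a * r : ℕ) : ℝ) ≤ 3 * n := by push_cast; linarith
    calc ((a : ℝ) * (N + a * r : ℕ)) ^ 2 ≤ ((a : ℝ) * (3 * n)) ^ 2 := by gcongr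
      _ = 9 * (a : ℝ) ^ 2 * (n : ℝ) ^ 2 := by ring
      _ ≤ 9 * (a : ℝ) ^ 2 * ((a : ℝ) ^ 2 * (2 : ℝ) ^ a) := by
        have := H.scale.sq_le
        gcongr
      _ = _ := by ring
  · have hE := H.exp_neg_mul_le
    have hE1 : (a : ℝ) * √(Real.exp (-(a / 25))) ≤ 1 / 1000 := by
      have e1 : √(Real.exp (-((a : ℝ) / 25))) ≤ Real.exp (-(a / 100)) := by
        rw [Real.sqrt_le_left (Real.exp_pos _).le, ← Real.exp_nat_mul, Real.exp_le_exp]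
        push_cast; linarith
      have e2 : (a : ℝ) ≤ a ^ 12 := le_self_pow₀ (by linarith) (by norm_num)
      calc (a : ℝ) * √(Real.exp (-(a / 25))) ≤ (a : ℝ) ^ 12 * Real.exp (-(a / 100)) := by gcongr
        _ ≤ _ := by linarith
    have hg := gw_pos a
    have hr2 : (r : ℝ) ^ 2 ≤ n := by
      have : (1 : ℝ) ≤ 8000 * a ^ 2 := by nlinarith
      calc (r : ℝ) ^ 2 = 1 * (r : ℝ) ^ 2 := (one_mul _).symm
        _ ≤ 8000 * (a : ℝ) ^ 2 * r ^ 2 := by gcongr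
        _ ≤ _ := hr
    have h1 : (1 + 4 * ((a : ℝ) ^ 2 / N) ^ 2) ^ (r ^ 2) ≤ Real.exp (1 / 100) := by
      calc (1 + 4 * ((a : ℝ) ^ 2 / N) ^ 2) ^ (r ^ 2)
          ≤ Real.exp (4 * ((a : ℝ) ^ 2 / N) ^ 2) ^ (r ^ 2) := by
            gcongr; rw [add_comm]; exact Real.add_one_le_exp _
        _ = Real.exp ((r ^ 2 : ℕ) * (4 * ((a : ℝ) ^ 2 / N) ^ 2)) := (Real.exp_nat_mul _ _).symm
        _ ≤ _ := by
          rw [Real.exp_le_exp]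
          push_cast
          calc (r : ℝ) ^ 2 * (4 * ((a : ℝ) ^ 2 / N) ^ 2) ≤ n * (4 * ((a : ℝ) ^ 2 / N) ^ 2) := by gcongr
            _ ≤ _ := by linarith
    have h2 : (r : ℝ) ^ 2 * (1 + a * √(Real.exp (-(a / 25)))) * gw a / (N : ℝ) ^ a ≤ 0.6 := by
      have h3 := H.scale.gw_le
      calc (r : ℝ) ^ 2 * (1 + a * √(Real.exp (-(a / 25)))) * gw a / (N : ℝ) ^ a
          ≤ (r : ℝ) ^ 2 * (1 + 1 / 1000) * gw a / (n : ℝ) ^ a := by gcongr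
        _ ≤ 0.6 := by
          rw [div_le_iff₀ (by positivity)]
          refine le_of_mul_le_mul_left ?_ hn
          calc (n : ℝ) * ((r : ℝ) ^ 2 * (1 + 1 / 1000) * gw a)
              = (r : ℝ) ^ 2 * (1 + 1 / 1000) * ((n : ℝ) * gw a) := by ring
            _ ≤ (r : ℝ) ^ 2 * (1 + 1 / 1000) * (4000 * (a : ℝ) ^ 2 * (n : ℝ) ^ a) := by gcongr
            _ = 8000 * (a : ℝ) ^ 2 * (r : ℝ) ^ 2 * (0.5005 * (n : ℝ) ^ a) := by ring
            _ ≤ (n : ℝ) * (0.6 * (n : ℝ) ^ a) := by gcongr; norm_num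
    calc _ ≤ Real.exp (1 / 100) * Real.exp 0.6 := by gcongr
      _ = Real.exp 0.61 := by rw [← Real.exp_add]; norm_num
      _ ≤ Real.exp 1 := Real.exp_le_exp.2 (by norm_num)
      _ ≤ 8 := by linarith [Real.exp_one_lt_d9]

end Balanced

theorem exists_chrom_of_frac {n : ℕ} {s t x : ℝ}
    (h : 0.9 ≤ frac (fun G : SimpleGraph (Fin n) => (chrom G : ℝ) ∈ Set.Icc s t))
    (hx : 0.1 < frac (fun G : SimpleGraph (Fin n) => (chrom G : ℝ) ≤ x)) : s ≤ x := by
  obtain ⟨G, hG, hG'⟩ := exists_of_one_lt_frac_add (V := Fin n)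
    (P := fun G => (chrom G : ℝ) ∈ Set.Icc s t) (Q := fun G => (chrom G : ℝ) ≤ x)
    (by norm_num at *; linarith)
  exact hG.1.trans hG'

namespace Balanced

variable {n a J : ℕ} {z : ℝ}

theorem le_add_of_coupling (H : Balanced n a J z) {N r : ℕ} {t s' t' : ℝ} {s : ℝ} (hN : n ≤ N)
    (hN' : N ≤ 2 * n) (hr : 8000 * (a : ℝ) ^ 2 * r ^ 2 ≤ n)
    (h : 0.9 ≤ frac (fun G : SimpleGraph (Fin N) => (chrom G : ℝ) ∈ Set.Icc s t))
    (h' : 0.9 ≤ frac (fun G : SimpleGraph (Fin (N + a * r)) => (chrom G : ℝ) ∈ Set.Icc s' t')) :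
    s' ≤ t + r := by
  have h1 := H.coupling_step (T := ⌊t⌋₊) hN hN' hr (h.trans (frac_mono fun G hG =>
    (chrom_le_iff G).1 (Nat.le_floor hG.2)))
  by_cases ht : 0 ≤ t
  · refine exists_chrom_of_frac h' (h1.trans_le (frac_mono fun G hG => ?_))
    have h2 : (chrom G : ℝ) ≤ (⌊t⌋₊ + r : ℕ) := by exact_mod_cast (chrom_le_iff G).2 hG
    push_cast at h2
    linarith [Nat.floor_le ht]
  · have h3 : frac (fun G : SimpleGraph (Fin N) => (chrom G : ℝ) ∈ Set.Icc s t) ≤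
        frac (fun G : SimpleGraph (Fin N) => (chrom G : ℝ) ≤ -1 / 2 + 0 * t) := by
      refine frac_mono fun G hG => ?_
      have : (0 : ℝ) ≤ chrom G := Nat.cast_nonneg _
      linarith [hG.2]
    have h4 := exists_chrom_of_frac (s := 0) (t := t) (x := -1 / 2 + 0 * t)
      (h.trans (frac_mono fun G hG => ⟨Nat.cast_nonneg _, hG.2⟩)) (lt_of_lt_of_le (by norm_num) (h.trans h3))
    linarith

/-- Near a scale `n`, the width `√N log log N / log ^ 3 N` is at most a constant times
`√n log a / a ^ 3`. -/
theorem width_le (H : Balanced n a J z) {N : ℕ} (hN : n ≤ N) (hN' : N ≤ 2 * n) :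
    √N * Real.log (Real.log N) / Real.log N ^ 3 ≤ 75 * (√n * Real.log a / a ^ 3) := by
  have ha := H.le_a
  have hn := H.n_pos
  have l0 := H.large.le_log
  have hNr : (n : ℝ) ≤ N := by exact_mod_cast hN
  have hNr' : (N : ℝ) ≤ 2 * n := by exact_mod_cast hN'
  have l3 := Real.log_two_gt_d9
  have l4 := Real.log_two_lt_d9
  have h1 : 0.3 * (a : ℝ) ≤ Real.log N := by
    have := H.le_log_n
    have := Real.log_le_log hn hNr
    nlinarith
  have h2 : Real.log N ≤ a := by
    have := H.one_add_log_n_le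
    have := Real.log_le_log (hn.trans_le hNr) hNr'
    rw [Real.log_mul (by norm_num) hn.ne'] at this
    linarith
  have h3 : Real.log (Real.log N) ≤ Real.log a := Real.log_le_log (by linarith) h2
  have h4 : √(N : ℝ) ≤ 2 * √n := by
    rw [Real.sqrt_le_left (by positivity), mul_pow, Real.sq_sqrt hn.le]
    linarith
  have hL : 0 ≤ Real.log a := by linarith
  have hLL : 0 ≤ Real.log (Real.log N) := Real.log_nonneg (by linarith)
  calc √N * Real.log (Real.log N) / Real.log N ^ 3 ≤ 2 * √n * Real.log a / (0.3 * (a : ℝ)) ^ 3 := by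
        gcongr
    _ = 2 / 0.027 * (√n * Real.log a / a ^ 3) := by field_simp; norm_num
    _ ≤ _ := by gcongr; norm_num

theorem exists_width (H : Balanced n a J z) {s t : ℕ → ℝ}
    (h : ∀ n, 0.9 ≤ frac (fun G : SimpleGraph (Fin n) => (chrom G : ℝ) ∈ Set.Icc (s n) (t n))) :
    ∃ N, n ≤ N ∧ 1 / 1000000 * √N * Real.log (Real.log N) / Real.log N ^ 3 ≤ t N - s N := by
  by_contra! hlt
  have ha := H.le_a
  have hn := H.n_pos
  have l0 := H.large.le_log
  have hpow : ∀ i : ℕ, i ≤ 40 → (a : ℝ) ^ i ≤ n := fun i hi =>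
    le_trans (pow_le_pow_right₀ (by linarith) hi) H.pow_le_n
  set L := Real.log a with hL
  set w := √(n : ℝ) with hw
  have hw2 : w ^ 2 = n := Real.sq_sqrt hn.le
  have hwa : 1000000 * (a : ℝ) ≤ w := by
    rw [hw, Real.le_sqrt (by positivity) hn.le]
    calc (1000000 * (a : ℝ)) ^ 2 ≤ (a * a) ^ 2 := by gcongr
      _ = (a : ℝ) ^ 4 := by ring
      _ ≤ _ := hpow 4 (by norm_num)
  set l := 1 / 10000 * (w * L / a ^ 3) with hl
  have hwid : ∀ N, n ≤ N → N ≤ 2 * n → t N ≤ s N + l := by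
    intro N h1 h2
    have h3 := hlt N h1
    have h4 : _ ≤ 75 * (w * L / a ^ 3) := H.width_le h1 h2
    have h5 : 0 ≤ w * L / (a : ℝ) ^ 3 := by positivity
    rw [mul_assoc, mul_div_assoc] at h3
    linarith
  set r := ⌈w / (100 * a)⌉₊ with hr
  have hr1 : w ≤ r * (100 * a) := by
    rw [← div_le_iff₀ (by positivity)]; exact Nat.le_ceil _
  have hr2 : a * r ≤ w / 100 + a := by
    have := (Nat.ceil_lt_add_one (show 0 ≤ w / (100 * (a : ℝ)) by positivity)).le
    calc (a : ℝ) * r ≤ a * (w / (100 * a) + 1) := by gcongr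
      _ = _ := by field_simp
  have hrn : 8000 * (a : ℝ) ^ 2 * r ^ 2 ≤ n := by
    calc 8000 * (a : ℝ) ^ 2 * (r : ℝ) ^ 2 = 8000 * (a * r) ^ 2 := by ring
      _ ≤ 8000 * (w / 100 + w / 1000000) ^ 2 := by gcongr; linarith
      _ ≤ w ^ 2 := by nlinarith
      _ = n := hw2
  have hrpos : 0 < r := by
    have : (0 : ℝ) < r := by nlinarith
    exact_mod_cast this
  have hiter : ∀ i : ℕ, i * (a * r) ≤ n → t (n + i * (a * r)) ≤ t n + i * (r + l) := by
    intro i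
    induction i with
    | zero => intro _; simp
    | succ i ih =>
      intro hi
      have e : n + (i + 1) * (a * r) = n + i * (a * r) + a * r := by ring
      have hi' : i * (a * r) ≤ n := by nlinarith
      have h1 := H.le_add_of_coupling (N := n + i * (a * r)) (by omega) (by omega) hrn (h _)
        (h (n + i * (a * r) + a * r))
      have h2 := hwid (n + i * (a * r) + a * r) (by omega) (by omega)
      have h3 := ih hi'
      rw [e]; push_cast; linarith
  have ha0 : 0 < a := by have := H.large.le_a; omega
  have har : a * (a * r) ≤ n := by
    have : (a : ℝ) * (a * r) ≤ n := by
      calc (a : ℝ) * (a * r) ≤ w * (w / 100 + a) := by gcongr; linarith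
        _ ≤ w ^ 2 := by nlinarith
        _ = n := hw2
    exact_mod_cast this
  set i := n / (a * (a * r)) with hi
  have hpos : 0 < a * (a * r) := by positivity
  have hi1 : 1 ≤ i := (Nat.one_le_div_iff hpos).2 har
  have hi2 : a * (i * (a * r)) ≤ n := by
    have := Nat.div_mul_le_self n (a * (a * r))
    calc a * (i * (a * r)) = n / (a * (a * r)) * (a * (a * r)) := by rw [← hi]; ring
      _ ≤ n := this
  have hi3 : n ≤ 2 * a * (i * (a * r)) := by
    have h1 := (Nat.lt_div_mul_add (a := n) hpos).le
    rw [← hi] at h1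
    calc n ≤ i * (a * (a * r)) + 1 * (a * (a * r)) := by linarith
      _ ≤ i * (a * (a * r)) + i * (a * (a * r)) := by gcongr
      _ = _ := by ring
  have hi4 : i * (a * r) ≤ n := le_trans (Nat.le_mul_of_pos_left _ ha0) hi2
  have h1 : s n ≤ _ := exists_chrom_of_frac (h n) H.frac_chrom_le_gt
  have h2 := hiter i hi4
  have h3 := hwid n le_rfl (by omega)
  have h4 : classCount n a J z + (i * (a * r) : ℕ) / a * (1 + Real.log a / a ^ 2) <
      t (n + i * (a * r)) := by
    by_contra! hle
    have h5 := H.frac_chrom_le_half hi3 hi2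
    have h6 := (h (n + i * (a * r))).trans (frac_mono fun G hG => hG.2.trans hle)
    norm_num at h5 h6
    linarith
  have e1 : ((i * (a * r) : ℕ) : ℝ) / a = i * r := by push_cast; field_simp
  rw [e1] at h4
  have hi1' : (1 : ℝ) ≤ i := by exact_mod_cast hi1
  have hi3' : (n : ℝ) ≤ 2 * a * (i * (a * r)) := by exact_mod_cast hi3
  have b1 : i * l ≤ 1 / 100 * (i * r * (L / a ^ 2)) := by
    have : l ≤ 1 / 100 * (r * (L / a ^ 2)) := by
      calc l = 1 / 10000 * (w * L / a ^ 3) := hl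
        _ ≤ 1 / 10000 * (r * (100 * a) * L / a ^ 3) := by gcongr
        _ = _ := by field_simp; norm_num
    calc i * l ≤ i * (1 / 100 * (r * (L / a ^ 2))) := by gcongr
      _ = _ := by ring
  have b2 : l ≤ i * l := le_mul_of_one_le_left (by positivity) hi1'
  have b3 : (n : ℝ) * 500 / a ^ 4 ≤ i * r * (L / a ^ 2) := by
    calc (n : ℝ) * 500 / (a : ℝ) ^ 4 ≤ 2 * (a : ℝ) * (i * (a * r)) * 500 / (a : ℝ) ^ 4 := by gcongr
      _ = (i : ℝ) * r * (1000 / (a : ℝ) ^ 2) := by field_simp; norm_num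
      _ ≤ _ := by gcongr
  have b4 : 5 * ((n : ℝ) / a ^ 5) ≤ n * 100 / a ^ 4 := by
    rw [← mul_div_assoc, div_le_div_iff₀ (by positivity) (by positivity)]
    have : 5 * (n : ℝ) * a ^ 4 * 1 ≤ 5 * (n : ℝ) * a ^ 4 * (20 * a) := by gcongr; linarith
    calc 5 * (n : ℝ) * a ^ 4 ≤ 5 * (n : ℝ) * a ^ 4 * (20 * a) := by linarith
      _ = _ := by ring
  have b5 : (a : ℝ) ^ 2 ≤ n * 100 / a ^ 4 := by
    rw [le_div_iff₀ (by positivity)]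
    have := hpow 6 (by norm_num)
    calc (a : ℝ) ^ 2 * a ^ 4 = (a : ℝ) ^ 6 := by ring
      _ ≤ _ := by linarith
  have b6 : (n : ℝ) * 500 / a ^ 4 = 5 * (n * 100 / a ^ 4) := by ring
  have b7 : 0 < (n : ℝ) * 100 / a ^ 4 := by positivity
  have e2 : (i : ℝ) * (r + l) = i * r + i * l := by ring
  have e3 : (i : ℝ) * r * (1 + L / a ^ 2) = i * r + i * r * (L / a ^ 2) := by ring
  rw [e2] at h2
  rw [e3] at h4
  linarith

end Balanced

theorem exists_width_ge {s t : ℕ → ℝ}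
    (h : ∀ n, 0.9 ≤ frac (fun G : SimpleGraph (Fin n) => (chrom G : ℝ) ∈ Set.Icc (s n) (t n)))
    (M : ℕ) :
    ∃ N, M ≤ N ∧ 1 / 1000000 * √N * Real.log (Real.log N) / Real.log N ^ 3 ≤ t N - s N := by
  obtain ⟨a, ⟨n, S⟩, hL, hM⟩ := (exists_scale.and (eventually_large.and (eventually_ge_atTop M))).exists
  have L := hL n S
  obtain ⟨z, H⟩ := exists_balanced S L
  obtain ⟨N, hN, hw⟩ := H.exists_width h
  refine ⟨N, ?_, hw⟩
  have ha := H.le_a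
  have : (a : ℝ) ≤ n := le_trans (le_self_pow₀ (by linarith) (by norm_num)) H.pow_le_n
  have : a ≤ n := by exact_mod_cast this
  omega

end ChromNC

/-- Assume: whenever `a = a(n)` is an integer-valued function with
`μ_{a(n)}(n) = Θ(n / log² n)`, then whp `χ_{a(n)−1}(G_{n,1/2}) = k_{a(n)−1}(n) + O(n^{0.99})`.
Then there is a constant `c > 0` such that for any sequence of intervals `[s n, t n]` with
`P(χ(G_{n,1/2}) ∈ [s n, t n]) ≥ 0.9` for all `n`, there are infinitely many `n*` with
`t_{n*} − s_{n*} ≥ c √n* log log n* / (log n*)³`. -/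
theorem chromatic_nonconcentration_polylog
    (hyp : ∀ a : ℕ → ℕ,
      (∃ c₁ c₂ : ℝ, 0 < c₁ ∧ 0 < c₂ ∧ ∀ᶠ n : ℕ in atTop,
        c₁ * n / Real.log n ^ 2 ≤ muNat n (a n) (1 / 2) ∧
        muNat n (a n) (1 / 2) ≤ c₂ * n / Real.log n ^ 2) →
      ∃ C : ℝ, Tendsto (fun n : ℕ => gnpProb n (1 / 2)
          {G | |(boundedChrom (a n - 1) G : ℝ) - (kThresh n (a n - 1) : ℝ)|
            ≤ C * (n : ℝ) ^ (0.99 : ℝ)}) atTop (nhds 1)) :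
    ∃ c : ℝ, 0 < c ∧ ∀ s t : ℕ → ℝ,
      (∀ n : ℕ, 0.9 ≤ gnpProb n (1 / 2) {G | (chrom G : ℝ) ∈ Set.Icc (s n) (t n)}) →
      ∀ N : ℕ, ∃ nstar : ℕ, N ≤ nstar ∧
        c * Real.sqrt nstar * Real.log (Real.log nstar) / Real.log nstar ^ 3
          ≤ t nstar - s nstar := by
  refine ⟨1 / 1000000, by norm_num, fun s t h N => ChromNC.exists_width_ge (fun n => ?_) N⟩
  exact (h n).trans_eq (ChromNC.gnpProb_half n _)
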